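/- Voronoï-type expansion: let ω ∈ Ω and ε > 0. There exist C > 0 and X₀ > 0 such that for every X ≥ X₀ and every x ∈ (X, 2X), |Ê(x;ω) − (2^{3/2}/π)·∑_{m ≤ X²} (r₂(m)/m)·sin(π·√m·ω(x))·sin(π·√m·(2x+ω(x))) + 2·x^{−2}·Ξ_ψ(x;ω)| ≤ C·X^{−1+ε}. -/

import Mathlib

open MeasureTheory Filter Real

noncomputable section

/-- The Cygan–Korányi norm on `ℝ³`. -/
def cyganNorm (u : ℝ × ℝ × ℝ) : ℝ :=
  ((u.1 ^ 2 + u.2.1 ^ 2) ^ 2 + u.2.2 ^ 2) ^ ((1 : ℝ) / 4)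

/-- The unit ball for the Cygan–Korányi norm. -/
def cyganBall : Set (ℝ × ℝ × ℝ) := {u | cyganNorm u ≤ 1}

/-- The Heisenberg dilation `δ_x`. -/
def heisDil (x : ℝ) (u : ℝ × ℝ × ℝ) : ℝ × ℝ × ℝ := (x * u.1, x * u.2.1, x ^ 2 * u.2.2)

/-- Euclidean volume of the Cygan–Korányi unit ball. -/
def volB : ℝ := (volume cyganBall).toReal

/-- `N(x)`: the number of integer lattice points inside `δ_x B`. -/
def latticeCount (x : ℝ) : ℕ :=
  Set.ncard {p : ℤ × ℤ × ℤ | ((p.1 : ℝ), (p.2.1 : ℝ), (p.2.2 : ℝ)) ∈ heisDil x '' cyganBall}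

/-- The error term `E(x;ω)` for the shell count. -/
def Eshell (ω : ℝ → ℝ) (x : ℝ) : ℝ :=
  ((latticeCount (x + ω x) : ℝ) - (latticeCount x : ℝ))
    - volB * ∑ j ∈ Finset.Icc 1 4, (Nat.choose 4 j : ℝ) * x ^ (4 - j) * ω x ^ j

/-- The normalized error term `Ê(x;ω) = E(x;ω)/x²`. -/
def Ehat (ω : ℝ → ℝ) (x : ℝ) : ℝ := Eshell ω x / x ^ 2

/-- `σ(X;ω)`, the square root of the variance of `Ê(x;ω)` over `[X,2X]`. -/
def sigmaShell (ω : ℝ → ℝ) (X : ℝ) : ℝ :=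
  Real.sqrt ((1 / X) * ∫ x in X..(2 * X), Ehat ω x ^ 2)

/-- `M_j(X;ω) = (1/X)·∫_X^{2X} (ω(x)·log ω(x))^j dx`. -/
def Mom (j : ℕ) (X : ℝ) (ω : ℝ → ℝ) : ℝ :=
  (1 / X) * ∫ x in X..(2 * X), (ω x * Real.log (ω x)) ^ j

/-- `L_j(ω) = lim_{X→∞} M_j(X;ω)/M_2(X;ω)^{j/2}`. -/
def Llim (ω : ℝ → ℝ) (j : ℕ) : ℝ :=
  limUnder atTop fun X => Mom j X ω / Mom 2 X ω ^ (j / 2)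

/-- The Gaussian moment factor `j!/(2^{j/2}·(j/2)!)`. -/
def gaussMoment (j : ℕ) : ℝ :=
  (Nat.factorial j : ℝ) / (2 ^ (j / 2) * (Nat.factorial (j / 2) : ℝ))

/-- The regularity class `Ω` of gap width functions. -/
structure OmegaClass (ω : ℝ → ℝ) : Prop where
  contDiff : ContDiffOn ℝ 2 ω (Set.Ioi 0)
  pos : ∀ x, 0 < x → 0 < ω x
  tendsto_zero : Tendsto ω atTop (nhds 0)
  deriv_small : ∀ᶠ x in atTop, |deriv ω x| < 1 / 2
  zeros_bound : ∃ C > (0 : ℝ), ∃ ξ > (0 : ℝ), ∀ᶠ X in atTop,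
    {x ∈ Set.Icc X (2 * X) | deriv ω x = 0}.Finite ∧
    {x ∈ Set.Icc X (2 * X) | deriv (deriv ω) x = 0}.Finite ∧
    ({x ∈ Set.Icc X (2 * X) | deriv ω x = 0}.ncard : ℝ) *
        sSup (ω '' Set.Icc X (2 * X)) ≤ C * X ^ ((1 : ℝ) / 2) ∧
    ({x ∈ Set.Icc X (2 * X) | deriv (deriv ω) x = 0}.ncard : ℝ) ≤ C * X ^ (1 - ξ)
  mom2_lower : ∀ α > (0 : ℝ), ∃ c > (0 : ℝ), ∀ᶠ X in atTop, c * X ^ (-α) ≤ Mom 2 X ω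
  Llim_exists : ∀ j : ℕ, Even j →
    Tendsto (fun X => Mom j X ω / Mom 2 X ω ^ (j / 2)) atTop (nhds (Llim ω j))
  carleman : Tendsto (fun n => ∑ k ∈ Finset.range n,
      (gaussMoment (2 * (k + 1)) * Llim ω (2 * (k + 1))) ^
        ((-1 : ℝ) / (2 * ((k : ℝ) + 1)))) atTop atTop

/-- `r₂(m)`: the number of representations of `m` as a sum of two integer squares. -/
def r2 (m : ℕ) : ℕ := Set.ncard {p : ℤ × ℤ | p.1 ^ 2 + p.2 ^ 2 = (m : ℤ)}

/-- The sawtooth function `ψ(t) = t − ⌊t⌋ − 1/2`. -/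
def sawtooth (t : ℝ) : ℝ := t - ⌊t⌋ - 1 / 2

/-- The sawtooth sum `Ξ_ψ(x;ω)`. -/
def XiPsi (ω : ℝ → ℝ) (x : ℝ) : ℝ :=
  (∑ m ∈ Finset.Icc 1 ⌊(x + ω x) ^ 2⌋₊,
      (r2 m : ℝ) * sawtooth (Real.sqrt ((x + ω x) ^ 4 - (m : ℝ) ^ 2)))
    - ∑ m ∈ Finset.Icc 1 ⌊x ^ 2⌋₊, (r2 m : ℝ) * sawtooth (Real.sqrt (x ^ 4 - (m : ℝ) ^ 2))

/-- Gaussian integers of norm `n`. -/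
def gaussR (n : ℕ) : Set GaussianInt := {z | Zsqrtd.norm z = (n : ℤ)}

lemma sq_sum_finite (n : ℕ) : {p : ℤ × ℤ | p.1 ^ 2 + p.2 ^ 2 = (n : ℤ)}.Finite := by
  apply Set.Finite.subset (Set.Finite.prod (Set.finite_Icc (-(n:ℤ)) n) (Set.finite_Icc (-(n:ℤ)) n))
  rintro ⟨a, b⟩ h
  simp only [Set.mem_ofPred_eq] at h
  simp only [Set.mem_prod, Set.mem_Icc]
  have key : ∀ a b : ℤ, a ^ 2 + b ^ 2 = n → -(n:ℤ) ≤ a ∧ a ≤ n := by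
    intro a b h
    have h1 : |a| ≤ a ^ 2 := by
      rw [← sq_abs]
      rcases (abs_nonneg a).eq_or_lt with h | h
      · rw [← h]; norm_num
      · nlinarith
    have := abs_le.mp (h1.trans (by nlinarith [sq_nonneg b] : a ^ 2 ≤ (n:ℤ)))
    exact this
  exact ⟨key a b h, key b a (by linarith)⟩

lemma gaussR_eq_image (n : ℕ) :
    gaussR n = (fun p : ℤ × ℤ => (⟨p.1, p.2⟩ : GaussianInt)) ''
      {p : ℤ × ℤ | p.1 ^ 2 + p.2 ^ 2 = (n : ℤ)} := by
  ext z
  simp only [gaussR, Set.mem_ofPred_eq, Set.mem_image, Prod.exists, Zsqrtd.norm_def]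
  constructor
  · intro h
    exact ⟨z.re, z.im, by linarith, rfl⟩
  · rintro ⟨a, b, h, rfl⟩
    simp only
    linarith

lemma gaussR_finite (n : ℕ) : (gaussR n).Finite := by
  rw [gaussR_eq_image]
  exact (sq_sum_finite n).image _

lemma r2_eq (n : ℕ) : r2 n = (gaussR n).ncard := by
  rw [gaussR_eq_image, Set.ncard_image_of_injective]
  · rfl
  · rintro ⟨a, b⟩ ⟨c, d⟩ h
    simp only [Zsqrtd.mk.injEq] at h
    simp [h.1, h.2]

lemma gauss_irred_of_norm_prime {p : ℕ} (hp : p.Prime) {z : GaussianInt}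
    (hz : Zsqrtd.norm z = (p : ℤ)) : Prime z := by
  have hir : Irreducible z := by
    constructor
    · intro hu
      rw [← Zsqrtd.norm_eq_one_iff, hz] at hu
      simp at hu
      exact hp.one_lt.ne' hu
    · intro a b hab
      have h := congrArg (fun w => (Zsqrtd.norm w).natAbs) hab
      simp only [Zsqrtd.norm_mul, Int.natAbs_mul, hz, Int.natAbs_natCast] at h
      rw [← Zsqrtd.norm_eq_one_iff, ← Zsqrtd.norm_eq_one_iff]
      rcases hp.eq_one_or_self_of_dvd _ ⟨_, h⟩ with h1 | h1
      · exact Or.inl h1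
      · right
        rw [h1] at h
        have := hp.pos
        nlinarith [Nat.eq_of_mul_eq_mul_left this (by linarith : p * 1 = p * b.norm.natAbs)]
  exact hir.prime

lemma gauss_split {p : ℕ} (hp : p.Prime) {w : GaussianInt} (hw : Zsqrtd.norm w = (p : ℤ)) (m : ℕ)
    (e : ℕ) : ∀ z ∈ gaussR (p ^ e * m), ∃ i ∈ Finset.range (e + 1), ∃ z' ∈ gaussR m,
      z = w ^ i * (star w) ^ (e - i) * z' := by
  induction e with
  | zero =>
    intro z hz
    exact ⟨0, by simp, z, by simpa using hz, by simp⟩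
  | succ e ih =>
    intro z hz
    have hwp := gauss_irred_of_norm_prime hp hw
    have hp0 : (p : ℤ) ≠ 0 := by exact_mod_cast hp.ne_zero
    have h1 : w ∣ z * star z := by
      rw [← Zsqrtd.norm_eq_mul_conj, show Zsqrtd.norm z = _ from hz]
      have : w ∣ ((p : ℤ) : GaussianInt) := by
        rw [← hw, Zsqrtd.norm_eq_mul_conj]; exact dvd_mul_right _ _
      push_cast
      rw [pow_succ]
      push_cast at this
      exact Dvd.dvd.mul_right (Dvd.dvd.mul_left this _) _
    have hz' : Zsqrtd.norm z = (p : ℤ) * ((p ^ e * m : ℕ) : ℤ) := by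
      rw [show Zsqrtd.norm z = _ from hz]; push_cast; ring
    rcases hwp.dvd_or_dvd h1 with h | h
    · obtain ⟨q, rfl⟩ := h
      rw [Zsqrtd.norm_mul, hw] at hz'
      have hq : q ∈ gaussR (p ^ e * m) := mul_left_cancel₀ hp0 hz'
      obtain ⟨i, hi, z', hz2, rfl⟩ := ih q hq
      simp only [Finset.mem_range] at hi
      refine ⟨i + 1, by simp; omega, z', hz2, ?_⟩
      rw [show e + 1 - (i + 1) = e - i by omega]; ring
    · obtain ⟨q, hq⟩ := h
      have hzq : z = star w * star q := by
        rw [← star_star z, hq, star_mul, mul_comm]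
      rw [hzq, Zsqrtd.norm_mul, Zsqrtd.norm_conj, hw] at hz'
      have hq : star q ∈ gaussR (p ^ e * m) := mul_left_cancel₀ hp0 hz'
      obtain ⟨i, hi, z', hz', hh⟩ := ih _ hq
      simp only [Finset.mem_range] at hi
      refine ⟨i, by simp; omega, z', hz', ?_⟩
      rw [hzq, hh, show e + 1 - i = e - i + 1 by omega]; ring

lemma gauss_card_split {p : ℕ} (hp : p.Prime) {w : GaussianInt} (hw : Zsqrtd.norm w = (p : ℤ))
    (m : ℕ) (e : ℕ) : (gaussR (p ^ e * m)).ncard ≤ (e + 1) * (gaussR m).ncard := by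
  classical
  have hsub : gaussR (p ^ e * m) ⊆ (fun q : ℕ × GaussianInt => w ^ q.1 * (star w) ^ (e - q.1) * q.2)
      '' ((Finset.range (e + 1) : Set ℕ) ×ˢ gaussR m) := by
    intro z hz
    obtain ⟨i, hi, z', hz', h⟩ := gauss_split hp hw m e z hz
    exact ⟨(i, z'), ⟨hi, hz'⟩, h.symm⟩
  have hfin : ((Finset.range (e + 1) : Set ℕ) ×ˢ gaussR m).Finite :=
    (Finset.finite_toSet _).prod (gaussR_finite m)
  refine (Set.ncard_le_ncard hsub (hfin.image _)).trans ((Set.ncard_image_le hfin).trans ?_)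
  rw [Set.ncard_prod, Set.ncard_coe_finset, Finset.card_range]

lemma gauss_card_inert {p : ℕ} (hp : p.Prime) (hpi : Prime (p : GaussianInt)) (m : ℕ)
    (hpm : ¬ p ∣ m) (e : ℕ) : (gaussR (p ^ e * m)).ncard ≤ (gaussR m).ncard := by
  have hp0 : (p : ℤ) ≠ 0 := by exact_mod_cast hp.ne_zero
  have hdiv : ∀ l : ℕ, ∀ z ∈ gaussR (p * l), ∃ q, z = (p : GaussianInt) * q ∧
      (p : ℤ) * Zsqrtd.norm q = l := by
    intro l z hz
    have h1 : (p : GaussianInt) ∣ z * star z := by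
      rw [← Zsqrtd.norm_eq_mul_conj, show Zsqrtd.norm z = _ from hz]
      push_cast
      exact dvd_mul_right _ _
    have h2 : (p : GaussianInt) ∣ z := by
      rcases hpi.dvd_or_dvd h1 with h | h
      · exact h
      · obtain ⟨q, hq⟩ := h
        refine ⟨star q, ?_⟩
        rw [← star_star z, hq, star_mul, mul_comm]
        simp
    obtain ⟨q, rfl⟩ := h2
    refine ⟨q, rfl, ?_⟩
    have : Zsqrtd.norm ((p : GaussianInt) * q) = ((p * l : ℕ) : ℤ) := hz
    rw [Zsqrtd.norm_mul, Zsqrtd.norm_natCast] at this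
    push_cast at this
    apply mul_left_cancel₀ hp0
    linarith
  induction e using Nat.strong_induction_on with
  | _ e ih =>
    match e with
    | 0 => simp
    | 1 =>
      have : gaussR (p ^ 1 * m) = ∅ := by
        rw [Set.eq_empty_iff_forall_notMem]
        intro z hz
        rw [pow_one] at hz
        obtain ⟨q, -, h⟩ := hdiv m z hz
        apply hpm
        have : (p : ℤ) ∣ (m : ℤ) := ⟨_, h.symm⟩
        exact_mod_cast this
      rw [this]; simp
    | e + 2 =>
      refine le_trans ?_ (ih e (by omega))
      have hsub : gaussR (p ^ (e + 2) * m) ⊆ (fun q => (p : GaussianInt) * q) ''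
          gaussR (p ^ e * m) := by
        intro z hz
        rw [show p ^ (e + 2) * m = p * (p * (p ^ e * m)) by ring] at hz
        obtain ⟨q, hq, h⟩ := hdiv _ z hz
        refine ⟨q, ?_, hq.symm⟩
        push_cast at h
        have := mul_left_cancel₀ hp0 h
        show Zsqrtd.norm q = _
        rw [this]; push_cast; ring
      exact (Set.ncard_le_ncard hsub ((gaussR_finite _).image _)).trans
        (Set.ncard_image_le (gaussR_finite _))

lemma gauss_card_step {p : ℕ} (hp : p.Prime) (m : ℕ) (hpm : ¬ p ∣ m) (e : ℕ) :
    (gaussR (p ^ e * m)).ncard ≤ (e + 1) * (gaussR m).ncard := by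
  have : Fact p.Prime := ⟨hp⟩
  by_cases hpi : Prime (p : GaussianInt)
  · exact (gauss_card_inert hp hpi m hpm e).trans (Nat.le_mul_of_pos_left _ (by omega))
  · have hir : ¬ Irreducible (p : GaussianInt) := fun h => hpi h.prime
    obtain ⟨a, b, hab⟩ := GaussianInt.sq_add_sq_of_nat_prime_of_not_irreducible p hir
    apply gauss_card_split hp (w := ⟨a, b⟩)
    rw [Zsqrtd.norm_def]
    simp only
    rw [← hab]; push_cast; ring

lemma gauss_card_le (n : ℕ) (hn : n ≠ 0) : (gaussR n).ncard ≤ (gaussR 1).ncard * n.divisors.card := by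
  induction n using Nat.strong_induction_on with
  | _ n ih =>
    by_cases h1 : n = 1
    · subst h1; simp
    · have hp := Nat.minFac_prime h1
      set p := n.minFac with hpdef
      have hm0 : n / p ^ n.factorization p ≠ 0 := (Nat.ordCompl_pos p hn).ne'
      have hpm := Nat.not_dvd_ordCompl hp hn
      have hlt : n / p ^ n.factorization p < n := by
        apply Nat.div_lt_self (Nat.pos_of_ne_zero hn)
        apply Nat.one_lt_pow _ hp.one_lt
        have := hp.factorization_pos_of_dvd hn (Nat.minFac_dvd n)
        omega
      have hmul := Nat.ordProj_mul_ordCompl_eq_self n p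
      have hcop := (Nat.Prime.coprime_iff_not_dvd hp).2 hpm
      have := ih _ hlt hm0
      have h2 := gauss_card_step hp _ hpm (n.factorization p)
      rw [hmul] at h2
      refine h2.trans ?_
      have h3 : n.divisors.card = (n.factorization p + 1) * (n / p ^ n.factorization p).divisors.card := by
        conv_lhs => rw [← hmul]
        rw [Nat.Coprime.card_divisors_mul (Nat.Coprime.pow_left _ hcop),
          Nat.divisors_prime_pow hp]
        simp
      rw [h3]
      calc _ ≤ (n.factorization p + 1) * ((gaussR 1).ncard * (n / p ^ n.factorization p).divisors.card) := by gcongr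
        _ = _ := by ring

lemma divisor_bound (ε : ℝ) (hε : 0 < ε) : ∃ C > (0:ℝ), ∀ n : ℕ, n ≠ 0 →
    (n.divisors.card : ℝ) ≤ C * (n : ℝ) ^ ε := by
  set M : ℝ := max 1 (1 / (ε * Real.log 2)) with hM
  have hM1 : 1 ≤ M := le_max_left _ _
  set P : ℕ := ⌈(2:ℝ) ^ (1 / ε)⌉₊ with hP
  have hl2 : 0 < ε * Real.log 2 := mul_pos hε (Real.log_pos (by norm_num))
  have two_pow : ∀ e : ℕ, ((e : ℝ) + 1) ≤ 2 ^ e := by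
    intro e
    have := Nat.lt_two_pow_self (n := e)
    have h : e + 1 ≤ 2 ^ e := this
    exact_mod_cast h
  have key : ∀ p : ℕ, p.Prime → ∀ e : ℕ, ((e : ℝ) + 1) ≤ (if p < P then M else 1) * ((p : ℝ) ^ e) ^ ε := by
    intro p hp e
    have hp2 : (2:ℝ) ≤ p := by exact_mod_cast hp.two_le
    have hp0 : (0:ℝ) < p := by linarith
    have hre : ((p : ℝ) ^ e) ^ ε = ((p : ℝ) ^ ε) ^ e := by
      rw [← Real.rpow_natCast, ← Real.rpow_natCast, ← Real.rpow_mul hp0.le, ← Real.rpow_mul hp0.le, mul_comm]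
    split_ifs with h
    · have h1 : 1 + ε * Real.log 2 * e ≤ ((p : ℝ) ^ e) ^ ε := by
        calc 1 + ε * Real.log 2 * e ≤ Real.exp (ε * Real.log 2 * e) := by
              linarith [Real.add_one_le_exp (ε * Real.log 2 * e)]
          _ = ((2 : ℝ) ^ e) ^ ε := by
              rw [← Real.rpow_natCast, ← Real.rpow_mul (by norm_num), Real.rpow_def_of_pos (by norm_num)]
              ring_nf
          _ ≤ _ := by
              apply Real.rpow_le_rpow (by positivity) _ hε.le
              gcongr
      have h2 : 1 ≤ M * (ε * Real.log 2) := by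
        calc (1:ℝ) = 1 / (ε * Real.log 2) * (ε * Real.log 2) := by field_simp
          _ ≤ _ := by gcongr; exact le_max_right _ _
      calc (e:ℝ) + 1 ≤ M * (ε * Real.log 2) * e + M := by nlinarith [Nat.cast_nonneg (α := ℝ) e]
        _ = M * (1 + ε * Real.log 2 * e) := by ring
        _ ≤ _ := by gcongr
    · rw [one_mul, hre]
      refine (two_pow e).trans ?_
      gcongr
      have h3 : (2:ℝ) ^ (1/ε) ≤ p := (Nat.le_ceil _).trans (by exact_mod_cast (not_lt.mp h))
      calc (2:ℝ) = ((2:ℝ) ^ (1/ε)) ^ ε := by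
            rw [← Real.rpow_mul (by norm_num)]; field_simp; simp
        _ ≤ _ := Real.rpow_le_rpow (by positivity) h3 hε.le
  refine ⟨M ^ P, by positivity, fun n hn => ?_⟩
  rw [Nat.card_divisors hn]
  push_cast
  calc ∏ x ∈ n.primeFactors, ((n.factorization x : ℝ) + 1)
      ≤ ∏ x ∈ n.primeFactors, ((if x < P then M else 1) * ((x : ℝ) ^ (n.factorization x)) ^ ε) := by
        apply Finset.prod_le_prod
        · intros; positivity
        · intro x hx
          exact key x (Nat.prime_of_mem_primeFactors hx) _
    _ = (∏ x ∈ n.primeFactors, (if x < P then M else 1)) * (∏ x ∈ n.primeFactors, ((x : ℝ) ^ (n.factorization x))) ^ ε := by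
        rw [Finset.prod_mul_distrib, Real.finsetProd_rpow]
        intros; positivity
    _ ≤ M ^ P * (n : ℝ) ^ ε := by
        have hn' : (∏ x ∈ n.primeFactors, ((x : ℝ) ^ (n.factorization x))) = n := by
          conv_rhs => rw [← Nat.prod_factorization_pow_eq_self hn]
          rw [Finsupp.prod]; push_cast; rfl
        rw [hn']
        gcongr
        rw [Finset.prod_ite, Finset.prod_const, Finset.prod_const_one, mul_one]
        apply pow_le_pow_right₀ hM1
        calc _ ≤ (Finset.range P).card := by
              apply Finset.card_le_card
              intro x hx; simp at hx ⊢; exact hx.2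
          _ = P := by simp

lemma r2_bound (ε : ℝ) (hε : 0 < ε) : ∃ C > (0:ℝ), ∀ n : ℕ, n ≠ 0 →
    (r2 n : ℝ) ≤ C * (n : ℝ) ^ ε := by
  obtain ⟨C, hC, h⟩ := divisor_bound ε hε
  refine ⟨((gaussR 1).ncard + 1) * C, by positivity, fun n hn => ?_⟩
  rw [r2_eq]
  have h1 : ((gaussR n).ncard : ℝ) ≤ (gaussR 1).ncard * n.divisors.card := by
    exact_mod_cast gauss_card_le n hn
  have h2 := h n hn
  calc _ ≤ _ := h1
    _ ≤ ((gaussR 1).ncard + 1) * (C * (n:ℝ)^ε) := by gcongr; linarith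
    _ = _ := by ring

/-- Dirichlet kernel. -/
def dK (N : ℕ) (u : ℝ) : ℝ := 1 + 2 * ∑ j ∈ Finset.range N, Real.cos (2 * π * ((j : ℝ) + 1) * u)

/-- the half-integer frequency -/
def tN (N : ℕ) : ℝ := (N : ℝ) + 1 / 2

lemma tN_pos (N : ℕ) : 0 < tN N := by unfold tN; positivity

lemma dK_sin (N : ℕ) (u : ℝ) : dK N u * Real.sin (π * u) = Real.sin (2 * π * tN N * u) := by
  unfold dK tN
  induction N with
  | zero => simp; ring_nf
  | succ n ih =>
    rw [Finset.sum_range_succ, mul_add, ← add_assoc, add_mul, ih]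
    have h := Real.sin_sub_sin (2 * π * (((n + 1 : ℕ) : ℝ) + 1 / 2) * u) (2 * π * ((n : ℝ) + 1 / 2) * u)
    have e1 : (2 * π * (((n + 1 : ℕ) : ℝ) + 1 / 2) * u - 2 * π * ((n : ℝ) + 1 / 2) * u) / 2 = π * u := by
      push_cast; ring
    have e2 : (2 * π * (((n + 1 : ℕ) : ℝ) + 1 / 2) * u + 2 * π * ((n : ℝ) + 1 / 2) * u) / 2
        = 2 * π * ((n : ℝ) + 1) * u := by
      push_cast; ring
    rw [e1, e2] at h
    linarith

@[fun_prop]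
lemma dK_cont (N : ℕ) : Continuous (dK N) := by unfold dK; fun_prop

lemma dK_even (N : ℕ) (u : ℝ) : dK N (-u) = dK N u := by
  unfold dK
  simp [mul_neg, Real.cos_neg]

lemma dK_abs_le (N : ℕ) (u : ℝ) : |dK N u| ≤ 2 * tN N := by
  unfold dK tN
  have h : |∑ j ∈ Finset.range N, Real.cos (2 * π * ((j : ℝ) + 1) * u)| ≤ N := by
    calc _ ≤ ∑ j ∈ Finset.range N, |Real.cos (2 * π * ((j : ℝ) + 1) * u)| := Finset.abs_sum_le_sum_abs _ _
      _ ≤ ∑ j ∈ Finset.range N, (1:ℝ) := Finset.sum_le_sum (fun j _ => Real.abs_cos_le_one _)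
      _ = N := by simp
  rw [abs_le] at h ⊢
  constructor <;> linarith

lemma dK_integral (N : ℕ) : ∫ u in (0:ℝ)..(1/2), dK N u = 1 / 2 := by
  unfold dK
  rw [intervalIntegral.integral_add (by simp) (by apply Continuous.intervalIntegrable; fun_prop),
    intervalIntegral.integral_const_mul, intervalIntegral.integral_finsetSum]
  · have : ∀ j ∈ Finset.range N, ∫ u in (0:ℝ)..(1/2), Real.cos (2 * π * ((j : ℝ) + 1) * u) = 0 := by
      intro j _
      have hc : (2 * π * ((j : ℝ) + 1)) ≠ 0 := by positivity
      rw [intervalIntegral.integral_comp_mul_left (fun x => Real.cos x) hc, integral_cos]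
      have : 2 * π * ((j : ℝ) + 1) * (1 / 2) = ((j + 1 : ℕ) : ℝ) * π := by push_cast; ring
      rw [this, Real.sin_nat_mul_pi]
      simp
    rw [Finset.sum_eq_zero this]
    simp
  · intro j _
    apply Continuous.intervalIntegrable; fun_prop

lemma sin_pi_ge {t : ℝ} (h0 : 0 ≤ t) (h1 : t ≤ 1 / 2) : 2 * t ≤ Real.sin (π * t) := by
  have := Real.mul_le_sin (x := π * t) (by positivity) (by nlinarith [Real.pi_pos])
  calc 2 * t = 2 / π * (π * t) := by field_simp
    _ ≤ _ := this

lemma cos_pi_nonneg {t : ℝ} (h0 : 0 ≤ t) (h1 : t ≤ 1 / 2) : 0 ≤ Real.cos (π * t) := by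
  apply Real.cos_nonneg_of_mem_Icc
  constructor <;> nlinarith [Real.pi_pos]

lemma hd_sin (c x : ℝ) : HasDerivAt (fun u => Real.sin (c * u)) (Real.cos (c * x) * c) x := by
  simpa using ((hasDerivAt_id' x).const_mul c).sin

lemma hd_cos (c x : ℝ) : HasDerivAt (fun u => Real.cos (c * u)) (-Real.sin (c * x) * c) x := by
  simpa using ((hasDerivAt_id' x).const_mul c).cos

/-- oscillatory integral bound -/
lemma osc_bound {a b B : ℝ} (hab : a ≤ b) {G γ φ φ' : ℝ → ℝ}
    (hG : ∀ x, HasDerivAt G (γ x) x) (hγ : Continuous γ) (hB : ∀ x, |G x| ≤ B)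
    (hφ : ∀ x ∈ Set.Icc a b, HasDerivAt φ (φ' x) x) (hφ' : ContinuousOn φ' (Set.Icc a b))
    (hneg : ∀ x ∈ Set.Icc a b, φ' x ≤ 0) (hb : 0 ≤ φ b) :
    |∫ u in a..b, γ u * φ u| ≤ 2 * B * φ a := by
  have hu : Set.uIcc a b = Set.Icc a b := Set.uIcc_of_le hab
  have hi' : IntervalIntegrable φ' volume a b := by
    apply ContinuousOn.intervalIntegrable; rwa [hu]
  have hB0 : 0 ≤ B := (abs_nonneg _).trans (hB 0)
  have h1 : ∫ u in a..b, φ' u = φ b - φ a :=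
    intervalIntegral.integral_eq_sub_of_hasDerivAt (by rw [hu]; exact hφ) hi'
  have hGc : Continuous G := continuous_iff_continuousAt.2 fun x => (hG x).continuousAt
  have h2 := intervalIntegral.integral_mul_deriv_eq_deriv_mul (a := a) (b := b) (u := φ) (v := G)
    (u' := φ') (v' := γ) (by rw [hu]; exact hφ) (fun x _ => hG x) hi' (hγ.intervalIntegrable _ _)
  have h3 : ∫ u in a..b, γ u * φ u = ∫ u in a..b, φ u * γ u := by
    congr 1; ext; ring
  have h4 : |∫ u in a..b, φ' u * G u| ≤ B * (φ a - φ b) := by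
    have : ‖∫ u in a..b, φ' u * G u‖ ≤ ∫ u in a..b, -(B * φ' u) := by
      apply intervalIntegral.norm_integral_le_of_norm_le hab
      · refine Filter.Eventually.of_forall fun x hx => ?_
        rw [Real.norm_eq_abs, abs_mul, abs_of_nonpos (hneg x ⟨hx.1.le, hx.2⟩)]
        have := hB x
        have h := hneg x ⟨hx.1.le, hx.2⟩
        nlinarith
      · exact (hi'.const_mul B).neg
    rw [Real.norm_eq_abs] at this
    refine this.trans (le_of_eq ?_)
    rw [intervalIntegral.integral_neg, intervalIntegral.integral_const_mul, h1]; ring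
  rw [h3, h2]
  have hφa : φ b ≤ φ a := by
    have : 0 ≤ ∫ u in a..b, - φ' u := intervalIntegral.integral_nonneg hab (fun x hx => by
      linarith [hneg x hx])
    rw [intervalIntegral.integral_neg, h1] at this
    linarith
  have ha1 := abs_le.1 (hB a)
  have hb1 := abs_le.1 (hB b)
  have := abs_le.1 h4
  rw [abs_le]
  constructor <;> nlinarith

lemma osc_cos {a b c : ℝ} (hc : 0 < c) (hab : a ≤ b) {φ φ' : ℝ → ℝ}
    (hφ : ∀ x ∈ Set.Icc a b, HasDerivAt φ (φ' x) x) (hφ' : ContinuousOn φ' (Set.Icc a b))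
    (hneg : ∀ x ∈ Set.Icc a b, φ' x ≤ 0) (hb : 0 ≤ φ b) :
    |∫ u in a..b, Real.cos (c * u) * φ u| ≤ 2 * (1 / c) * φ a := by
  apply osc_bound hab (G := fun u => Real.sin (c * u) / c) _ (by fun_prop) _ hφ hφ' hneg hb
  · intro x
    refine ((hd_sin c x).div_const c).congr_deriv ?_
    field_simp
  · intro x
    rw [abs_div, abs_of_pos hc]
    gcongr; exact Real.abs_sin_le_one _

lemma osc_sin {a b c : ℝ} (hc : 0 < c) (hab : a ≤ b) {φ φ' : ℝ → ℝ}
    (hφ : ∀ x ∈ Set.Icc a b, HasDerivAt φ (φ' x) x) (hφ' : ContinuousOn φ' (Set.Icc a b))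
    (hneg : ∀ x ∈ Set.Icc a b, φ' x ≤ 0) (hb : 0 ≤ φ b) :
    |∫ u in a..b, Real.sin (c * u) * φ u| ≤ 2 * (1 / c) * φ a := by
  apply osc_bound hab (G := fun u => -Real.cos (c * u) / c) _ (by fun_prop) _ hφ hφ' hneg hb
  · intro x
    refine (((hd_cos c x).fun_neg).div_const c).congr_deriv ?_
    field_simp
  · intro x
    rw [abs_div, abs_of_pos hc, abs_neg]
    gcongr; exact Real.abs_cos_le_one _

/-- first tail integral of the kernel -/
def jK (N : ℕ) (t : ℝ) : ℝ := ∫ u in t..(1/2), dK N u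
/-- second tail integral of the kernel -/
def kK (N : ℕ) (t : ℝ) : ℝ := ∫ u in t..(1/2), jK N u

lemma jK_deriv (N : ℕ) (t : ℝ) : HasDerivAt (jK N) (-dK N t) t := by
  unfold jK
  exact intervalIntegral.integral_hasDerivAt_left ((dK_cont N).intervalIntegrable _ _)
    ((dK_cont N).stronglyMeasurableAtFilter _ _) (dK_cont N).continuousAt

@[fun_prop]
lemma jK_cont (N : ℕ) : Continuous (jK N) :=
  continuous_iff_continuousAt.2 fun x => (jK_deriv N x).continuousAt

lemma kK_deriv (N : ℕ) (t : ℝ) : HasDerivAt (kK N) (-jK N t) t := by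
  unfold kK
  exact intervalIntegral.integral_hasDerivAt_left ((jK_cont N).intervalIntegrable _ _)
    ((jK_cont N).stronglyMeasurableAtFilter _ _) (jK_cont N).continuousAt

@[fun_prop]
lemma kK_cont (N : ℕ) : Continuous (kK N) :=
  continuous_iff_continuousAt.2 fun x => (kK_deriv N x).continuousAt

lemma csc_deriv {x : ℝ} (h : Real.sin (π * x) ≠ 0) :
    HasDerivAt (fun u => 1 / Real.sin (π * u)) (-(π * Real.cos (π * x) / Real.sin (π * x) ^ 2)) x := by
  have h1 : HasDerivAt (fun u => Real.sin (π * u)) (Real.cos (π * x) * π) x := hd_sin π x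
  simp only [one_div]
  refine (h1.fun_inv h).congr_deriv ?_
  field_simp

lemma csc2_deriv {x : ℝ} (h : Real.sin (π * x) ≠ 0) :
    HasDerivAt (fun u => π * Real.cos (π * u) / Real.sin (π * u) ^ 2)
      (-(π ^ 2 * (Real.sin (π * x) ^ 2 + 2 * Real.cos (π * x) ^ 2) / Real.sin (π * x) ^ 3)) x := by
  have h1 : HasDerivAt (fun u => Real.sin (π * u)) (Real.cos (π * x) * π) x := hd_sin π x
  have h2 : HasDerivAt (fun u => Real.cos (π * u)) (-Real.sin (π * x) * π) x := hd_cos π x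
  refine ((h2.const_mul π).fun_div (h1.fun_pow 2) (pow_ne_zero 2 h)).congr_deriv ?_
  field_simp
  norm_num
  ring

lemma sin_pi_pos {t : ℝ} (h0 : 0 < t) (h1 : t ≤ 1 / 2) : 0 < Real.sin (π * t) :=
  lt_of_lt_of_le (by linarith) (sin_pi_ge h0.le h1)

lemma dK_eq_div (N : ℕ) {u : ℝ} (h0 : 0 < u) (h1 : u ≤ 1 / 2) :
    dK N u = Real.sin (2 * π * tN N * u) * (1 / Real.sin (π * u)) := by
  rw [← dK_sin]
  field_simp [(sin_pi_pos h0 h1).ne']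

lemma jK_bound_csc (N : ℕ) {t : ℝ} (h0 : 0 < t) (h1 : t ≤ 1 / 2) :
    |jK N t| ≤ 2 * (1 / (2 * π * tN N)) * (1 / Real.sin (π * t)) := by
  have hT := tN_pos N
  unfold jK
  rw [intervalIntegral.integral_congr (g := fun u => Real.sin (2 * π * tN N * u) * (1 / Real.sin (π * u)))]
  · apply osc_sin (by positivity) h1 (fun x hx => csc_deriv (sin_pi_pos (h0.trans_le hx.1) hx.2).ne')
    · apply ContinuousOn.neg
      apply ContinuousOn.div (by fun_prop) (by fun_prop)
      intro x hx
      exact pow_ne_zero 2 (sin_pi_pos (h0.trans_le hx.1) hx.2).ne'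
    · intro x hx
      have := cos_pi_nonneg (h0.le.trans hx.1) hx.2
      have := Real.pi_pos
      rw [neg_nonpos]; positivity
    · have := sin_pi_pos (t := 1/2) (by norm_num) le_rfl
      positivity
  · intro u hu
    rw [Set.uIcc_of_le h1] at hu
    exact dK_eq_div N (h0.trans_le hu.1) hu.2

lemma jK_bound (N : ℕ) {t : ℝ} (h0 : 0 < t) (h1 : t ≤ 1 / 2) :
    |jK N t| ≤ 1 / (tN N * t) := by
  have hT := tN_pos N
  refine (jK_bound_csc N h0 h1).trans ?_
  have hs := sin_pi_ge h0.le h1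
  have : 1 / Real.sin (π * t) ≤ 1 / (2 * t) := by gcongr
  calc _ ≤ 2 * (1 / (2 * π * tN N)) * (1 / (2 * t)) := by gcongr
    _ = (1 / (2 * π)) * (1 / (tN N * t)) := by field_simp
    _ ≤ 1 * (1 / (tN N * t)) := by
      gcongr
      rw [div_le_one (by positivity)]
      nlinarith [Real.pi_gt_three]
    _ = _ := one_mul _

lemma jK_bound' (N : ℕ) {t : ℝ} (h0 : 0 ≤ t) (h1 : t ≤ 1 / 2) : |jK N t| ≤ 3 := by
  have hT := tN_pos N
  by_cases h : tN N * t ≤ 1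
  · have e : jK N t = 1 / 2 - ∫ u in (0:ℝ)..t, dK N u := by
      rw [← dK_integral N, jK, sub_eq_add_neg, ← intervalIntegral.integral_symm, add_comm,
        intervalIntegral.integral_add_adjacent_intervals] <;>
      exact (dK_cont N).intervalIntegrable _ _
    have h2 : ‖∫ u in (0:ℝ)..t, dK N u‖ ≤ 2 * tN N * |t - 0| :=
      intervalIntegral.norm_integral_le_of_norm_le_const (fun u _ => dK_abs_le N u)
    rw [sub_zero, abs_of_nonneg h0, Real.norm_eq_abs] at h2
    have := abs_le.1 h2
    rw [e, abs_le]
    constructor <;> linarith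
  · push Not at h
    have ht : 0 < t := by
      rcases h0.eq_or_lt with h' | h'
      · rw [← h'] at h; norm_num at h
      · exact h'
    refine (jK_bound N ht h1).trans ?_
    rw [div_le_iff₀ (by positivity)]
    linarith

lemma kK_bound (N : ℕ) {t : ℝ} (h0 : 0 < t) (h1 : t ≤ 1 / 2) :
    |kK N t| ≤ 1 / (tN N ^ 2 * t) := by
  have hT := tN_pos N
  have hpi := Real.pi_pos
  have hspos : ∀ x ∈ Set.Icc t (1/2), 0 < Real.sin (π * x) :=
    fun x hx => sin_pi_pos (h0.trans_le hx.1) hx.2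
  set c := 2 * π * tN N with hc
  have hcpos : 0 < c := by positivity
  -- expansion of jK
  have hcos12 : Real.cos (c * (1/2)) = 0 := by
    rw [hc, tN, Real.cos_eq_zero_iff]
    exact ⟨N, by push_cast; ring⟩
  have hJ : ∀ s ∈ Set.Icc t (1/2), |jK N s - Real.cos (c * s) * (1 / Real.sin (π * s)) / c| ≤
      1 / c * (2 * (1 / c) * (π * Real.cos (π * s) / Real.sin (π * s) ^ 2)) := by
    intro s hs
    have hs0 : 0 < s := h0.trans_le hs.1
    have hsp : ∀ x ∈ Set.Icc s (1/2), 0 < Real.sin (π * x) :=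
      fun x hx => sin_pi_pos (hs0.trans_le hx.1) hx.2
    have hu : Set.uIcc s (1/2) = Set.Icc s (1/2) := Set.uIcc_of_le hs.2
    have hcont : ContinuousOn (fun x => -(π * Real.cos (π * x) / Real.sin (π * x) ^ 2)) (Set.Icc s (1/2)) := by
      apply ContinuousOn.neg
      apply ContinuousOn.div (by fun_prop) (by fun_prop)
      intro x hx
      exact pow_ne_zero 2 (hsp x hx).ne'
    have ibp := intervalIntegral.integral_mul_deriv_eq_deriv_mul (a := s) (b := 1/2)
      (u := fun u => 1 / Real.sin (π * u)) (u' := fun x => -(π * Real.cos (π * x) / Real.sin (π * x) ^ 2))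
      (v := fun u => -Real.cos (c * u) / c) (v' := fun u => Real.sin (c * u))
      (by rw [hu]; exact fun x hx => csc_deriv (hsp x hx).ne')
      (by
        intro x _
        refine (((hd_cos c x).fun_neg).div_const c).congr_deriv ?_
        field_simp)
      (by apply ContinuousOn.intervalIntegrable; rwa [hu])
      (by apply Continuous.intervalIntegrable; fun_prop)
    have e1 : jK N s = ∫ u in s..(1/2), (1 / Real.sin (π * u)) * Real.sin (c * u) := by
      unfold jK
      apply intervalIntegral.integral_congr
      intro u huu
      rw [hu] at huu
      simp only
      rw [dK_eq_div N (hs0.trans_le huu.1) huu.2, mul_comm]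
    have e2 : (∫ x in s..(1/2), -(π * Real.cos (π * x) / Real.sin (π * x) ^ 2) * (-Real.cos (c * x) / c))
        = 1 / c * ∫ x in s..(1/2), Real.cos (c * x) * (π * Real.cos (π * x) / Real.sin (π * x) ^ 2) := by
      rw [← intervalIntegral.integral_const_mul]
      congr 1; ext x; ring
    rw [e1, ibp, e2, hcos12]
    have e3 : 1 / Real.sin (π * (1 / 2)) * (-0 / c) - 1 / Real.sin (π * s) * (-Real.cos (c * s) / c) -
        (1 / c * ∫ x in s..(1/2), Real.cos (c * x) * (π * Real.cos (π * x) / Real.sin (π * x) ^ 2)) -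
        Real.cos (c * s) * (1 / Real.sin (π * s)) / c =
        -(1 / c * ∫ x in s..(1/2), Real.cos (c * x) * (π * Real.cos (π * x) / Real.sin (π * x) ^ 2)) := by
      ring
    rw [e3, abs_neg, abs_mul, abs_of_pos (by positivity : 0 < 1 / c)]
    gcongr
    apply osc_cos hcpos hs.2 (fun x hx => csc2_deriv (hsp x hx).ne')
    · apply ContinuousOn.neg
      apply ContinuousOn.div (by fun_prop) (by fun_prop)
      intro x hx
      exact pow_ne_zero 3 (hsp x hx).ne'
    · intro x hx
      have := hsp x hx
      rw [neg_nonpos]; positivity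
    · have h1 := hsp (1/2) ⟨hs.2, le_rfl⟩
      have h2 := cos_pi_nonneg (t := 1/2) (by norm_num) le_rfl
      positivity
  have hu : Set.uIcc t (1/2) = Set.Icc t (1/2) := Set.uIcc_of_le h1
  have hcscc : ContinuousOn (fun s => 1 / Real.sin (π * s)) (Set.Icc t (1/2)) := by
    apply ContinuousOn.div (by fun_prop) (by fun_prop)
    intro x hx
    exact (hspos x hx).ne'
  have hcont : ContinuousOn (fun x => (π * Real.cos (π * x) / Real.sin (π * x) ^ 2)) (Set.Icc t (1/2)) := by
    apply ContinuousOn.div (by fun_prop) (by fun_prop)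
    intro x hx
    exact pow_ne_zero 2 (hspos x hx).ne'
  have hA : |∫ s in t..(1/2), Real.cos (c * s) * (1 / Real.sin (π * s))| ≤ 2 * (1 / c) * (1 / Real.sin (π * t)) := by
    apply osc_cos hcpos h1 (fun x hx => csc_deriv (hspos x hx).ne') hcont.neg
    · intro x hx
      have := cos_pi_nonneg (h0.le.trans hx.1) hx.2
      rw [neg_nonpos]; positivity
    · have := hspos (1/2) ⟨h1, le_rfl⟩
      positivity
  have hint1 : IntervalIntegrable (fun s => Real.cos (c * s) * (1 / Real.sin (π * s)) / c) volume t (1/2) := by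
    apply ContinuousOn.intervalIntegrable
    rw [hu]
    apply ContinuousOn.div_const
    exact ContinuousOn.mul (by fun_prop) hcscc
  have hcsc : ∫ s in t..(1/2), (π * Real.cos (π * s) / Real.sin (π * s) ^ 2) ≤ 1 / Real.sin (π * t) := by
    have := intervalIntegral.integral_eq_sub_of_hasDerivAt (a := t) (b := 1/2)
      (f := fun u => 1 / Real.sin (π * u)) (f' := fun x => -(π * Real.cos (π * x) / Real.sin (π * x) ^ 2))
      (by rw [hu]; exact fun x hx => csc_deriv (hspos x hx).ne')
      (by apply ContinuousOn.intervalIntegrable; rw [hu]; exact hcont.neg)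
    rw [intervalIntegral.integral_neg] at this
    have h2 := hspos (1/2) ⟨h1, le_rfl⟩
    have h3 : 0 < 1 / Real.sin (π * (1/2)) := by positivity
    linarith
  have hB : |∫ s in t..(1/2), (jK N s - Real.cos (c * s) * (1 / Real.sin (π * s)) / c)| ≤
      1 / c * (2 * (1 / c) * (1 / Real.sin (π * t))) := by
    have : ‖∫ s in t..(1/2), (jK N s - Real.cos (c * s) * (1 / Real.sin (π * s)) / c)‖ ≤
        ∫ s in t..(1/2), 1 / c * (2 * (1 / c) * (π * Real.cos (π * s) / Real.sin (π * s) ^ 2)) := by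
      apply intervalIntegral.norm_integral_le_of_norm_le h1
      · exact Filter.Eventually.of_forall fun x hx => hJ x ⟨hx.1.le, hx.2⟩
      · apply ContinuousOn.intervalIntegrable
        rw [hu]
        exact (hcont.const_smul (2 * (1 / c))).const_smul (1 / c)
    rw [Real.norm_eq_abs] at this
    refine this.trans ?_
    rw [intervalIntegral.integral_const_mul, intervalIntegral.integral_const_mul]
    gcongr
  have hsplit : kK N t = (∫ s in t..(1/2), (jK N s - Real.cos (c * s) * (1 / Real.sin (π * s)) / c)) +
      (∫ s in t..(1/2), Real.cos (c * s) * (1 / Real.sin (π * s))) / c := by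
    rw [← intervalIntegral.integral_div, ← intervalIntegral.integral_add _ hint1]
    · unfold kK
      congr 1; ext s; ring
    · exact ((jK_cont N).intervalIntegrable _ _).sub hint1
  have hs := sin_pi_ge h0.le h1
  have hcs : 1 / Real.sin (π * t) ≤ 1 / (2 * t) := by gcongr
  calc |kK N t| ≤ 1 / c * (2 * (1 / c) * (1 / Real.sin (π * t))) + (2 * (1 / c) * (1 / Real.sin (π * t))) / c := by
        rw [hsplit]
        refine (abs_add_le _ _).trans (add_le_add hB ?_)
        rw [abs_div, abs_of_pos hcpos]
        gcongr
    _ = 4 / c ^ 2 * (1 / Real.sin (π * t)) := by field_simp; ring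
    _ ≤ 4 / c ^ 2 * (1 / (2 * t)) := by gcongr
    _ = (1 / (2 * π ^ 2)) * (1 / (tN N ^ 2 * t)) := by rw [hc]; field_simp; norm_num
    _ ≤ 1 * (1 / (tN N ^ 2 * t)) := by
      gcongr
      rw [div_le_one (by positivity)]
      nlinarith [Real.pi_gt_three]
    _ = _ := one_mul _

lemma kK_bound' (N : ℕ) (hN : 2 ≤ N) {t : ℝ} (h0 : 0 ≤ t) (h1 : t ≤ 1 / 2) :
    |kK N t| ≤ 4 / tN N := by
  have hT := tN_pos N
  have hT2 : 2 ≤ tN N := by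
    have : (2:ℝ) ≤ N := by exact_mod_cast hN
    unfold tN; linarith
  have hTi : 1 / tN N ≤ 1 / 2 := by gcongr
  by_cases h : 1 / tN N ≤ t
  · have ht : 0 < t := lt_of_lt_of_le (by positivity) h
    refine (kK_bound N ht h1).trans ?_
    rw [div_le_iff₀ hT] at h
    rw [div_le_div_iff₀ (by positivity) hT]
    nlinarith
  · push Not at h
    have e : kK N t = (∫ u in t..(1 / tN N), jK N u) + kK N (1 / tN N) := by
      unfold kK
      rw [intervalIntegral.integral_add_adjacent_intervals] <;>
      exact (jK_cont N).intervalIntegrable _ _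
    have h2 : ‖∫ u in t..(1 / tN N), jK N u‖ ≤ 3 * |1 / tN N - t| := by
      apply intervalIntegral.norm_integral_le_of_norm_le_const
      intro u hu
      rw [Set.uIoc_of_le h.le] at hu
      exact jK_bound' N (h0.trans hu.1.le) (hu.2.trans hTi)
    rw [abs_of_nonneg (by linarith), Real.norm_eq_abs] at h2
    have h3 := kK_bound N (t := 1 / tN N) (by positivity) hTi
    have h4 : 1 / (tN N ^ 2 * (1 / tN N)) = 1 / tN N := by field_simp
    rw [h4] at h3
    rw [e]
    refine (abs_add_le _ _).trans ?_
    have : 4 / tN N = 4 * (1 / tN N) := by ring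
    rw [this]
    linarith

lemma kK_L1 (N : ℕ) (hN : 2 ≤ N) :
    ∫ t in (0:ℝ)..(1/2), |kK N t| ≤ (4 + Real.log (tN N)) / tN N ^ 2 := by
  have hT := tN_pos N
  have hT2 : 2 ≤ tN N := by
    have : (2:ℝ) ≤ N := by exact_mod_cast hN
    unfold tN; linarith
  have hTi : 1 / tN N ≤ 1 / 2 := by gcongr
  have hT0 : 0 < 1 / tN N := by positivity
  have hc : Continuous (fun t => |kK N t|) := (kK_cont N).abs
  rw [← intervalIntegral.integral_add_adjacent_intervals (b := 1 / tN N) (hc.intervalIntegrable _ _)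
    (hc.intervalIntegrable _ _)]
  have h1 : ∫ t in (0:ℝ)..(1 / tN N), |kK N t| ≤ ∫ t in (0:ℝ)..(1 / tN N), 4 / tN N := by
    apply intervalIntegral.integral_mono_on hT0.le (hc.intervalIntegrable _ _) (by simp)
    intro t ht
    exact kK_bound' N hN ht.1 (ht.2.trans hTi)
  have hinv : ContinuousOn (fun t : ℝ => 1 / tN N ^ 2 * (1 / t)) (Set.uIcc (1 / tN N) (1 / 2)) := by
    apply ContinuousOn.mul (by fun_prop)
    apply ContinuousOn.div (by fun_prop) (by fun_prop)
    intro x hx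
    rw [Set.uIcc_of_le hTi] at hx
    exact (hT0.trans_le hx.1).ne'
  have h2 : ∫ t in (1 / tN N)..(1 / 2), |kK N t| ≤ ∫ t in (1 / tN N)..(1 / 2), 1 / tN N ^ 2 * (1 / t) := by
    apply intervalIntegral.integral_mono_on hTi (hc.intervalIntegrable _ _) hinv.intervalIntegrable
    intro t ht
    have := kK_bound N (hT0.trans_le ht.1) ht.2
    refine this.trans (le_of_eq ?_)
    have := (hT0.trans_le ht.1).ne'
    field_simp
  rw [intervalIntegral.integral_const_mul, integral_one_div_of_pos hT0 (by norm_num)] at h2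
  rw [intervalIntegral.integral_const] at h1
  have h3 : Real.log (1 / 2 / (1 / tN N)) ≤ Real.log (tN N) := by
    apply Real.log_le_log (by positivity)
    rw [div_div_eq_mul_div]; linarith
  have h4 : 1 / tN N ^ 2 * Real.log (1 / 2 / (1 / tN N)) ≤ 1 / tN N ^ 2 * Real.log (tN N) := by gcongr
  have h5 : (1 / tN N - 0) • (4 / tN N) = 4 / tN N ^ 2 := by rw [smul_eq_mul]; field_simp; ring
  rw [h5] at h1
  calc _ ≤ 4 / tN N ^ 2 + 1 / tN N ^ 2 * Real.log (tN N) := by linarith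
    _ = _ := by ring

lemma dK_L1 (N : ℕ) (hN : 2 ≤ N) :
    ∫ t in (0:ℝ)..(1/2), |dK N t| ≤ 4 + Real.log (tN N) := by
  have hT := tN_pos N
  have hT2 : 2 ≤ tN N := by
    have : (2:ℝ) ≤ N := by exact_mod_cast hN
    unfold tN; linarith
  have hTi : 1 / tN N ≤ 1 / 2 := by gcongr
  have hT0 : 0 < 1 / tN N := by positivity
  have hc : Continuous (fun t => |dK N t|) := (dK_cont N).abs
  rw [← intervalIntegral.integral_add_adjacent_intervals (b := 1 / tN N) (hc.intervalIntegrable _ _)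
    (hc.intervalIntegrable _ _)]
  have h1 : ∫ t in (0:ℝ)..(1 / tN N), |dK N t| ≤ ∫ t in (0:ℝ)..(1 / tN N), 2 * tN N := by
    apply intervalIntegral.integral_mono_on hT0.le (hc.intervalIntegrable _ _) (by simp)
    intro t ht
    exact dK_abs_le N t
  have hinv : ContinuousOn (fun t : ℝ => 1 * (1 / t)) (Set.uIcc (1 / tN N) (1 / 2)) := by
    apply ContinuousOn.mul (by fun_prop)
    apply ContinuousOn.div (by fun_prop) (by fun_prop)
    intro x hx
    rw [Set.uIcc_of_le hTi] at hx
    exact (hT0.trans_le hx.1).ne'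
  have h2 : ∫ t in (1 / tN N)..(1 / 2), |dK N t| ≤ ∫ t in (1 / tN N)..(1 / 2), 1 * (1 / t) := by
    apply intervalIntegral.integral_mono_on hTi (hc.intervalIntegrable _ _) hinv.intervalIntegrable
    intro t ht
    have ht0 := hT0.trans_le ht.1
    rw [dK_eq_div N ht0 ht.2, abs_mul]
    have hs := sin_pi_ge ht0.le ht.2
    have hsp := sin_pi_pos ht0 ht.2
    rw [abs_of_pos (by positivity : 0 < 1 / Real.sin (π * t))]
    gcongr
    · exact Real.abs_sin_le_one _
    · linarith
  rw [intervalIntegral.integral_const_mul, integral_one_div_of_pos hT0 (by norm_num)] at h2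
  rw [intervalIntegral.integral_const] at h1
  have h3 : Real.log (1 / 2 / (1 / tN N)) ≤ Real.log (tN N) := by
    apply Real.log_le_log (by positivity)
    rw [div_div_eq_mul_div]; linarith
  have h5 : (1 / tN N - 0) • (2 * tN N) = 2 := by rw [smul_eq_mul]; field_simp; ring
  rw [h5] at h1
  linarith

lemma le_of_forall_small {A B K : ℝ} (hK : 0 ≤ K)
    (h : ∀ η : ℝ, 0 < η → η < 1 / 2 → A ≤ B + K * η) : A ≤ B := by
  by_contra hlt
  push Not at hlt
  set η := min (1 / 4) ((A - B) / (2 * (K + 1))) with hη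
  have h1 : 0 < η := lt_min (by norm_num) (div_pos (by linarith) (by linarith))
  have h2 : η < 1 / 2 := (min_le_left _ _).trans_lt (by norm_num)
  have h3 : η ≤ (A - B) / (2 * (K + 1)) := min_le_right _ _
  rw [le_div_iff₀ (by linarith)] at h3
  nlinarith [h η h1 h2]

lemma q_nonneg {δ a : ℝ} (hδ0 : 0 ≤ δ) (hδ1 : δ ≤ 1) (ha0 : 0 ≤ a) (ha1 : a ≤ π / 2) :
    0 ≤ δ * Real.cos (δ * a) * Real.sin a - Real.sin (δ * a) * Real.cos a := by
  set q : ℝ → ℝ := fun a => δ * Real.cos (δ * a) * Real.sin a - Real.sin (δ * a) * Real.cos a with hq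
  have hd : ∀ x, HasDerivAt q ((1 - δ ^ 2) * (Real.sin (δ * x) * Real.sin x)) x := by
    intro x
    refine ((((hd_cos δ x).const_mul δ).fun_mul (Real.hasDerivAt_sin x)).fun_sub
      ((hd_sin δ x).fun_mul (Real.hasDerivAt_cos x))).congr_deriv ?_
    ring
  have hmono : MonotoneOn q (Set.Icc 0 (π / 2)) := by
    apply monotoneOn_of_deriv_nonneg (convex_Icc _ _)
    · exact (continuous_iff_continuousAt.2 fun x => (hd x).continuousAt).continuousOn
    · exact fun x _ => (hd x).differentiableAt.differentiableWithinAt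
    · intro x hx
      rw [interior_Icc] at hx
      rw [(hd x).deriv]
      have hp := Real.pi_pos
      have h1 : 0 ≤ Real.sin x := Real.sin_nonneg_of_nonneg_of_le_pi hx.1.le (by linarith [hx.2])
      have h2 : 0 ≤ Real.sin (δ * x) := by
        apply Real.sin_nonneg_of_nonneg_of_le_pi (mul_nonneg hδ0 hx.1.le)
        nlinarith [hx.2, hx.1]
      have h3 : 0 ≤ 1 - δ ^ 2 := by nlinarith
      positivity
  have := hmono (Set.left_mem_Icc.2 (by positivity)) ⟨ha0, ha1⟩ ha0
  simpa [hq] using this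

lemma S_eta {τ η : ℝ} (hτ : 0 ≤ τ) (h0 : 0 < η) (h1 : η < 1 / 2) :
    |(∫ u in η..(1/2), Real.sin (2 * π * τ * u) / Real.sin (π * u)) - 1 / 2|
      ≤ 8 / (1 + τ) + 2 * τ * η := by
  have hpi := Real.pi_pos
  have hu : Set.uIcc η (1/2) = Set.Icc η (1/2) := Set.uIcc_of_le h1.le
  have hsp : ∀ x ∈ Set.Icc η (1/2), 0 < Real.sin (π * x) :=
    fun x hx => sin_pi_pos (h0.trans_le hx.1) hx.2
  by_cases hτ2 : τ < 1 / 2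
  · have hb : ‖∫ u in η..(1/2), Real.sin (2 * π * τ * u) / Real.sin (π * u)‖ ≤ (π * τ) * |1/2 - η| := by
      apply intervalIntegral.norm_integral_le_of_norm_le_const
      intro x hx
      rw [Set.uIoc_of_le h1.le] at hx
      have hx' : x ∈ Set.Icc η (1/2) := ⟨hx.1.le, hx.2⟩
      have hx0 : 0 < x := h0.trans hx.1
      have h2 := hsp x hx'
      have h3 := sin_pi_ge hx0.le hx.2
      rw [Real.norm_eq_abs, abs_div, abs_of_pos h2, div_le_iff₀ h2]
      have h4 : |Real.sin (2 * π * τ * x)| ≤ |2 * π * τ * x| := Real.abs_sin_le_abs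
      rw [abs_of_nonneg (by positivity : 0 ≤ 2 * π * τ * x)] at h4
      have : π * τ * (2 * x) ≤ π * τ * Real.sin (π * x) := by gcongr
      linarith
    rw [Real.norm_eq_abs, abs_of_nonneg (by linarith : 0 ≤ 1/2 - η)] at hb
    have h5 : (π * τ) * (1/2 - η) ≤ 1 := by
      have := Real.pi_lt_d2
      have : π * τ ≤ 2 := by nlinarith
      nlinarith
    have h6 : 2 ≤ 8 / (1 + τ) := by rw [le_div_iff₀ (by linarith)]; linarith
    have h7 : 0 ≤ 2 * τ * η := by positivity
    have := abs_le.1 hb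
    rw [abs_le]; constructor <;> linarith
  push Not at hτ2
  set n := ⌊τ - 1/2⌋₊ with hn
  have hn1 : (n:ℝ) ≤ τ - 1/2 := Nat.floor_le (by linarith)
  have hn2 : τ - 1/2 < n + 1 := Nat.lt_floor_add_one _
  set δ := τ - n - 1/2 with hδ
  have hδ0 : 0 ≤ δ := by linarith
  have hδ1 : δ ≤ 1 := by linarith
  set c := π * (τ + n + 1/2) with hc
  have hnn : (0:ℝ) ≤ n := Nat.cast_nonneg n
  have hcge : 1 + τ ≤ c := by
    have := Real.pi_gt_three
    rw [hc]; nlinarith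
  have hcpos : 0 < c := by linarith
  -- the dK part
  have hA : (∫ u in η..(1/2), dK n u) = 1/2 - ∫ u in (0:ℝ)..η, dK n u := by
    have := intervalIntegral.integral_add_adjacent_intervals (a := 0) (b := η) (c := 1/2) (μ := volume)
      ((dK_cont n).intervalIntegrable _ _) ((dK_cont n).intervalIntegrable _ _)
    rw [dK_integral n] at this
    linarith
  have hA' : ‖∫ u in (0:ℝ)..η, dK n u‖ ≤ 2 * tN n * |η - 0| :=
    intervalIntegral.norm_integral_le_of_norm_le_const (fun u _ => dK_abs_le n u)
  rw [sub_zero, abs_of_pos h0, Real.norm_eq_abs] at hA'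
  have hA2 : 2 * tN n * η ≤ 2 * τ * η := by
    have : tN n ≤ τ := by unfold tN; linarith
    gcongr
  -- the h part
  set h : ℝ → ℝ := fun u => Real.sin (π * δ * u) / Real.sin (π * u) with hh
  set h' : ℝ → ℝ := fun x => ((Real.cos (π * δ * x) * (π * δ)) * Real.sin (π * x) -
      Real.sin (π * δ * x) * (Real.cos (π * x) * π)) / Real.sin (π * x) ^ 2 with hh'
  have hd : ∀ x ∈ Set.Icc η (1/2), HasDerivAt h (h' x) x := fun x hx =>
    (hd_sin (π * δ) x).fun_div (hd_sin π x) (hsp x hx).ne'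
  have hh'c : ContinuousOn h' (Set.Icc η (1/2)) := by
    apply ContinuousOn.div (by fun_prop) (by fun_prop)
    intro x hx
    exact pow_ne_zero 2 (hsp x hx).ne'
  have hhc : ContinuousOn h (Set.Icc η (1/2)) := fun x hx => (hd x hx).continuousAt.continuousWithinAt
  have hh'0 : ∀ x ∈ Set.Icc η (1/2), 0 ≤ h' x := by
    intro x hx
    apply div_nonneg _ (by positivity)
    have := q_nonneg (a := π * x) hδ0 hδ1 (mul_nonneg hpi.le (h0.le.trans hx.1)) (by nlinarith [hx.2])
    have e : π * δ * x = δ * (π * x) := by ring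
    rw [e]
    nlinarith
  have hosc := osc_cos (φ := fun u => 1 - h u) (φ' := fun u => - h' u) hcpos h1.le
    (fun x hx => (hd x hx).const_sub 1) hh'c.neg (fun x hx => by linarith [hh'0 x hx]) (by
      have : h (1/2) ≤ 1 := by
        simp only [hh]
        rw [show π * (1/2) = π / 2 by ring, Real.sin_pi_div_two, div_one]
        exact Real.sin_le_one _
      linarith)
  have hosc1 := osc_cos (φ := fun u => 1) (φ' := fun u => 0) hcpos h1.le
    (fun x hx => hasDerivAt_const x (1:ℝ)) continuousOn_const (fun x hx => le_rfl) zero_le_one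
  have hη0 : 0 ≤ h η := by
    apply div_nonneg _ (hsp η ⟨le_rfl, h1.le⟩).le
    apply Real.sin_nonneg_of_nonneg_of_le_pi (by positivity)
    nlinarith [mul_le_one₀ hδ1 h0.le (h1.le.trans (by norm_num))]
  have key : ∫ u in η..(1/2), Real.sin (2 * π * τ * u) / Real.sin (π * u) =
      (∫ u in η..(1/2), dK n u) + 2 * ((∫ u in η..(1/2), Real.cos (c * u) * 1) -
        ∫ u in η..(1/2), Real.cos (c * u) * (1 - h u)) := by
    have i1 : IntervalIntegrable (fun u => Real.cos (c * u) * 1) volume η (1/2) := by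
      apply Continuous.intervalIntegrable; fun_prop
    have i2 : IntervalIntegrable (fun u => Real.cos (c * u) * (1 - h u)) volume η (1/2) := by
      apply ContinuousOn.intervalIntegrable; rw [hu]
      exact ContinuousOn.mul (by fun_prop) (continuousOn_const.sub hhc)
    rw [← intervalIntegral.integral_sub i1 i2, ← intervalIntegral.integral_const_mul,
      ← intervalIntegral.integral_add ((dK_cont n).intervalIntegrable _ _) ((i1.sub i2).const_mul 2)]
    apply intervalIntegral.integral_congr
    intro u huu
    rw [hu] at huu
    have hs := hsp u huu
    simp only
    rw [dK_eq_div n (h0.trans_le huu.1) huu.2]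
    have hss := Real.sin_sub_sin (2 * π * τ * u) (2 * π * tN n * u)
    have e1 : (2 * π * τ * u - 2 * π * tN n * u) / 2 = π * δ * u := by rw [hδ, tN]; ring
    have e2 : (2 * π * τ * u + 2 * π * tN n * u) / 2 = c * u := by rw [hc, tN]; ring
    rw [e1, e2] at hss
    have : Real.sin (2 * π * τ * u) = Real.sin (2 * π * tN n * u) + 2 * Real.sin (π * δ * u) * Real.cos (c * u) := by
      linarith
    rw [this]
    simp only [hh]
    field_simp
    ring
  rw [key, hA]
  have e8 : 8 / c ≤ 8 / (1 + τ) := by gcongr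
  have e9 : 2 * (1 / c) * (1 - h η) ≤ 2 / c := by
    rw [show 2 / c = 2 * (1 / c) * 1 by ring]
    gcongr
    linarith
  have e10 : 2 * (1 / c) * 1 = 2 / c := by ring
  have e11 : 8 / c = 4 * (2 / c) := by ring
  have a1 := abs_le.1 hA'
  have a2 := abs_le.1 hosc
  have a3 := abs_le.1 hosc1
  rw [abs_le]
  constructor <;> linarith

/-- dual weight -/
def wK (N : ℕ) (r : ℝ) : ℝ := 2 * ∫ u in (0:ℝ)..(1/2), dK N u * Real.cos (2 * π * r * u)

lemma wK_bound (N : ℕ) {r : ℝ} (hr : 0 ≤ r) :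
    |wK N r - (if r ≤ tN N then 1 else 0)| ≤ 16 / (1 + |r - tN N|) := by
  have hT := tN_pos N
  apply le_of_forall_small (K := 2 * (tN N + r) + 2 * |r - tN N| + 4 * tN N) (by positivity)
  intro η h0 h1
  have hsp : ∀ x ∈ Set.Icc η (1/2), 0 < Real.sin (π * x) :=
    fun x hx => sin_pi_pos (h0.trans_le hx.1) hx.2
  have hu : Set.uIcc η (1/2) = Set.Icc η (1/2) := Set.uIcc_of_le h1.le
  have hi : ∀ τ : ℝ, IntervalIntegrable (fun u => Real.sin (2 * π * τ * u) / Real.sin (π * u)) volume η (1/2) := by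
    intro τ
    apply ContinuousOn.intervalIntegrable; rw [hu]
    apply ContinuousOn.div (by fun_prop) (by fun_prop)
    intro x hx
    exact (hsp x hx).ne'
  have hc : Continuous fun u => dK N u * Real.cos (2 * π * r * u) := by fun_prop
  have e1 : wK N r = 2 * (∫ u in (0:ℝ)..η, dK N u * Real.cos (2 * π * r * u)) +
      ((∫ u in η..(1/2), Real.sin (2 * π * (tN N + r) * u) / Real.sin (π * u)) +
       ∫ u in η..(1/2), Real.sin (2 * π * (tN N - r) * u) / Real.sin (π * u)) := by
    rw [wK, ← intervalIntegral.integral_add_adjacent_intervals (b := η) (hc.intervalIntegrable _ _)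
      (hc.intervalIntegrable _ _), mul_add]
    congr 1
    rw [← intervalIntegral.integral_add (hi _) (hi _), ← intervalIntegral.integral_const_mul]
    apply intervalIntegral.integral_congr
    intro u huu
    rw [hu] at huu
    have hs := hsp u huu
    simp only
    rw [dK_eq_div N (h0.trans_le huu.1) huu.2]
    have ea : 2 * π * (tN N + r) * u = 2 * π * tN N * u + 2 * π * r * u := by ring
    have eb : 2 * π * (tN N - r) * u = 2 * π * tN N * u - 2 * π * r * u := by ring
    rw [ea, eb, Real.sin_add, Real.sin_sub]
    field_simp
    ring
  have hb : ‖∫ u in (0:ℝ)..η, dK N u * Real.cos (2 * π * r * u)‖ ≤ 2 * tN N * |η - 0| := by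
    apply intervalIntegral.norm_integral_le_of_norm_le_const
    intro u _
    rw [Real.norm_eq_abs, abs_mul]
    calc _ ≤ 2 * tN N * 1 := by
          gcongr
          · exact dK_abs_le N u
          · exact Real.abs_cos_le_one _
      _ = _ := mul_one _
  rw [sub_zero, abs_of_pos h0, Real.norm_eq_abs] at hb
  have s1 := S_eta (τ := tN N + r) (by linarith) h0 h1
  have hle : 8 / (1 + (tN N + r)) ≤ 8 / (1 + |r - tN N|) := by
    gcongr
    rw [abs_le]; constructor <;> linarith
  have e16 : 16 / (1 + |r - tN N|) = 2 * (8 / (1 + |r - tN N|)) := by ring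
  rw [e16, e1]
  have a1 := abs_le.1 hb
  have a2 := abs_le.1 s1
  split_ifs with h
  · have s2 := S_eta (τ := tN N - r) (by linarith) h0 h1
    have eabs : |r - tN N| = tN N - r := by rw [abs_sub_comm, abs_of_nonneg]; linarith
    rw [eabs] at hle ⊢
    have a3 := abs_le.1 s2
    rw [abs_le]
    constructor <;> linarith
  · push Not at h
    have s2 := S_eta (τ := r - tN N) (by linarith) h0 h1
    have eabs : |r - tN N| = r - tN N := by rw [abs_of_nonneg]; linarith
    have eneg : (∫ u in η..(1/2), Real.sin (2 * π * (tN N - r) * u) / Real.sin (π * u)) =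
        - ∫ u in η..(1/2), Real.sin (2 * π * (r - tN N) * u) / Real.sin (π * u) := by
      rw [← intervalIntegral.integral_neg]
      congr 1; ext u
      rw [show 2 * π * (tN N - r) * u = -(2 * π * (r - tN N) * u) by ring, Real.sin_neg]; ring
    rw [eneg]
    rw [eabs] at hle ⊢
    have a3 := abs_le.1 s2
    rw [abs_le]
    constructor <;> linarith

/-- evenness identity -/
lemma dK_cos_shift (N : ℕ) (r y : ℝ) :
    ∫ u in (-(1/2):ℝ)..(1/2), dK N u * Real.cos (2 * π * r * (y + u)) = Real.cos (2 * π * r * y) * wK N r := by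
  have hc : Continuous fun u => dK N u * Real.cos (2 * π * r * (y + u)) := by fun_prop
  rw [← intervalIntegral.integral_add_adjacent_intervals (b := 0) (hc.intervalIntegrable _ _)
      (hc.intervalIntegrable _ _)]
  have e : ∫ u in (-(1/2):ℝ)..0, dK N u * Real.cos (2 * π * r * (y + u)) =
      ∫ u in (0:ℝ)..(1/2), dK N u * Real.cos (2 * π * r * (y - u)) := by
    have := intervalIntegral.integral_comp_neg (a := (0:ℝ)) (b := 1/2)
      (fun u => dK N u * Real.cos (2 * π * r * (y + u)))
    rw [neg_zero] at this
    rw [← this]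
    simp only [dK_even]
    rfl
  rw [e, ← intervalIntegral.integral_add, wK, ← intervalIntegral.integral_const_mul,
    ← intervalIntegral.integral_const_mul]
  · congr 1; ext u
    rw [mul_add, mul_sub, Real.cos_add, Real.cos_sub]; ring
  all_goals apply Continuous.intervalIntegrable; fun_prop

lemma dK_abs_le' (N : ℕ) {m t : ℝ} (hm : 0 < m) (h0 : m ≤ |t|) (h1 : |t| ≤ 1 / 2) :
    |dK N t| ≤ 1 / (2 * m) := by
  have e : dK N t = dK N |t| := by
    rcases abs_choice t with h | h <;> rw [h]
    rw [dK_even]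
  have ht : 0 < |t| := hm.trans_le h0
  rw [e, dK_eq_div N ht h1, abs_mul]
  have hs := sin_pi_ge ht.le h1
  have hsp := sin_pi_pos ht h1
  rw [abs_of_pos (by positivity : 0 < 1 / Real.sin (π * |t|))]
  calc _ ≤ 1 * (1 / (2 * m)) := by
        gcongr
        · exact Real.abs_sin_le_one _
        · linarith
    _ = _ := one_mul _

lemma jK_half (N : ℕ) : jK N (1/2) = 0 := by simp [jK]
lemma kK_half (N : ℕ) : kK N (1/2) = 0 := by simp [kK]
lemma jK_zero (N : ℕ) : jK N 0 = 1/2 := dK_integral N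

lemma ibp_right (N : ℕ) {b : ℝ} (hb : b ≤ 1/2) {f f1 f2 : ℝ → ℝ}
    (d1 : ∀ t ∈ Set.Icc b (1/2), HasDerivAt f (f1 t) t)
    (d2 : ∀ t ∈ Set.Icc b (1/2), HasDerivAt f1 (f2 t) t)
    (c2 : ContinuousOn f2 (Set.Icc b (1/2))) :
    ∫ t in b..(1/2), dK N t * f t = jK N b * f b + kK N b * f1 b + ∫ t in b..(1/2), kK N t * f2 t := by
  have hu : Set.uIcc b (1/2) = Set.Icc b (1/2) := Set.uIcc_of_le hb
  have c1 : ContinuousOn f1 (Set.Icc b (1/2)) := fun x hx => (d2 x hx).continuousAt.continuousWithinAt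
  have e1 := intervalIntegral.integral_mul_deriv_eq_deriv_mul (a := b) (b := 1/2)
    (u := f) (u' := f1) (v := fun t => - jK N t) (v' := fun t => dK N t) (by rw [hu]; exact d1)
    (fun x _ => by simpa using (jK_deriv N x).fun_neg)
    (by apply ContinuousOn.intervalIntegrable; rwa [hu]) (by apply Continuous.intervalIntegrable; fun_prop)
  have e2 := intervalIntegral.integral_mul_deriv_eq_deriv_mul (a := b) (b := 1/2)
    (u := f1) (u' := f2) (v := fun t => - kK N t) (v' := fun t => jK N t) (by rw [hu]; exact d2)
    (fun x _ => by simpa using (kK_deriv N x).fun_neg)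
    (by apply ContinuousOn.intervalIntegrable; rwa [hu]) (by apply Continuous.intervalIntegrable; fun_prop)
  simp only [mul_neg, intervalIntegral.integral_neg, jK_half, kK_half] at e1 e2
  simp only [mul_comm (dK N _), mul_comm (kK N _) (f2 _)]
  rw [e1, sub_neg_eq_add, e2]
  ring

lemma ibp_left (N : ℕ) {b : ℝ} (hb : b ≤ 0) {f f1 f2 : ℝ → ℝ}
    (d1 : ∀ t ∈ Set.Icc b 0, HasDerivAt f (f1 t) t)
    (d2 : ∀ t ∈ Set.Icc b 0, HasDerivAt f1 (f2 t) t)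
    (c2 : ContinuousOn f2 (Set.Icc b 0)) :
    ∫ t in b..0, dK N t * f t = f 0 / 2 - jK N (-b) * f b - kK N 0 * f1 0 + kK N (-b) * f1 b
      + ∫ t in b..0, kK N (-t) * f2 t := by
  have hu : Set.uIcc b 0 = Set.Icc b 0 := Set.uIcc_of_le hb
  have c1 : ContinuousOn f1 (Set.Icc b 0) := fun x hx => (d2 x hx).continuousAt.continuousWithinAt
  have e1 := intervalIntegral.integral_mul_deriv_eq_deriv_mul (a := b) (b := 0)
    (u := f) (u' := f1) (v := fun t => jK N (-t)) (v' := fun t => dK N t) (by rw [hu]; exact d1)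
    (fun x _ => by
      have := (jK_deriv N (-x)).scomp x (hasDerivAt_neg x)
      simpa [dK_even, Function.comp_def] using this)
    (by apply ContinuousOn.intervalIntegrable; rwa [hu]) (by apply Continuous.intervalIntegrable; fun_prop)
  have e2 := intervalIntegral.integral_mul_deriv_eq_deriv_mul (a := b) (b := 0)
    (u := f1) (u' := f2) (v := fun t => kK N (-t)) (v' := fun t => jK N (-t)) (by rw [hu]; exact d2)
    (fun x _ => by
      have := (kK_deriv N (-x)).scomp x (hasDerivAt_neg x)
      simpa [Function.comp_def] using this)
    (by apply ContinuousOn.intervalIntegrable; rwa [hu]) (by apply Continuous.intervalIntegrable; fun_prop)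
  simp only [neg_zero, jK_zero] at e1 e2
  simp only [mul_comm (dK N _), mul_comm (kK N _) (f2 _)]
  rw [e1, e2]
  ring

/-- hypotheses on the profile -/
structure PH (T u0 : ℝ) (f f1 f2 : ℝ → ℝ) : Prop where
  zero : ∀ t ∈ Set.Icc (-(1/2):ℝ) (1/2), t ≤ u0 → f t = 0
  cont : ContinuousOn f (Set.Icc (-(1/2):ℝ) (1/2))
  d1 : ∀ t ∈ Set.Icc (-(1/2):ℝ) (1/2), u0 < t → HasDerivAt f (f1 t) t
  d2 : ∀ t ∈ Set.Icc (-(1/2):ℝ) (1/2), u0 < t → HasDerivAt f1 (f2 t) t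
  c2 : ∀ b, -(1/2) ≤ b → u0 < b → ContinuousOn f2 (Set.Icc b (1/2))
  f_nonneg : ∀ t ∈ Set.Icc (-(1/2):ℝ) (1/2), 0 ≤ f t
  f_le : ∀ t ∈ Set.Icc (-(1/2):ℝ) (1/2), u0 < t → f t ≤ 4 * Real.sqrt ((t - u0) / T)
  f1_nonneg : ∀ t ∈ Set.Icc (-(1/2):ℝ) (1/2), u0 < t → 0 ≤ f1 t
  f1_le : ∀ t ∈ Set.Icc (-(1/2):ℝ) (1/2), u0 < t → f1 t ≤ 4 / Real.sqrt (T * (t - u0))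
  f2_nonpos : ∀ t ∈ Set.Icc (-(1/2):ℝ) (1/2), u0 < t → f2 t ≤ 0
  f2_le : ∀ t ∈ Set.Icc (-(1/2):ℝ) (1/2), u0 < t →
    |f2 t| ≤ 40 / (Real.sqrt (T * (t - u0)) * (t - u0))

namespace PH
variable {T u0 : ℝ} {f f1 f2 : ℝ → ℝ}

lemma f_le' (h : PH T u0 f f1 f2) (hT : 0 < T) {k t : ℝ} (hk : 0 ≤ k)
    (ht : t ∈ Set.Icc (-(1/2):ℝ) (1/2)) (htk : t ≤ u0 + k ^ 2 / T) : f t ≤ 4 * k / T := by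
  rcases le_or_gt t u0 with h0 | h0
  · rw [h.zero t ht h0]; positivity
  · refine (h.f_le t ht h0).trans ?_
    have : Real.sqrt ((t - u0) / T) ≤ k / T := by
      apply Real.sqrt_le_iff.2 ⟨by positivity, ?_⟩
      rw [div_pow, div_le_div_iff₀ hT (by positivity)]
      have : t - u0 ≤ k ^ 2 / T := by linarith
      rw [le_div_iff₀ hT] at this
      nlinarith
    calc _ ≤ 4 * (k / T) := by gcongr
      _ = _ := by ring

lemma f1_le' (h : PH T u0 f f1 f2) (hT : 0 < T) {t : ℝ}
    (ht : t ∈ Set.Icc (-(1/2):ℝ) (1/2)) (htk : u0 + 1 / T ≤ t) : f1 t ≤ 4 := by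
  have h0 : u0 < t := lt_of_lt_of_le (by linarith [div_pos one_pos hT]) htk
  refine (h.f1_le t ht h0).trans ?_
  rw [div_le_iff₀ (by
    apply Real.sqrt_pos.2; apply mul_pos hT; linarith)]
  have : 1 ≤ Real.sqrt (T * (t - u0)) := by
    rw [Real.one_le_sqrt]
    have : 1 / T ≤ t - u0 := by linarith
    rw [div_le_iff₀ hT] at this
    linarith
  linarith

/-- bound for integral near singularity -/
lemma near (h : PH T u0 f f1 f2) (N : ℕ) {b κ M F : ℝ} (hb : b ∈ Set.Icc (-(1/2):ℝ) (1/2))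
    (hκ : 0 ≤ κ) (hbk : b ≤ u0 + κ) (hM : 0 ≤ M) (hF : 0 ≤ F)
    (hD : ∀ t ∈ Set.Icc (-(1/2):ℝ) (1/2), u0 ≤ t → t ≤ b → |dK N t| ≤ M)
    (hf : ∀ t ∈ Set.Icc (-(1/2):ℝ) (1/2), t ≤ b → f t ≤ F) :
    |∫ t in (-(1/2):ℝ)..b, dK N t * f t| ≤ M * F * κ := by
  set p := min b (max u0 (-(1/2))) with hp
  have hp1 : -(1/2) ≤ p := le_min hb.1 (le_max_right _ _)
  have hp2 : p ≤ b := min_le_left _ _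
  have hcont : ContinuousOn (fun t => dK N t * f t) (Set.Icc (-(1/2):ℝ) (1/2)) :=
    (dK_cont N).continuousOn.mul h.cont
  have hi : ∀ c d : ℝ, -(1/2) ≤ c → c ≤ d → d ≤ 1/2 → IntervalIntegrable (fun t => dK N t * f t) volume c d := by
    intro c d h1 h2 h3
    apply ContinuousOn.intervalIntegrable
    rw [Set.uIcc_of_le h2]
    exact hcont.mono (Set.Icc_subset_Icc h1 h3)
  rw [← intervalIntegral.integral_add_adjacent_intervals (b := p) (hi _ _ le_rfl hp1 (hp2.trans hb.2))
    (hi _ _ hp1 hp2 hb.2)]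
  have e0 : ∫ t in (-(1/2):ℝ)..p, dK N t * f t = 0 := by
    have : ‖∫ t in (-(1/2):ℝ)..p, dK N t * f t‖ ≤ 0 * |p - (-(1/2))| := by
      apply intervalIntegral.norm_integral_le_of_norm_le_const
      intro t ht
      rw [Set.uIoc_of_le hp1] at ht
      have htI : t ∈ Set.Icc (-(1/2):ℝ) (1/2) := ⟨ht.1.le, ht.2.trans (hp2.trans hb.2)⟩
      have h2 : t ≤ max u0 (-(1/2)) := ht.2.trans (min_le_right _ _)
      rcases le_max_iff.1 h2 with h3 | h3
      · rw [h.zero t htI h3, mul_zero, norm_zero]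
      · exact absurd h3 (not_le.2 ht.1)
    rw [zero_mul] at this
    exact norm_le_zero_iff.1 this
  rw [e0, zero_add]
  have : ‖∫ t in p..b, dK N t * f t‖ ≤ (M * F) * |b - p| := by
    apply intervalIntegral.norm_integral_le_of_norm_le_const
    intro t ht
    rw [Set.uIoc_of_le hp2] at ht
    have htI : t ∈ Set.Icc (-(1/2):ℝ) (1/2) := ⟨hp1.trans ht.1.le, ht.2.trans hb.2⟩
    rw [Real.norm_eq_abs, abs_mul, abs_of_nonneg (h.f_nonneg t htI)]
    have hu : u0 ≤ t := by
      rcases min_choice b (max u0 (-(1/2))) with h1 | h1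
      · rw [hp, h1] at ht; exact absurd ht.1 (not_lt.2 ht.2)
      · have := ht.1; rw [hp, h1] at this
        exact (le_max_left _ _).trans this.le
    exact mul_le_mul (hD t htI hu ht.2) (hf t htI ht.2) (h.f_nonneg t htI) hM
  rw [Real.norm_eq_abs, abs_of_nonneg (by linarith : 0 ≤ b - p)] at this
  refine this.trans ?_
  gcongr
  rcases min_choice b (max u0 (-(1/2))) with h1 | h1
  · rw [hp, h1]; linarith
  · rw [hp, h1]
    have := le_max_left u0 (-(1/2))
    linarith


lemma int_f2 (h : PH T u0 f f1 f2) (hT : 0 < T) {b c KB : ℝ} (hb : -(1/2) ≤ b) (hbc : b ≤ c)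
    (hc : c ≤ 1/2) (hub : u0 + 1 / T ≤ b) {k : ℝ → ℝ} (hk : ∀ t ∈ Set.Icc b c, |k t| ≤ KB) :
    |∫ t in b..c, k t * f2 t| ≤ KB * 4 := by
  have hT1 : 0 < 1 / T := by positivity
  have hKB : 0 ≤ KB := (abs_nonneg _).trans (hk b ⟨le_rfl, hbc⟩)
  have hu : Set.uIcc b c = Set.Icc b c := Set.uIcc_of_le hbc
  have hmem : ∀ t ∈ Set.Icc b c, t ∈ Set.Icc (-(1/2):ℝ) (1/2) := fun t ht => ⟨hb.trans ht.1, ht.2.trans hc⟩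
  have hi2 : IntervalIntegrable f2 volume b c := by
    apply ContinuousOn.intervalIntegrable
    rw [hu]
    exact (h.c2 b hb (by linarith)).mono (Set.Icc_subset_Icc le_rfl hc)
  have e : ∫ t in b..c, f2 t = f1 c - f1 b :=
    intervalIntegral.integral_eq_sub_of_hasDerivAt (by
      rw [hu]; intro t ht; exact h.d2 t (hmem t ht) (by linarith [ht.1])) hi2
  have : ‖∫ t in b..c, k t * f2 t‖ ≤ ∫ t in b..c, -(KB * f2 t) := by
    apply intervalIntegral.norm_integral_le_of_norm_le hbc
    · refine Filter.Eventually.of_forall fun t ht => ?_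
      have ht' : t ∈ Set.Icc b c := ⟨ht.1.le, ht.2⟩
      have h2 := h.f2_nonpos t (hmem t ht') (by linarith [ht.1])
      rw [Real.norm_eq_abs, abs_mul, abs_of_nonpos h2]
      nlinarith [hk t ht']
    · exact (hi2.const_mul KB).neg
  rw [Real.norm_eq_abs, intervalIntegral.integral_neg, intervalIntegral.integral_const_mul, e] at this
  refine this.trans ?_
  have h3 := h.f1_nonneg c (hmem c ⟨hbc, le_rfl⟩) (by linarith)
  have h4 := h.f1_le' hT (hmem b ⟨le_rfl, hbc⟩) hub
  nlinarith

lemma tailR (h : PH T u0 f f1 f2) (hT : 0 < T) (N : ℕ) {b JB KB FB : ℝ} (hb : -(1/2) ≤ b)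
    (hb2 : b ≤ 1/2) (hub : u0 + 1 / T ≤ b) (hJ : |jK N b| ≤ JB)
    (hK : ∀ t ∈ Set.Icc b (1/2), |kK N t| ≤ KB) (hF : f b ≤ FB) :
    |∫ t in b..(1/2), dK N t * f t| ≤ JB * FB + KB * 8 := by
  have hT1 : 0 < 1 / T := by positivity
  have hmem : ∀ t ∈ Set.Icc b (1/2), t ∈ Set.Icc (-(1/2):ℝ) (1/2) := fun t ht => ⟨hb.trans ht.1, ht.2⟩
  rw [ibp_right N hb2 (fun t ht => h.d1 t (hmem t ht) (by linarith [ht.1]))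
    (fun t ht => h.d2 t (hmem t ht) (by linarith [ht.1])) (h.c2 b hb (by linarith))]
  have h1 := h.int_f2 hT hb hb2 le_rfl hub hK
  have hbm : b ∈ Set.Icc b (1/2) := ⟨le_rfl, hb2⟩
  have hf0 := h.f_nonneg b (hmem b hbm)
  have hf1 := h.f1_nonneg b (hmem b hbm) (by linarith)
  have hf1' := h.f1_le' hT (hmem b hbm) hub
  have hKB := hK b hbm
  have h2 : |jK N b * f b| ≤ JB * FB := by
    rw [abs_mul, abs_of_nonneg hf0]
    exact mul_le_mul hJ hF hf0 ((abs_nonneg _).trans hJ)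
  have h3 : |kK N b * f1 b| ≤ KB * 4 := by
    rw [abs_mul, abs_of_nonneg hf1]
    exact mul_le_mul hKB hf1' hf1 ((abs_nonneg _).trans hKB)
  refine (abs_add_le _ _).trans ?_
  have := abs_add_le (jK N b * f b) (kK N b * f1 b)
  linarith

end PH

lemma hi_df {T u0 : ℝ} {f f1 f2 : ℝ → ℝ} (h : PH T u0 f f1 f2) (N : ℕ) {c d : ℝ}
    (h1 : -(1/2) ≤ c) (h2 : c ≤ d) (h3 : d ≤ 1/2) :
    IntervalIntegrable (fun t => dK N t * f t) volume c d := by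
  apply ContinuousOn.intervalIntegrable
  rw [Set.uIcc_of_le h2]
  exact ((dK_cont N).continuousOn.mul h.cont).mono (Set.Icc_subset_Icc h1 h3)

lemma primalA {u0 : ℝ} {f f1 f2 : ℝ → ℝ} (N : ℕ) (hN : 12 ≤ N) (h : PH (tN N) u0 f f1 f2)
    (hu0 : |u0| ≤ 2 / tN N) :
    |(∫ t in (-(1/2):ℝ)..(1/2), dK N t * f t) - f 0| ≤ 200 / tN N := by
  have hT := tN_pos N
  have hT12 : 12 ≤ tN N := by
    have : (12:ℝ) ≤ N := by exact_mod_cast hN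
    unfold tN; linarith
  set i := 1 / tN N with hi
  have hi0 : 0 < i := by positivity
  have hi12 : i ≤ 1 / 12 := by rw [hi]; gcongr
  have e2 : 2 / tN N = 2 * i := by rw [hi]; ring
  have eT : tN N * i = 1 := by rw [hi]; field_simp
  rw [e2] at hu0
  have hu := abs_le.1 hu0
  set b := u0 + 4 * i with hb
  have hbI : b ∈ Set.Icc (-(1/2):ℝ) (1/2) := ⟨by linarith, by linarith⟩
  have h0I : (0:ℝ) ∈ Set.Icc (-(1/2):ℝ) (1/2) := by constructor <;> norm_num
  have k4 : (2:ℝ) ^ 2 / tN N = 4 * i := by rw [hi]; ring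
  have f0 := h.f_le' hT (k := 2) (by norm_num) h0I (by rw [k4]; linarith)
  have f0' := h.f_nonneg 0 h0I
  have fb := fun t (ht : t ∈ Set.Icc (-(1/2):ℝ) (1/2)) (htb : t ≤ b) =>
    h.f_le' hT (k := 2) (by norm_num) ht (by rw [k4]; linarith)
  have e8 : 4 * 2 / tN N = 8 * i := by rw [hi]; ring
  rw [e8] at fb f0
  have n1 := h.near N (κ := 4 * i) (M := 2 * tN N) (F := 8 * i) hbI (by linarith) (by linarith)
    (by linarith) (by linarith) (fun t _ _ _ => dK_abs_le N t) fb
  have t1 := h.tailR hT N (b := b) (JB := 3) (KB := 4 / tN N) (FB := 8 * i) hbI.1 hbI.2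
    (by rw [← hi]; linarith)
    (jK_bound' N (by linarith) hbI.2) (fun t ht => kK_bound' N (by omega) (by linarith [ht.1]) ht.2)
    (fb b hbI le_rfl)
  rw [← intervalIntegral.integral_add_adjacent_intervals (b := b) (hi_df h N le_rfl hbI.1 hbI.2)
    (hi_df h N hbI.1 hbI.2 le_rfl)]
  have e200 : 200 / tN N = 200 * i := by rw [hi]; ring
  have e4 : 4 / tN N = 4 * i := by rw [hi]; ring
  have e64 : 2 * tN N * (8 * i) * (4 * i) = 64 * i := by linear_combination 64 * i * eT
  rw [e64] at n1
  rw [e4] at t1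
  rw [e200]
  have := abs_le.1 n1
  have := abs_le.1 t1
  rw [abs_le]
  constructor <;> linarith

lemma primalB {u0 : ℝ} {f f1 f2 : ℝ → ℝ} (N : ℕ) (_hN : 12 ≤ N) (h : PH (tN N) u0 f f1 f2)
    (hu0 : 2 / tN N ≤ u0) :
    |(∫ t in (-(1/2):ℝ)..(1/2), dK N t * f t) - f 0| ≤ 20 / (tN N ^ 2 * u0) := by
  have hT := tN_pos N
  set i := 1 / tN N with hi
  have hi0 : 0 < i := by positivity
  have e2 : 2 / tN N = 2 * i := by rw [hi]; ring
  rw [e2] at hu0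
  have hup : 0 < u0 := by linarith
  have h0I : (0:ℝ) ∈ Set.Icc (-(1/2):ℝ) (1/2) := by constructor <;> norm_num
  rw [h.zero 0 h0I hup.le, sub_zero]
  have k4 : (1:ℝ) ^ 2 / tN N = i := by rw [hi]; ring
  have e8 : 4 * 1 / tN N = 4 * i := by rw [hi]; ring
  have eF : 20 / (tN N ^ 2 * u0) = 20 * i * i / u0 := by rw [hi]; field_simp
  by_cases hb : u0 + i ≤ 1 / 2
  · set b := u0 + i with hbdef
    have hbI : b ∈ Set.Icc (-(1/2):ℝ) (1/2) := ⟨by linarith, by linarith⟩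
    have fb := fun t (ht : t ∈ Set.Icc (-(1/2):ℝ) (1/2)) (htb : t ≤ b) =>
      h.f_le' hT (k := 1) (by norm_num) ht (by rw [k4]; linarith)
    rw [e8] at fb
    have n1 := h.near N (κ := i) (M := 1 / (2 * u0)) (F := 4 * i) hbI (by linarith) (by linarith)
      (by positivity) (by linarith) (fun t ht htu _ => dK_abs_le' N hup (htu.trans (le_abs_self _))
        (abs_le.2 ht)) fb
    have t1 := h.tailR hT N (b := b) (JB := 1 / (tN N * u0)) (KB := 1 / (tN N ^ 2 * u0)) (FB := 4 * i) hbI.1 hbI.2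
      (by rw [← hi])
      ((jK_bound N (by linarith) hbI.2).trans (by gcongr; linarith))
      (fun t ht => (kK_bound N (by linarith [ht.1]) ht.2).trans (by gcongr; linarith [ht.1]))
      (fb b hbI le_rfl)
    rw [← intervalIntegral.integral_add_adjacent_intervals (b := b) (hi_df h N le_rfl hbI.1 hbI.2)
      (hi_df h N hbI.1 hbI.2 le_rfl)]
    have ea : 1 / (2 * u0) * (4 * i) * i = 2 * (i * i / u0) := by field_simp; ring
    have eb : 1 / (tN N * u0) * (4 * i) + 1 / (tN N ^ 2 * u0) * 8 = 12 * (i * i / u0) := by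
      rw [hi]; field_simp; norm_num
    have ec : 20 * i * i / u0 = 20 * (i * i / u0) := by ring
    have hp : 0 < i * i / u0 := by positivity
    rw [ea] at n1
    rw [eb] at t1
    rw [eF, ec]
    refine (abs_add_le _ _).trans ?_
    linarith
  · push Not at hb
    have hbI : (1/2:ℝ) ∈ Set.Icc (-(1/2):ℝ) (1/2) := ⟨by norm_num, le_rfl⟩
    have fb := fun t (ht : t ∈ Set.Icc (-(1/2):ℝ) (1/2)) (htb : t ≤ 1/2) =>
      h.f_le' hT (k := 1) (by norm_num) ht (by rw [k4]; linarith)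
    rw [e8] at fb
    have n1 := h.near N (κ := i) (M := 1 / (2 * u0)) (F := 4 * i) hbI (by linarith) (by linarith)
      (by positivity) (by linarith) (fun t ht htu _ => dK_abs_le' N hup (htu.trans (le_abs_self _))
        (abs_le.2 ht)) fb
    refine n1.trans ?_
    have ea : 1 / (2 * u0) * (4 * i) * i = 2 * (i * i / u0) := by field_simp; ring
    have ec : 20 * i * i / u0 = 20 * (i * i / u0) := by ring
    have hp : 0 < i * i / u0 := by positivity
    rw [eF, ec, ea]
    linarith

lemma coreC {u0 : ℝ} {f f1 f2 : ℝ → ℝ} (N : ℕ) (hN : 12 ≤ N) (h : PH (tN N) u0 f f1 f2)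
    (hu0 : u0 ≤ -(2 / tN N)) {b : ℝ} (hb : -(1/2) ≤ b) (hb0 : b ≤ 0) (hub : u0 + 1 / tN N ≤ b) :
    |∫ t in b..0, kK N (-t) * f2 t| ≤ (8 + 80 * (4 + Real.log (tN N))) / (tN N ^ 2 * (-u0)) ∧
    |∫ t in (0:ℝ)..(1/2), kK N t * f2 t| ≤ 80 * (4 + Real.log (tN N)) / (tN N ^ 2 * (-u0)) := by
  have hT := tN_pos N
  set s := -u0 with hs
  have hs2 : 2 / tN N ≤ s := by linarith
  have hT1 : 0 < 1 / tN N := by positivity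
  have hs0 : 0 < s := lt_of_lt_of_le (by positivity) hs2
  have hTs : 2 ≤ tN N * s := by rwa [div_le_iff₀ hT, mul_comm] at hs2
  have hi : 1 / tN N ≤ s / 2 := by
    have : 2 / tN N = 2 * (1 / tN N) := by ring
    linarith
  have hf2 : ∀ t ∈ Set.Icc (-(1/2):ℝ) (1/2), -s / 2 ≤ t → |f2 t| ≤ 80 / s := by
    intro t ht hts
    have hd : s / 2 ≤ t - u0 := by linarith
    refine (h.f2_le t ht (by linarith)).trans ?_
    have h1 : 1 ≤ Real.sqrt (tN N * (t - u0)) := by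
      rw [Real.one_le_sqrt]
      nlinarith
    rw [div_le_div_iff₀ (by apply mul_pos; linarith; linarith) hs0]
    nlinarith
  have hL : ∀ c d : ℝ, 0 ≤ c → c ≤ d → d ≤ 1/2 → ∫ t in c..d, |kK N t| ≤ (4 + Real.log (tN N)) / tN N ^ 2 := by
    intro c d h1 h2 h3
    refine le_trans ?_ (kK_L1 N (by omega))
    apply intervalIntegral.integral_mono_interval h1 h2 h3
    · exact Filter.Eventually.of_forall fun t => abs_nonneg _
    · exact (kK_cont N).abs.intervalIntegrable _ _
  have h0I : (0:ℝ) ∈ Set.Icc (-(1/2):ℝ) (1/2) := by constructor <;> norm_num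
  have eL : 80 * (4 + Real.log (tN N)) / (tN N ^ 2 * s) = 80 / s * ((4 + Real.log (tN N)) / tN N ^ 2) := by
    field_simp
  have hcore : ∀ c d : ℝ, -(1/2) ≤ c → c ≤ d → d ≤ 1/2 → -s/2 ≤ c → ∀ k : ℝ → ℝ, Continuous k →
      (∫ t in c..d, |k t|) ≤ (4 + Real.log (tN N)) / tN N ^ 2 →
      |∫ t in c..d, k t * f2 t| ≤ 80 * (4 + Real.log (tN N)) / (tN N ^ 2 * s) := by
    intro c d h1 h2 h3 h4 k hk hkL
    have : ‖∫ t in c..d, k t * f2 t‖ ≤ ∫ t in c..d, 80 / s * |k t| := by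
      apply intervalIntegral.norm_integral_le_of_norm_le h2
      · refine Filter.Eventually.of_forall fun t ht => ?_
        rw [Real.norm_eq_abs, abs_mul, mul_comm]
        gcongr
        exact hf2 t ⟨by linarith [ht.1], by linarith [ht.2]⟩ (by linarith [ht.1])
      · exact (hk.abs.intervalIntegrable _ _).const_mul _
    rw [Real.norm_eq_abs, intervalIntegral.integral_const_mul] at this
    rw [eL]
    refine this.trans ?_
    gcongr
  refine ⟨?_, hcore 0 (1/2) (by norm_num) (by norm_num) le_rfl (by linarith) _ (kK_cont N)
    (hL _ _ le_rfl (by norm_num) le_rfl)⟩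
  set m := max b (-s/2) with hm
  have hbm : b ≤ m := le_max_left _ _
  have hm0 : m ≤ 0 := max_le hb0 (by linarith)
  have hi2 : ∀ c d : ℝ, b ≤ c → c ≤ d → d ≤ 1/2 → IntervalIntegrable (fun t => kK N (-t) * f2 t) volume c d := by
    intro c d h1 h2 h3
    apply ContinuousOn.intervalIntegrable
    rw [Set.uIcc_of_le h2]
    apply ContinuousOn.mul (by fun_prop)
    exact (h.c2 b hb (by linarith)).mono (Set.Icc_subset_Icc h1 h3)
  rw [← intervalIntegral.integral_add_adjacent_intervals (b := m) (hi2 _ _ le_rfl hbm (by linarith))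
    (hi2 _ _ hbm hm0 (by norm_num))]
  have h2 := hcore m 0 (by linarith) hm0 (by norm_num) (le_max_right _ _) (fun t => kK N (-t)) (by fun_prop) (by
    have := intervalIntegral.integral_comp_neg (a := m) (b := 0) (fun t => |kK N t|)
    rw [this, neg_zero]
    exact hL _ _ le_rfl (by linarith) (by linarith))
  have h1 : |∫ t in b..m, kK N (-t) * f2 t| ≤ 8 / (tN N ^ 2 * s) := by
    rcases max_choice b (-s/2) with hc | hc
    · have : m = b := by rw [hm, hc]
      rw [this, intervalIntegral.integral_same, abs_zero]; positivity
    · have hms : m = -s/2 := by rw [hm, hc]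
      have := h.int_f2 hT hb hbm (by linarith) hub (k := fun t => kK N (-t)) (KB := 1 / (tN N ^ 2 * (s/2))) (by
        intro t ht
        refine (kK_bound N (by linarith [ht.2]) (by linarith [ht.1])).trans ?_
        gcongr
        linarith [ht.2])
      refine this.trans (le_of_eq ?_)
      field_simp; norm_num
  refine (abs_add_le _ _).trans ?_
  calc _ ≤ 8 / (tN N ^ 2 * s) + 80 * (4 + Real.log (tN N)) / (tN N ^ 2 * s) := add_le_add h1 h2
    _ = _ := by ring

lemma primalC {u0 : ℝ} {f f1 f2 : ℝ → ℝ} (N : ℕ) (hN : 12 ≤ N) (h : PH (tN N) u0 f f1 f2)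
    (hu0 : u0 ≤ -(2 / tN N)) :
    |(∫ t in (-(1/2):ℝ)..(1/2), dK N t * f t) - f 0|
      ≤ (28 + 160 * (4 + Real.log (tN N))) / (tN N ^ 2 * (-u0)) := by
  have hT := tN_pos N
  have hT12 : 12 ≤ tN N := by
    have : (12:ℝ) ≤ N := by exact_mod_cast hN
    unfold tN; linarith
  have hi0 : 0 < 1 / tN N := by positivity
  have e2 : 2 / tN N = 2 * (1 / tN N) := by ring
  have hi12 : 1 / tN N ≤ 1 / 12 := by gcongr
  have key : ∀ b : ℝ, -(1/2) ≤ b → b ≤ 0 → u0 + 1 / tN N ≤ b →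
      (∫ t in (-(1/2):ℝ)..(1/2), dK N t * f t) - f 0 =
        (∫ t in (-(1/2):ℝ)..b, dK N t * f t) - jK N (-b) * f b + kK N (-b) * f1 b +
        (∫ t in b..0, kK N (-t) * f2 t) + ∫ t in (0:ℝ)..(1/2), kK N t * f2 t := by
    intro b hb hb0 hub
    have hm : ∀ t ∈ Set.Icc b 0, t ∈ Set.Icc (-(1/2):ℝ) (1/2) := fun t ht => ⟨hb.trans ht.1, by linarith [ht.2]⟩
    have hm' : ∀ t ∈ Set.Icc (0:ℝ) (1/2), t ∈ Set.Icc (-(1/2):ℝ) (1/2) := fun t ht => ⟨by linarith [ht.1], ht.2⟩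
    rw [← intervalIntegral.integral_add_adjacent_intervals (b := b) (hi_df h N le_rfl hb (by linarith))
      (hi_df h N hb (by linarith) le_rfl),
      ← intervalIntegral.integral_add_adjacent_intervals (a := b) (b := 0) (c := 1/2) (hi_df h N hb hb0 (by norm_num))
      (hi_df h N (by norm_num) (by norm_num) le_rfl),
      ibp_left N hb0 (fun t ht => h.d1 t (hm t ht) (by linarith [ht.1]))
        (fun t ht => h.d2 t (hm t ht) (by linarith [ht.1]))
        ((h.c2 b hb (by linarith)).mono (Set.Icc_subset_Icc le_rfl (by norm_num))),
      ibp_right N (by norm_num) (fun t ht => h.d1 t (hm' t ht) (by linarith [ht.1]))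
        (fun t ht => h.d2 t (hm' t ht) (by linarith [ht.1]))
        ((h.c2 b hb (by linarith)).mono (Set.Icc_subset_Icc hb0 le_rfl)), jK_zero]
    ring
  set s := -u0 with hs
  have hs0 : 0 < s := by linarith
  have eR : (28 + 160 * (4 + Real.log (tN N))) / (tN N ^ 2 * s) =
      20 / (tN N ^ 2 * s) + (8 + 80 * (4 + Real.log (tN N))) / (tN N ^ 2 * s) +
        80 * (4 + Real.log (tN N)) / (tN N ^ 2 * s) := by ring
  rw [eR]
  by_cases hc : u0 + 1 / tN N ≤ -(1/2)
  · have c := coreC N hN h hu0 le_rfl (by norm_num) hc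
    rw [key (-(1/2)) le_rfl (by norm_num) hc, neg_neg, jK_half, kK_half, intervalIntegral.integral_same]
    have hp : 0 < 20 / (tN N ^ 2 * s) := by positivity
    have c1 := abs_le.1 c.1
    have c2 := abs_le.1 c.2
    rw [abs_le]; constructor <;> linarith
  · push Not at hc
    set b := u0 + 1 / tN N with hb
    have hb0 : b ≤ 0 := by linarith
    have c := coreC N hN h hu0 hc.le hb0 le_rfl
    rw [key b hc.le hb0 le_rfl]
    have hbI : b ∈ Set.Icc (-(1/2):ℝ) (1/2) := ⟨hc.le, by linarith⟩
    have hbs : s / 2 ≤ -b := by linarith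
    have fb := fun t (ht : t ∈ Set.Icc (-(1/2):ℝ) (1/2)) (htb : t ≤ b) =>
      h.f_le' hT (k := 1) (by norm_num) ht (by rw [one_pow]; linarith)
    have n1 := h.near N (κ := 1 / tN N) (M := 1 / (2 * (s/2))) (F := 4 * 1 / tN N) hbI (by linarith) (by linarith)
      (by positivity) (by positivity) (fun t ht htu htb => dK_abs_le' N (by positivity)
        ((by linarith : s/2 ≤ -t).trans (neg_le_abs _)) (abs_le.2 ht)) fb
    have hf0 := h.f_nonneg b hbI
    have hf1 := h.f1_nonneg b hbI (by linarith)
    have h2 : |jK N (-b) * f b| ≤ 1 / (tN N * (s/2)) * (4 * 1 / tN N) := by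
      rw [abs_mul, abs_of_nonneg hf0]
      gcongr
      · exact (jK_bound N (by linarith) (by linarith)).trans (by gcongr)
      · exact fb b hbI le_rfl
    have h3 : |kK N (-b) * f1 b| ≤ 1 / (tN N ^ 2 * (s/2)) * 4 := by
      rw [abs_mul, abs_of_nonneg hf1]
      gcongr
      · exact (kK_bound N (by linarith) (by linarith)).trans (by gcongr)
      · exact h.f1_le' hT hbI le_rfl
    have e1 : 1 / (2 * (s/2)) * (4 * 1 / tN N) * (1 / tN N) = 4 / (tN N ^ 2 * s) := by field_simp
    have e2 : 1 / (tN N * (s/2)) * (4 * 1 / tN N) = 8 / (tN N ^ 2 * s) := by field_simp; norm_num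
    have e3 : 1 / (tN N ^ 2 * (s/2)) * 4 = 8 / (tN N ^ 2 * s) := by field_simp; norm_num
    have e4 : 20 / (tN N ^ 2 * s) = 4 / (tN N ^ 2 * s) + 8 / (tN N ^ 2 * s) + 8 / (tN N ^ 2 * s) := by ring
    rw [e1] at n1
    rw [e2] at h2
    rw [e3] at h3
    rw [e4]
    have c1 := abs_le.1 c.1
    have c2 := abs_le.1 c.2
    have := abs_le.1 n1
    have := abs_le.1 h2
    have := abs_le.1 h3
    rw [abs_le]; constructor <;> linarith

/-- Unified primal estimate. -/
lemma primal {u0 : ℝ} {f f1 f2 : ℝ → ℝ} (N : ℕ) (hN : 12 ≤ N) (h : PH (tN N) u0 f f1 f2) :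
    |(∫ t in (-(1/2):ℝ)..(1/2), dK N t * f t) - f 0|
      ≤ 1000 * (4 + Real.log (tN N)) / (tN N * (1 + tN N * |u0|)) := by
  have hT := tN_pos N
  have hL : 4 ≤ 4 + Real.log (tN N) := by
    have : 0 ≤ Real.log (tN N) := by
      apply Real.log_nonneg
      have : (12:ℝ) ≤ N := by exact_mod_cast hN
      unfold tN; linarith
    linarith
  set L := 4 + Real.log (tN N) with hLdef
  by_cases h1 : |u0| ≤ 2 / tN N
  · refine (primalA N hN h h1).trans ?_
    rw [le_div_iff₀ hT] at h1
    rw [div_le_div_iff₀ hT (by positivity)]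
    have : 200 * (1 + tN N * |u0|) ≤ 1000 * L := by nlinarith
    nlinarith
  · push Not at h1
    have hup : 0 < |u0| := lt_trans (by positivity) h1
    have h2 : |(∫ t in (-(1/2):ℝ)..(1/2), dK N t * f t) - f 0| ≤ (28 + 160 * L) / (tN N ^ 2 * |u0|) := by
      rcases le_or_gt 0 u0 with h3 | h3
      · rw [abs_of_nonneg h3] at h1 hup ⊢
        refine (primalB N hN h h1.le).trans ?_
        gcongr
        linarith
      · rw [abs_of_neg h3] at h1 hup ⊢
        exact primalC N hN h (by linarith)
    refine h2.trans ?_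
    have h3 : 2 < |u0| * tN N := by rwa [div_lt_iff₀ hT] at h1
    rw [div_le_div_iff₀ (by positivity) (by positivity)]
    have : (28 + 160 * L) * (1 + tN N * |u0|) ≤ 1000 * L * (tN N * |u0|) := by nlinarith
    nlinarith

/-- The profile. -/
def gP (ν Y : ℝ) : ℝ := Real.sqrt (1 - ν ^ 4 / Y ^ 4)

lemma gP_sq {ν Y : ℝ} (hν : 0 ≤ ν) (hY : ν ≤ Y) (hY0 : 0 < Y) :
    gP ν Y ^ 2 = 1 - ν ^ 4 / Y ^ 4 := by
  unfold gP
  rw [Real.sq_sqrt]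
  rw [sub_nonneg, div_le_one (by positivity)]
  gcongr

lemma gP_lower {ν Y : ℝ} (hν : 0 ≤ ν) (hY : ν ≤ Y) (hY0 : 0 < Y) :
    (Y - ν) / Y ≤ gP ν Y ^ 2 := by
  rw [gP_sq hν hY hY0, sub_div, div_self hY0.ne', ← div_pow]
  have h0 : 0 ≤ ν / Y := by positivity
  have h1 : ν / Y ≤ 1 := by rw [div_le_one hY0]; exact hY
  have := pow_le_of_le_one h0 h1 (n := 4) (by norm_num)
  linarith

lemma gP_upper {ν Y : ℝ} (hν : 0 ≤ ν) (hY : ν ≤ Y) (hY0 : 0 < Y) :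
    gP ν Y ^ 2 ≤ 4 * ((Y - ν) / Y) := by
  rw [gP_sq hν hY hY0, sub_div, div_self hY0.ne', ← div_pow]
  have h0 : 0 ≤ ν / Y := by positivity
  have h1 : ν / Y ≤ 1 := by rw [div_le_one hY0]; exact hY
  set q := ν / Y
  nlinarith [sq_nonneg (q^2 - 1), sq_nonneg (q - 1), mul_nonneg h0 (sub_nonneg.2 h1)]

lemma gP_pos {ν Y : ℝ} (hν : 0 ≤ ν) (hY : ν < Y) : 0 < gP ν Y := by
  have hY0 : 0 < Y := hν.trans_lt hY
  unfold gP
  apply Real.sqrt_pos.2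
  rw [sub_pos, div_lt_one (by positivity)]
  gcongr

/-- first derivative -/
def gP1 (ν Y : ℝ) : ℝ := 2 * ν ^ 4 / (Y ^ 5 * gP ν Y)
/-- second derivative -/
def gP2 (ν Y : ℝ) : ℝ := -(10 * ν ^ 4 / (Y ^ 6 * gP ν Y) + 4 * ν ^ 8 / (Y ^ 10 * gP ν Y ^ 3))

lemma gP_d1 {ν Y : ℝ} (hν : 0 ≤ ν) (hY : ν < Y) : HasDerivAt (gP ν) (gP1 ν Y) Y := by
  have hY0 : 0 < Y := hν.trans_lt hY
  have hg := gP_pos hν hY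
  have h1 : HasDerivAt (fun Y : ℝ => 1 - ν ^ 4 / Y ^ 4) (4 * ν ^ 4 / Y ^ 5) Y := by
    refine (((hasDerivAt_const Y (ν ^ 4)).fun_div (hasDerivAt_pow 4 Y) (by positivity)).const_sub 1).congr_deriv ?_
    field_simp
    norm_num
    ring
  have h2 : 1 - ν ^ 4 / Y ^ 4 ≠ 0 := by
    intro h
    unfold gP at hg
    rw [h, Real.sqrt_zero] at hg
    exact lt_irrefl _ hg
  refine (h1.sqrt h2).congr_deriv ?_
  unfold gP1
  change 4 * ν ^ 4 / Y ^ 5 / (2 * gP ν Y) = _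
  field_simp
  ring

lemma gP_d2 {ν Y : ℝ} (hν : 0 ≤ ν) (hY : ν < Y) : HasDerivAt (gP1 ν) (gP2 ν Y) Y := by
  have hY0 : 0 < Y := hν.trans_lt hY
  have hg := gP_pos hν hY
  have h1 := gP_d1 hν hY
  refine ((hasDerivAt_const Y (2 * ν ^ 4)).fun_div ((hasDerivAt_pow 5 Y).fun_mul h1) (by positivity)).congr_deriv ?_
  unfold gP2 gP1
  field_simp
  norm_num
  ring

lemma gP_zero {ν Y : ℝ} (hY0 : 0 < Y) (hY : Y ≤ ν) : gP ν Y = 0 := by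
  unfold gP
  apply Real.sqrt_eq_zero_of_nonpos
  rw [sub_nonpos, one_le_div (by positivity)]
  gcongr

lemma gP_PH {T y ν : ℝ} (hT : 0 < T) (hy : T / 2 ≤ y - 1 / 2) (hν : 0 ≤ ν) :
    PH T (ν - y) (fun t => gP ν (y + t)) (fun t => gP1 ν (y + t)) (fun t => gP2 ν (y + t)) := by
  have hYT : ∀ t ∈ Set.Icc (-(1/2):ℝ) (1/2), T / 2 ≤ y + t := fun t ht => by linarith [ht.1]
  have hY0 : ∀ t ∈ Set.Icc (-(1/2):ℝ) (1/2), 0 < y + t := fun t ht => by linarith [hYT t ht]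
  have hsig : ∀ t ∈ Set.Icc (-(1/2):ℝ) (1/2), ν - y < t →
      0 < Real.sqrt (T * (t - (ν - y))) ∧ Real.sqrt (T * (t - (ν - y))) ≤ 2 * ((y + t) * gP ν (y + t)) := by
    intro t ht htν
    have hY := hY0 t ht
    have hd : 0 < t - (ν - y) := by linarith
    have hg := gP_pos hν (show ν < y + t by linarith)
    refine ⟨Real.sqrt_pos.2 (by positivity), ?_⟩
    apply Real.sqrt_le_iff.2 ⟨by positivity, ?_⟩
    have h1 := gP_lower hν (show ν ≤ y + t by linarith) hY
    rw [div_le_iff₀ hY] at h1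
    have h2 := hYT t ht
    have h3 : (y + t) * (t - (ν - y)) ≤ (y + t) * (gP ν (y + t) ^ 2 * (y + t)) := by
      apply mul_le_mul_of_nonneg_left _ hY.le; linarith
    nlinarith
  have hder : ∀ (g g' : ℝ → ℝ) (t : ℝ), HasDerivAt g (g' (y + t)) (y + t) →
      HasDerivAt (fun s => g (y + s)) (g' (y + t)) t := by
    intro g g' t h
    exact h.comp_const_add y t
  constructor
  · intro t ht htu
    exact gP_zero (hY0 t ht) (by linarith)
  · unfold gP
    apply ContinuousOn.sqrt
    apply ContinuousOn.sub (by fun_prop)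
    apply ContinuousOn.div (by fun_prop) (by fun_prop)
    intro t ht
    have := hY0 t ht
    positivity
  · intro t ht htu
    exact hder _ _ t (gP_d1 hν (by linarith))
  · intro t ht htu
    exact hder _ _ t (gP_d2 hν (by linarith))
  · intro b hb hub
    have hcg : ContinuousOn (fun t => gP ν (y + t)) (Set.Icc b (1/2)) := by
      intro t ht
      exact (hder _ _ t (gP_d1 hν (by linarith [ht.1]))).continuousAt.continuousWithinAt
    unfold gP2
    apply ContinuousOn.neg
    apply ContinuousOn.add
    · apply ContinuousOn.div (by fun_prop) (ContinuousOn.mul (by fun_prop) hcg)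
      intro t ht
      have h1 := hY0 t ⟨hb.trans ht.1, ht.2⟩
      have h2 := gP_pos hν (show ν < y + t by linarith [ht.1])
      exact (mul_pos (pow_pos h1 6) h2).ne'
    · apply ContinuousOn.div (by fun_prop) (ContinuousOn.mul (by fun_prop) (hcg.pow 3))
      intro t ht
      have h1 := hY0 t ⟨hb.trans ht.1, ht.2⟩
      have h2 := gP_pos hν (show ν < y + t by linarith [ht.1])
      exact (mul_pos (pow_pos h1 10) (pow_pos h2 3)).ne'
  · intro t ht
    exact Real.sqrt_nonneg _
  · intro t ht htu
    have hY := hY0 t ht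
    have h1 := gP_upper hν (show ν ≤ y + t by linarith) hY
    have hd : 0 < t - (ν - y) := by linarith
    have h2 : gP ν (y + t) = Real.sqrt (gP ν (y + t) ^ 2) := (Real.sqrt_sq (Real.sqrt_nonneg _)).symm
    have h3 : (4:ℝ) * Real.sqrt ((t - (ν - y)) / T) = Real.sqrt (16 * ((t - (ν - y)) / T)) := by
      rw [Real.sqrt_mul (by norm_num), show (16:ℝ) = 4 ^ 2 by norm_num, Real.sqrt_sq (by norm_num)]
    change gP ν (y + t) ≤ _
    rw [h2, h3]
    apply Real.sqrt_le_sqrt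
    refine h1.trans ?_
    have h4 : (y + t - ν) / (y + t) ≤ (t - (ν - y)) / (T / 2) := by
      rw [show y + t - ν = t - (ν - y) by ring]
      gcongr
      exact hYT t ht
    have h5 : (t - (ν - y)) / (T / 2) = 2 * ((t - (ν - y)) / T) := by field_simp
    have h6 : 0 < (t - (ν - y)) / T := by positivity
    linarith
  · intro t ht htu
    have hY := hY0 t ht
    have hg := gP_pos hν (show ν < y + t by linarith)
    unfold gP1
    positivity
  · intro t ht htu
    have hY := hY0 t ht
    have hg := gP_pos hν (show ν < y + t by linarith)
    obtain ⟨s0, s1⟩ := hsig t ht htu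
    have hq : ν ^ 4 ≤ (y + t) ^ 4 := by gcongr; linarith
    unfold gP1
    rw [div_le_div_iff₀ (by positivity) s0]
    set Y := y + t
    set σ := Real.sqrt (T * (t - (ν - y)))
    calc 2 * ν ^ 4 * σ ≤ 2 * Y ^ 4 * (2 * (Y * gP ν Y)) := by gcongr
      _ = _ := by ring
  · intro t ht htu
    have hY := hY0 t ht
    have hg := gP_pos hν (show ν < y + t by linarith)
    unfold gP2
    rw [neg_nonpos]
    positivity
  · intro t ht htu
    have hY := hY0 t ht
    have hg := gP_pos hν (show ν < y + t by linarith)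
    obtain ⟨s0, s1⟩ := hsig t ht htu
    have hq : ν ^ 4 ≤ (y + t) ^ 4 := by gcongr; linarith
    have hq8 : ν ^ 8 ≤ (y + t) ^ 8 := by gcongr; linarith
    have hlow := gP_lower hν (show ν ≤ y + t by linarith) hY
    unfold gP2
    have hd : 0 < t - (ν - y) := by linarith
    have hdY : t - (ν - y) ≤ y + t := by linarith
    rw [abs_neg, abs_of_nonneg (by positivity)]
    have ed : y + t - ν = t - (ν - y) := by ring
    rw [ed, div_le_iff₀ hY] at hlow
    set Y := y + t
    set σ := Real.sqrt (T * (t - (ν - y)))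
    set d := t - (ν - y)
    have h1 : 10 * ν ^ 4 / (Y ^ 6 * gP ν Y) ≤ 20 / (σ * d) := by
      rw [div_le_div_iff₀ (by positivity) (by positivity)]
      calc 10 * ν ^ 4 * (σ * d) ≤ 10 * Y ^ 4 * ((2 * (Y * gP ν Y)) * Y) := by gcongr
        _ = _ := by ring
    have h2 : 4 * ν ^ 8 / (Y ^ 10 * gP ν Y ^ 3) ≤ 8 / (σ * d) := by
      rw [div_le_div_iff₀ (by positivity) (by positivity)]
      calc 4 * ν ^ 8 * (σ * d) ≤ 4 * Y ^ 8 * ((2 * (Y * gP ν Y)) * (gP ν Y ^ 2 * Y)) := by gcongr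
        _ = _ := by ring
    calc _ ≤ 20 / (σ * d) + 8 / (σ * d) := add_le_add h1 h2
      _ = 28 / (σ * d) := by ring
      _ ≤ _ := by gcongr; norm_num

/-- primal error for one radius -/
lemma primal_gP (N : ℕ) (hN : 12 ≤ N) {y ν : ℝ} (hy : tN N / 2 ≤ y - 1 / 2) (hν : 0 ≤ ν) :
    |(∫ t in (-(1/2):ℝ)..(1/2), dK N t * gP ν (y + t)) - gP ν y|
      ≤ 1000 * (4 + Real.log (tN N)) / (tN N * (1 + tN N * |ν - y|)) := by
  have := primal N hN (gP_PH (tN_pos N) hy hν)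
  simpa using this

lemma primal_gP_zero (N : ℕ) {y ν : ℝ} (hy : 1 / 2 < y) (hν : y + 1/2 ≤ ν) :
    (∫ t in (-(1/2):ℝ)..(1/2), dK N t * gP ν (y + t)) - gP ν y = 0 := by
  rw [gP_zero (by linarith) (by linarith), sub_zero, intervalIntegral.integral_congr (g := fun _ => (0:ℝ))]
  · simp
  · intro t ht
    rw [Set.uIcc_of_le (by norm_num)] at ht
    simp only
    rw [gP_zero (by linarith [ht.1]) (by linarith [ht.2]), mul_zero]

/-- Third order integration by parts. -/
lemma osc_ibp3 {p p1 p2 p3 : ℝ → ℝ} {c M2 M3 : ℝ} (hc : 0 < c)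
    (h0 : ∀ s, HasDerivAt p (p1 s) s) (h1 : ∀ s, HasDerivAt p1 (p2 s) s)
    (h2 : ∀ s, HasDerivAt p2 (p3 s) s) (h3 : Continuous p3)
    (e1 : p 1 = 0) (e2 : p (-1) = 0)
    (b2 : ∀ s ∈ Set.Icc (-1:ℝ) 1, |p2 s| ≤ M2) (b3 : ∀ s ∈ Set.Icc (-1:ℝ) 1, |p3 s| ≤ M3) :
    |(∫ s in (-1:ℝ)..1, p s * cos (c * s)) - (p1 1 - p1 (-1)) * cos c / c ^ 2|
      ≤ (2 * M2 + 2 * M3) / c ^ 3 := by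
  have hF : ∀ s, HasDerivAt (fun s => p s * sin (c * s) / c + p1 s * cos (c * s) / c ^ 2
      - p2 s * sin (c * s) / c ^ 3) (p s * cos (c * s) - p3 s * sin (c * s) / c ^ 3) s := by
    intro s
    refine (((((h0 s).fun_mul (hd_sin c s)).div_const c).fun_add
      (((h1 s).fun_mul (hd_cos c s)).div_const (c ^ 2))).fun_sub
      (((h2 s).fun_mul (hd_sin c s)).div_const (c ^ 3))).congr_deriv ?_
    field_simp
    ring
  have cp : Continuous p := continuous_iff_continuousAt.2 fun s => (h0 s).continuousAt
  have i1 : IntervalIntegrable (fun s => p s * cos (c * s)) volume (-1) 1 :=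
    (by fun_prop : Continuous fun s => p s * cos (c * s)).intervalIntegrable _ _
  have i2 : IntervalIntegrable (fun s => p3 s * sin (c * s) / c ^ 3) volume (-1) 1 :=
    (by fun_prop : Continuous fun s => p3 s * sin (c * s) / c ^ 3).intervalIntegrable _ _
  have key := intervalIntegral.integral_eq_sub_of_hasDerivAt (a := -1) (b := 1)
    (fun s _ => hF s) (i1.sub i2)
  rw [intervalIntegral.integral_sub i1 i2] at key
  have hb : |∫ s in (-1:ℝ)..1, p3 s * sin (c * s) / c ^ 3| ≤ M3 / c ^ 3 * |1 - (-1:ℝ)| := by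
    have := intervalIntegral.norm_integral_le_of_norm_le_const (a := -1) (b := 1)
      (f := fun s => p3 s * sin (c * s) / c ^ 3) (C := M3 / c ^ 3) (fun s hs => by
        rw [Set.uIoc_of_le (by norm_num)] at hs
        rw [Real.norm_eq_abs, abs_div, abs_mul, abs_of_pos (by positivity : 0 < c ^ 3)]
        gcongr
        have := b3 s ⟨hs.1.le, hs.2⟩
        have h4 := abs_sin_le_one (c * s)
        calc |p3 s| * |sin (c * s)| ≤ |p3 s| * 1 := by gcongr
          _ ≤ M3 := by linarith)
    exact this
  have hs : |sin c| ≤ 1 := abs_sin_le_one c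
  have b2a := b2 1 (by norm_num)
  have b2b := b2 (-1) (by norm_num)
  have hc3 : 0 < c ^ 3 := by positivity
  have e : (∫ s in (-1:ℝ)..1, p s * cos (c * s)) - (p1 1 - p1 (-1)) * cos c / c ^ 2
      = (∫ s in (-1:ℝ)..1, p3 s * sin (c * s) / c ^ 3) - (p2 1 + p2 (-1)) * sin c / c ^ 3 := by
    have : (∫ s in (-1:ℝ)..1, p s * cos (c * s)) = (∫ s in (-1:ℝ)..1, p3 s * sin (c * s) / c ^ 3)
       + ((∫ s in (-1:ℝ)..1, p s * cos (c * s)) - (∫ s in (-1:ℝ)..1, p3 s * sin (c * s) / c ^ 3)) := by ring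
    rw [this, key]
    simp only [e1, e2, mul_one, mul_neg, cos_neg, sin_neg]
    ring
  rw [e]
  have t : |(p2 1 + p2 (-1)) * sin c / c ^ 3| ≤ 2 * M2 / c ^ 3 := by
    rw [abs_div, abs_mul, abs_of_pos hc3]
    apply div_le_div_of_nonneg_right _ hc3.le
    have := abs_add_le (p2 1) (p2 (-1))
    calc |p2 1 + p2 (-1)| * |sin c| ≤ |p2 1 + p2 (-1)| * 1 := by gcongr
      _ ≤ _ := by linarith
  have n : |1 - (-1:ℝ)| = 2 := by norm_num
  rw [n] at hb
  have := abs_sub (∫ s in (-1:ℝ)..1, p3 s * sin (c * s) / c ^ 3) ((p2 1 + p2 (-1)) * sin c / c ^ 3)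
  calc _ ≤ _ := this
    _ ≤ M3 / c ^ 3 * 2 + 2 * M2 / c ^ 3 := by linarith
    _ = _ := by ring

/-- 1D oscillatory asymptotics for the slices. -/
lemma slice_osc {c τ : ℝ} (hc : 0 < c) (hτ : τ ∈ Set.Icc (-1:ℝ) 1) :
    |(∫ s in (-1:ℝ)..1, (1 - s ^ 2) * sqrt ((1 + τ ^ 2) + (1 - τ ^ 2) * s ^ 2) * cos (c * s))
      + 4 * sqrt 2 * cos c / c ^ 2| ≤ 68 / c ^ 3 := by
  have ht : τ ^ 2 ≤ 1 := by rw [sq_le_one_iff_abs_le_one, abs_le]; exact hτ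
  obtain ⟨b, hb⟩ : ∃ b, b = 1 - τ ^ 2 := ⟨_, rfl⟩
  have hb0 : 0 ≤ b := by linarith
  have hb1 : b ≤ 1 := by nlinarith [sq_nonneg τ]
  have ea : 1 + τ ^ 2 = 2 - b := by linarith
  rw [ea, ← hb]
  set h : ℝ → ℝ := fun s => sqrt (2 - b + b * s ^ 2) with hh
  have hq1 : ∀ s : ℝ, 1 ≤ 2 - b + b * s ^ 2 := fun s => by nlinarith [mul_nonneg hb0 (sq_nonneg s)]
  have h1 : ∀ s, 1 ≤ h s := fun s => by
    rw [hh]; exact Real.one_le_sqrt.2 (hq1 s)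
  have h1' : ∀ s, h s ≠ 0 := fun s => by have := h1 s; positivity
  have hsq : ∀ s, h s ^ 2 = 2 - b + b * s ^ 2 := fun s => Real.sq_sqrt (by linarith [hq1 s])
  have hc' : Continuous h := by rw [hh]; fun_prop
  have d0 : ∀ s, HasDerivAt h (b * s / h s) s := by
    intro s
    have : HasDerivAt (fun s => 2 - b + b * s ^ 2) (b * (2 * s)) s := by
      have := ((hasDerivAt_pow 2 s).const_mul b).const_add (2 - b)
      simpa using this
    refine (this.sqrt (by linarith [hq1 s])).congr_deriv ?_
    change b * (2 * s) / (2 * h s) = _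
    have := h1' s
    field_simp
  have d1 : ∀ s, HasDerivAt (fun s => b * s / h s) ((2 - b) * b / h s ^ 3) s := by
    intro s
    refine (((hasDerivAt_id' s).const_mul b).fun_div (d0 s) (h1' s)).congr_deriv ?_
    have := h1' s
    have e := hsq s
    field_simp
    rw [e]; ring
  have d2 : ∀ s, HasDerivAt (fun s => (2 - b) * b / h s ^ 3) (-3 * (2 - b) * b ^ 2 * s / h s ^ 5) s := by
    intro s
    refine ((hasDerivAt_const s ((2 - b) * b)).fun_div ((d0 s).fun_pow 3)
      (pow_ne_zero _ (h1' s))).congr_deriv ?_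
    have := h1' s
    field_simp
    norm_num
    ring
  have q0 : ∀ s : ℝ, HasDerivAt (fun s : ℝ => 1 - s ^ 2) (-(2 * s)) s := by
    intro s
    have := (hasDerivAt_pow 2 s).const_sub 1
    simpa using this
  have q1 : ∀ s : ℝ, HasDerivAt (fun s : ℝ => -(2 * s)) (-2) s := by
    intro s
    have := ((hasDerivAt_id' s).const_mul 2).fun_neg
    simpa using this
  have bh : ∀ s ∈ Set.Icc (-1:ℝ) 1, h s ≤ 2 ∧ |s| ≤ 1 ∧ s ^ 2 ≤ 1 := by
    intro s hs
    have hs1 : |s| ≤ 1 := abs_le.2 hs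
    have hs2 : s ^ 2 ≤ 1 := by rw [sq_le_one_iff_abs_le_one]; exact hs1
    refine ⟨?_, hs1, hs2⟩
    rw [hh]; apply Real.sqrt_le_iff.2
    constructor
    · norm_num
    · nlinarith
  have bs : ∀ s ∈ Set.Icc (-1:ℝ) 1, |b * s / h s| ≤ 1 := by
    intro s hs
    obtain ⟨_, u, _⟩ := bh s hs
    have := h1 s
    rw [abs_div, abs_mul, abs_of_nonneg hb0, abs_of_pos (by linarith : 0 < h s), div_le_one (by linarith)]
    nlinarith [abs_nonneg s]
  have hbb : 0 ≤ (2 - b) * b ∧ (2 - b) * b ≤ 1 := by constructor <;> nlinarith [sq_nonneg (b - 1)]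
  have bs2 : ∀ s, |(2 - b) * b / h s ^ 3| ≤ 1 := by
    intro s
    have := h1 s
    have h3 : 1 ≤ h s ^ 3 := one_le_pow₀ this
    rw [abs_div, abs_of_nonneg hbb.1, abs_of_pos (by linarith), div_le_one (by linarith)]
    linarith [hbb.2]
  have bs3 : ∀ s ∈ Set.Icc (-1:ℝ) 1, |-3 * (2 - b) * b ^ 2 * s / h s ^ 5| ≤ 3 := by
    intro s hs
    obtain ⟨_, u, _⟩ := bh s hs
    have := h1 s
    have h3 : 1 ≤ h s ^ 5 := one_le_pow₀ this
    have e : -3 * (2 - b) * b ^ 2 * s = -3 * (((2 - b) * b) * b * s) := by ring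
    rw [abs_div, e, abs_mul, abs_mul, abs_mul, abs_of_nonneg hbb.1, abs_of_nonneg hb0,
      abs_of_pos (by linarith : 0 < h s ^ 5), div_le_iff₀ (by linarith)]
    have n : |(-3:ℝ)| = 3 := by norm_num
    rw [n]
    have : (2 - b) * b * b * |s| ≤ 1 * 1 * 1 := by
      have := hbb.1
      have := hbb.2
      gcongr
    linarith
  have key := osc_ibp3 (p := fun s => (1 - s ^ 2) * h s)
    (p1 := fun s => -(2 * s) * h s + (1 - s ^ 2) * (b * s / h s))
    (p2 := fun s => (-2 * h s + -(2 * s) * (b * s / h s)) + (-(2 * s) * (b * s / h s)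
      + (1 - s ^ 2) * ((2 - b) * b / h s ^ 3)))
    (p3 := fun s => (-2 * (b * s / h s) + (-2 * (b * s / h s) + -(2 * s) * ((2 - b) * b / h s ^ 3)))
      + ((-2 * (b * s / h s) + -(2 * s) * ((2 - b) * b / h s ^ 3))
        + (-(2 * s) * ((2 - b) * b / h s ^ 3) + (1 - s ^ 2) * (-3 * (2 - b) * b ^ 2 * s / h s ^ 5))))
    (c := c) (M2 := 10) (M3 := 24) hc
    (fun s => (q0 s).fun_mul (d0 s))
    (fun s => ((q1 s).fun_mul (d0 s)).fun_add ((q0 s).fun_mul (d1 s)))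
    (fun s => ((((d0 s).const_mul (-2)).fun_add ((q1 s).fun_mul (d1 s))).fun_add
      (((q1 s).fun_mul (d1 s)).fun_add ((q0 s).fun_mul (d2 s)))))
    (by
      have c1 : Continuous fun s => b * s / h s := by fun_prop (disch := exact h1')
      have c2 : Continuous fun s => (2 - b) * b / h s ^ 3 :=
        Continuous.div (by fun_prop) (by fun_prop) (fun s => pow_ne_zero _ (h1' s))
      have c3 : Continuous fun s => -3 * (2 - b) * b ^ 2 * s / h s ^ 5 :=
        Continuous.div (by fun_prop) (by fun_prop) (fun s => pow_ne_zero _ (h1' s))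
      fun_prop)
    (by simp) (by simp)
    (by
      intro s hs
      obtain ⟨u1, u2, u3⟩ := bh s hs
      have v1 := bs s hs
      have v2 := bs2 s
      have v0 := h1 s
      have w1 : |s * (b * s / h s)| ≤ 1 := by
        rw [abs_mul]
        calc _ ≤ (1:ℝ) * 1 := by gcongr
          _ = 1 := by norm_num
      have w2 : |(1 - s ^ 2) * ((2 - b) * b / h s ^ 3)| ≤ 1 := by
        rw [abs_mul, abs_of_nonneg (by linarith : 0 ≤ 1 - s ^ 2)]
        calc _ ≤ (1:ℝ) * 1 := by gcongr; nlinarith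
          _ = 1 := by norm_num
      rw [abs_le] at *
      constructor <;> linarith)
    (by
      intro s hs
      obtain ⟨u1, u2, u3⟩ := bh s hs
      have v1 := bs s hs
      have v2 := bs2 s
      have v0 := h1 s
      have w1 : |s * ((2 - b) * b / h s ^ 3)| ≤ 1 := by
        rw [abs_mul]
        calc _ ≤ (1:ℝ) * 1 := by gcongr
          _ = 1 := by norm_num
      have w2 : |(1 - s ^ 2) * (-3 * (2 - b) * b ^ 2 * s / h s ^ 5)| ≤ 3 := by
        rw [abs_mul, abs_of_nonneg (by linarith : 0 ≤ 1 - s ^ 2)]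
        calc _ ≤ (1:ℝ) * 3 := by gcongr; nlinarith; exact bs3 s hs
          _ = 3 := by norm_num
      rw [abs_le] at *
      constructor <;> linarith)
  have hh1 : h 1 = sqrt 2 := by rw [hh]; norm_num
  have hh2 : h (-1) = sqrt 2 := by rw [hh]; norm_num
  simp only [hh1, hh2] at key
  convert key using 2
  · ring
  · norm_num

lemma gP_cont {Y : ℝ} : Continuous fun ν => gP ν Y := by
  unfold gP; fun_prop

lemma gP_le_one (ν Y : ℝ) : gP ν Y ≤ 1 := by
  unfold gP
  apply Real.sqrt_le_one.2
  have : 0 ≤ ν ^ 4 / Y ^ 4 := by positivity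
  linarith

lemma gP_nonneg (ν Y : ℝ) : 0 ≤ gP ν Y := Real.sqrt_nonneg _

lemma gP_compact {Y : ℝ} (hY : 0 < Y) (F : ℂ → ℝ) : HasCompactSupport fun z : ℂ => gP ‖z‖ Y * F z := by
  apply HasCompactSupport.intro (isCompact_closedBall (0:ℂ) Y)
  intro z hz
  simp only [Metric.mem_closedBall, dist_zero_right, not_le] at hz
  rw [gP_zero hY hz.le, zero_mul]

lemma gP_integrable {Y : ℝ} (hY : 0 < Y) {F : ℂ → ℝ} (hF : Continuous F) :
    Integrable (fun z : ℂ => gP ‖z‖ Y * F z) :=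
  ((gP_cont.comp continuous_norm).mul hF).integrable_of_hasCompactSupport (gP_compact hY F)

/-- The Fourier transform of the radial profile. -/
def AF (R : ℝ) : ℝ := ∫ z : ℂ, gP ‖z‖ 1 * cos (2 * π * R * z.re)

lemma gP_scale {ν Y : ℝ} (hY : 0 < Y) : gP (Y * ν) Y = gP ν 1 := by
  unfold gP
  congr 2
  field_simp

lemma AF_scale {Y : ℝ} (hY : 0 < Y) (r : ℝ) :
    ∫ z : ℂ, gP ‖z‖ Y * cos (2 * π * r * z.re) = Y ^ 2 * AF (Y * r) := by
  have := Measure.integral_comp_smul (volume : Measure ℂ)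
    (fun z : ℂ => gP ‖z‖ Y * cos (2 * π * r * z.re)) Y
  rw [Complex.finrank_real_complex, abs_of_pos (by positivity), smul_eq_mul] at this
  have e : AF (Y * r) = ∫ z : ℂ, gP ‖Y • z‖ Y * cos (2 * π * r * (Y • z).re) := by
    unfold AF
    congr 1
    ext z
    rw [norm_smul, Real.norm_eq_abs, abs_of_pos hY, gP_scale hY, Complex.smul_re, smul_eq_mul]
    congr 2; ring
  rw [e, this]
  field_simp

lemma AF_rot {Y : ℝ} (hY : 0 < Y) (k : ℂ) :
    ∫ z : ℂ, gP ‖z‖ Y * cos (2 * π * (k.re * z.re + k.im * z.im)) = Y ^ 2 * AF (Y * ‖k‖) := by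
  rw [← AF_scale hY]
  by_cases hk : k = 0
  · simp [hk]
  have hk' : ‖k‖ ≠ 0 := norm_ne_zero_iff.2 hk
  let u : Circle := ⟨k / ‖k‖, by simp [Submonoid.unitSphere, hk']⟩
  have := (rotation u).measurePreserving.integral_comp' (f := (rotation u).toMeasurableEquiv)
    (fun z : ℂ => gP ‖z‖ Y * cos (2 * π * (k.re * z.re + k.im * z.im)))
  rw [← this]
  congr 1
  ext z
  change gP ‖rotation u z‖ Y * cos (2 * π * (k.re * (rotation u z).re + k.im * (rotation u z).im)) = _
  rw [LinearIsometryEquiv.norm_map, rotation_apply]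
  congr 2
  have e : (u : ℂ) = k / ‖k‖ := rfl
  have hn : ‖k‖ ^ 2 = k.re ^ 2 + k.im ^ 2 := by
    rw [← Complex.normSq_eq_norm_sq, Complex.normSq_apply]; ring
  rw [e, Complex.mul_re, Complex.mul_im, Complex.div_ofReal_re, Complex.div_ofReal_im]
  field_simp
  linear_combination z.re * (-hn)

lemma AF_prod (R : ℝ) : AF R = ∫ s : ℝ, ∫ t : ℝ, sqrt (1 - (s ^ 2 + t ^ 2) ^ 2) * cos (2 * π * R * s) := by
  have hi := gP_integrable (Y := 1) one_pos (F := fun z => cos (2 * π * R * z.re)) (by fun_prop)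
  have hm := Complex.volume_preserving_equiv_real_prod
  have e : (fun z : ℂ => gP ‖z‖ 1 * cos (2 * π * R * z.re)) =
      (fun p : ℝ × ℝ => sqrt (1 - (p.1 ^ 2 + p.2 ^ 2) ^ 2) * cos (2 * π * R * p.1)) ∘
        Complex.measurableEquivRealProd := by
    ext z
    simp only [Function.comp, Complex.measurableEquivRealProd_apply]
    unfold gP
    congr 3
    have : ‖z‖ ^ 2 = z.re ^ 2 + z.im ^ 2 := by
      rw [← Complex.normSq_eq_norm_sq, Complex.normSq_apply]; ring
    rw [← this]; ring
  have h1 : Integrable (fun p : ℝ × ℝ => sqrt (1 - (p.1 ^ 2 + p.2 ^ 2) ^ 2) * cos (2 * π * R * p.1)) := by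
    rw [← hm.integrable_comp_emb (MeasurableEquiv.measurableEmbedding _), ← e]
    exact hi
  unfold AF
  rw [e]
  have := hm.integral_comp' (fun p : ℝ × ℝ => sqrt (1 - (p.1 ^ 2 + p.2 ^ 2) ^ 2) * cos (2 * π * R * p.1))
  simp only [Function.comp_def]
  rw [this, Measure.volume_eq_prod, integral_prod _ h1]

lemma slice_eq {s : ℝ} (hs : s ∈ Set.Icc (-1:ℝ) 1) :
    ∫ t : ℝ, sqrt (1 - (s ^ 2 + t ^ 2) ^ 2) =
      ∫ τ in (-1:ℝ)..1, (1 - s ^ 2) * (sqrt (1 - τ ^ 2) * sqrt ((1 + τ ^ 2) + (1 - τ ^ 2) * s ^ 2)) := by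
  have hs2 : s ^ 2 ≤ 1 := by rw [sq_le_one_iff_abs_le_one, abs_le]; exact hs
  rcases hs2.eq_or_lt with h | h
  · have : ∀ t : ℝ, sqrt (1 - (s ^ 2 + t ^ 2) ^ 2) = 0 := by
      intro t
      apply Real.sqrt_eq_zero_of_nonpos
      rw [h]; nlinarith [sq_nonneg t, sq_nonneg (t ^ 2)]
    simp only [this]
    simp [h]
  · have hw : 0 < 1 - s ^ 2 := by linarith
    set w := sqrt (1 - s ^ 2) with hwd
    have hw0 : 0 < w := Real.sqrt_pos.2 hw
    have hw2 : w ^ 2 = 1 - s ^ 2 := Real.sq_sqrt hw.le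
    have := Measure.integral_comp_mul_left (fun t : ℝ => sqrt (1 - (s ^ 2 + t ^ 2) ^ 2)) w
    rw [abs_of_pos (by positivity), smul_eq_mul] at this
    have e1 : ∫ t : ℝ, sqrt (1 - (s ^ 2 + t ^ 2) ^ 2) =
        w * ∫ τ : ℝ, sqrt (1 - (s ^ 2 + (w * τ) ^ 2) ^ 2) := by
      rw [this]; field_simp
    have e2 : ∀ τ : ℝ, 1 - (s ^ 2 + (w * τ) ^ 2) ^ 2 =
        w ^ 2 * ((1 - τ ^ 2) * ((1 + τ ^ 2) + (1 - τ ^ 2) * s ^ 2)) := by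
      intro τ
      rw [mul_pow, hw2]; ring
    have hpos : ∀ τ : ℝ, 0 ≤ (1 + τ ^ 2) + (1 - τ ^ 2) * s ^ 2 := by
      intro τ; nlinarith [mul_nonneg hw.le (sq_nonneg τ), sq_nonneg s]
    have e3 : ∀ τ : ℝ, sqrt (1 - (s ^ 2 + (w * τ) ^ 2) ^ 2) =
        w * (sqrt (1 - τ ^ 2) * sqrt ((1 + τ ^ 2) + (1 - τ ^ 2) * s ^ 2)) := by
      intro τ
      rw [e2, Real.sqrt_mul (by positivity), Real.sqrt_sq hw0.le, Real.sqrt_mul' _ (hpos τ)]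
    rw [e1, intervalIntegral.integral_of_le (by norm_num),
      setIntegral_congr_set Ioc_ae_eq_Icc,
      setIntegral_eq_integral_of_forall_compl_eq_zero]
    · rw [← integral_const_mul]
      congr 1
      ext τ
      rw [e3, ← hw2]; ring
    · intro τ hτ
      have : sqrt (1 - τ ^ 2) = 0 := by
        apply Real.sqrt_eq_zero_of_nonpos
        have : ¬ |τ| ≤ 1 := fun h => hτ (abs_le.1 h)
        rw [← sq_le_one_iff_abs_le_one] at this
        linarith
      rw [this]; simp

lemma AF_iter (R : ℝ) : AF R = ∫ τ in (-1:ℝ)..1, sqrt (1 - τ ^ 2) *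
    ∫ s in (-1:ℝ)..1, (1 - s ^ 2) * sqrt ((1 + τ ^ 2) + (1 - τ ^ 2) * s ^ 2) * cos (2 * π * R * s) := by
  rw [AF_prod]
  have e1 : ∫ s : ℝ, ∫ t : ℝ, sqrt (1 - (s ^ 2 + t ^ 2) ^ 2) * cos (2 * π * R * s) =
      ∫ s in (-1:ℝ)..1, ∫ τ in (-1:ℝ)..1, (1 - s ^ 2) * (sqrt (1 - τ ^ 2) *
        sqrt ((1 + τ ^ 2) + (1 - τ ^ 2) * s ^ 2)) * cos (2 * π * R * s) := by
    rw [intervalIntegral.integral_of_le (by norm_num : (-1:ℝ) ≤ 1),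
      setIntegral_congr_set Ioc_ae_eq_Icc, ← setIntegral_eq_integral_of_forall_compl_eq_zero
        (s := Set.Icc (-1:ℝ) 1)]
    · apply setIntegral_congr_fun measurableSet_Icc
      intro s hs
      simp only
      rw [integral_mul_const, slice_eq hs, intervalIntegral.integral_mul_const]
    · intro s hs
      have : ∀ t : ℝ, sqrt (1 - (s ^ 2 + t ^ 2) ^ 2) = 0 := by
        intro t
        apply Real.sqrt_eq_zero_of_nonpos
        have : ¬ |s| ≤ 1 := fun h => hs (abs_le.1 h)
        rw [← sq_le_one_iff_abs_le_one] at this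
        nlinarith [sq_nonneg t, sq_nonneg (t ^ 2)]
      simp [this]
  rw [e1, intervalIntegral_intervalIntegral_swap]
  · congr 1
    ext τ
    rw [← intervalIntegral.integral_const_mul]
    congr 1
    ext s
    ring
  · have : Continuous (Function.uncurry fun s τ : ℝ => (1 - s ^ 2) * (sqrt (1 - τ ^ 2) *
        sqrt ((1 + τ ^ 2) + (1 - τ ^ 2) * s ^ 2)) * cos (2 * π * R * s)) := by
      unfold Function.uncurry; fun_prop
    apply (this.continuousOn.integrableOn_compact (K := Set.uIcc (-1:ℝ) 1 ×ˢ Set.uIcc (-1:ℝ) 1)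
      (isCompact_uIcc.prod isCompact_uIcc)).mono_set
    exact Set.prod_mono Set.uIoc_subset_uIcc Set.uIoc_subset_uIcc

lemma AF_asymp {R : ℝ} (hR : 0 < R) :
    |AF R - (-(sqrt 2 / (2 * π))) * cos (2 * π * R) / R ^ 2| ≤ 1 / R ^ 3 := by
  set c := 2 * π * R with hc
  have hc0 : 0 < c := by positivity
  have hcontI : Continuous fun τ : ℝ => ∫ s in (-1:ℝ)..1, (1 - s ^ 2) *
      sqrt ((1 + τ ^ 2) + (1 - τ ^ 2) * s ^ 2) * cos (c * s) := by
    apply intervalIntegral.continuous_parametric_intervalIntegral_of_continuous'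
    unfold Function.uncurry; fun_prop
  have e : (-(sqrt 2 / (2 * π))) * cos c / R ^ 2 =
      ∫ τ in (-1:ℝ)..1, sqrt (1 - τ ^ 2) * (-(4 * sqrt 2 * cos c / c ^ 2)) := by
    rw [intervalIntegral.integral_mul_const, integral_sqrt_one_sub_sq, hc]
    field_simp; norm_num; ring
  rw [AF_iter, ← hc, e, ← intervalIntegral.integral_sub
    ((by fun_prop : Continuous _).intervalIntegrable _ _)
    ((by fun_prop : Continuous _).intervalIntegrable _ _)]
  have := intervalIntegral.norm_integral_le_of_norm_le_const (a := -1) (b := 1) (C := 68 / c ^ 3)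
    (f := fun τ => sqrt (1 - τ ^ 2) * (∫ s in (-1:ℝ)..1, (1 - s ^ 2) *
      sqrt ((1 + τ ^ 2) + (1 - τ ^ 2) * s ^ 2) * cos (c * s)) -
      sqrt (1 - τ ^ 2) * (-(4 * sqrt 2 * cos c / c ^ 2))) (fun τ hτ => by
        rw [Set.uIoc_of_le (by norm_num)] at hτ
        rw [← mul_sub, sub_neg_eq_add, Real.norm_eq_abs, abs_mul, abs_of_nonneg (Real.sqrt_nonneg _)]
        have h1 := slice_osc hc0 ⟨hτ.1.le, hτ.2⟩
        have h2 : sqrt (1 - τ ^ 2) ≤ 1 := by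
          apply Real.sqrt_le_one.2; nlinarith [sq_nonneg τ]
        calc _ ≤ 1 * (68 / c ^ 3) := by gcongr
          _ = _ := one_mul _)
  rw [Real.norm_eq_abs] at this
  refine this.trans ?_
  have n : |(1:ℝ) - -1| = 2 := by norm_num
  rw [n, hc]
  have h3 := Real.pi_gt_three
  have h4 : (27:ℝ) ≤ π ^ 3 := by
    calc (27:ℝ) = 3 ^ 3 := by norm_num
      _ ≤ π ^ 3 := by gcongr
  have : 68 / (2 * π * R) ^ 3 * 2 = (17 / π ^ 3) * (1 / R ^ 3) := by field_simp; norm_num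
  rw [this]
  have : 17 / π ^ 3 ≤ 1 := by rw [div_le_one (by positivity)]; linarith
  calc _ ≤ 1 * (1 / R ^ 3) := by gcongr
    _ = _ := one_mul _

/-- The integer box. -/
def zbox (M : ℕ) : Finset (Fin 2 → ℤ) := Fintype.piFinset fun _ => Finset.Icc (-(M:ℤ)) M

lemma mem_zbox {M : ℕ} {n : Fin 2 → ℤ} : n ∈ zbox M ↔ ∀ i, |n i| ≤ M := by
  simp [zbox, abs_le]

/-- Cast of integer vectors. -/
def zc (n : Fin 2 → ℤ) : Fin 2 → ℝ := fun i => (n i : ℝ)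

/-- periodization -/
def perz (f : (Fin 2 → ℝ) → ℝ) (v : Fin 2 → ℝ) : ℝ := ∑' n : Fin 2 → ℤ, f (v + zc n)

lemma perz_fin {f : (Fin 2 → ℝ) → ℝ} {M : ℕ} (hM : ∀ v : Fin 2 → ℝ, (∃ i, (M:ℝ) < |v i|) → f v = 0)
    {K : ℕ} {v : Fin 2 → ℝ} (hv : ∀ i, |v i| ≤ K) {n : Fin 2 → ℤ} (hn : n ∉ zbox (K + M)) :
    f (v + zc n) = 0 := by
  rw [mem_zbox] at hn
  push Not at hn
  obtain ⟨i, hi⟩ := hn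
  apply hM
  refine ⟨i, ?_⟩
  have h1 : ((K + M : ℕ) : ℝ) < |(n i : ℝ)| := by exact_mod_cast hi
  push_cast at h1
  have h2 := hv i
  have h3 : |(n i : ℝ)| ≤ |v i + n i| + |v i| := by
    have := abs_sub (v i + n i) (v i)
    simpa using this
  simp only [Pi.add_apply, zc]
  linarith

lemma perz_eq {f : (Fin 2 → ℝ) → ℝ} {M : ℕ} (hM : ∀ v : Fin 2 → ℝ, (∃ i, (M:ℝ) < |v i|) → f v = 0)
    {K : ℕ} {v : Fin 2 → ℝ} (hv : ∀ i, |v i| ≤ K) :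
    perz f v = ∑ n ∈ zbox (K + M), f (v + zc n) :=
  tsum_eq_sum fun _ hn => perz_fin hM hv hn

lemma perz_add (f : (Fin 2 → ℝ) → ℝ) (v : Fin 2 → ℝ) (m : Fin 2 → ℤ) : perz f (v + zc m) = perz f v := by
  unfold perz
  rw [← (Equiv.addLeft m).tsum_eq (fun n => f (v + zc n))]
  congr 1; ext n
  congr 1; ext i
  simp [zc, add_assoc]

lemma perz_cont {f : (Fin 2 → ℝ) → ℝ} (hf : Continuous f) {M : ℕ}
    (hM : ∀ v : Fin 2 → ℝ, (∃ i, (M:ℝ) < |v i|) → f v = 0) : Continuous (perz f) := by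
  rw [continuous_iff_continuousAt]
  intro v
  obtain ⟨K, hK⟩ := exists_nat_gt ‖v‖
  have : ∀ᶠ w in nhds v, (∑ n ∈ zbox (K + M), f (w + zc n)) = perz f w := by
    have : ∀ᶠ w in nhds v, ‖w‖ < K := (continuous_norm.continuousAt).eventually_lt continuousAt_const hK
    filter_upwards [this] with w hw
    exact (perz_eq hM fun i => (norm_le_pi_norm w i).trans hw.le).symm
  refine ContinuousAt.congr ?_ this
  exact (by fun_prop : Continuous fun w => ∑ n ∈ zbox (K + M), f (w + zc n)).continuousAt

/-- unit boxes -/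
def ubox (m : Fin 2 → ℤ) : Set (Fin 2 → ℝ) := {x | ∀ i, x i ∈ Set.Ioc (m i : ℝ) (m i + 1)}

lemma mem_ubox {m : Fin 2 → ℤ} {x : Fin 2 → ℝ} : x ∈ ubox m ↔ ∀ i, ⌈x i⌉ = m i + 1 := by
  unfold ubox
  simp only [Set.mem_ofPred_eq, Set.mem_Ioc, Int.ceil_eq_iff]
  push_cast
  simp

lemma ubox_meas (m : Fin 2 → ℤ) : MeasurableSet (ubox m) :=
  MeasurableSet.univ_pi' fun _ => measurableSet_Ioc

lemma unfold_int {g : (Fin 2 → ℝ) → ℂ} (hg : Integrable g) :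
    HasSum (fun m : Fin 2 → ℤ => ∫ x in ubox 0, g (x + zc m)) (∫ x, g x) := by
  have hU : (⋃ m, ubox m) = Set.univ := by
    ext x
    simp only [Set.mem_iUnion, Set.mem_univ, iff_true]
    exact ⟨fun i => ⌈x i⌉ - 1, mem_ubox.2 fun i => by ring⟩
  have hd : Pairwise (Function.onFun Disjoint ubox) := by
    intro m m' hmm
    rw [Function.onFun, Set.disjoint_left]
    intro x hx hx'
    apply hmm
    ext i
    have h1 := mem_ubox.1 hx i
    have h2 := mem_ubox.1 hx' i
    linarith
  have := hasSum_integral_iUnion (μ := volume) (f := g) ubox_meas hd hg.integrableOn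
  rw [hU, setIntegral_univ] at this
  refine (congrArg (fun F : (Fin 2 → ℤ) → ℂ => HasSum F (∫ x, g x)) ?_).mpr this
  funext m
  have hp := measurePreserving_add_right (volume : Measure (Fin 2 → ℝ)) (zc m)
  have := hp.setIntegral_preimage_emb (MeasurableEquiv.addRight (zc m)).measurableEmbedding g (ubox m)
  rw [← this]
  congr 2
  ext x
  simp [mem_ubox, zc]
  omega

lemma mF_eq (n : Fin 2 → ℤ) (x : Fin 2 → ℝ) :
    UnitAddTorus.mFourier n (fun i => (x i : UnitAddCircle)) =
      Complex.exp ((2 * π * ∑ i, (n i : ℝ) * x i : ℝ) * Complex.I) := by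
  simp only [UnitAddTorus.mFourier, ContinuousMap.coe_mk, fourier_coe_apply, Fin.prod_univ_two,
    ← Complex.exp_add, Fin.sum_univ_two]
  congr 1
  push_cast
  ring

lemma mF_per (n m : Fin 2 → ℤ) (x : Fin 2 → ℝ) :
    UnitAddTorus.mFourier n (fun i => ((x + zc m) i : UnitAddCircle)) =
    UnitAddTorus.mFourier n (fun i => (x i : UnitAddCircle)) := by
  congr 1
  ext i
  simp [zc]

/-- Poisson summation for even continuous compactly supported functions on the plane. -/
lemma poisson2 {f : (Fin 2 → ℝ) → ℝ} (hf : Continuous f) {M : ℕ}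
    (hM : ∀ v : Fin 2 → ℝ, (∃ i, (M:ℝ) < |v i|) → f v = 0) (heven : ∀ v, f (-v) = f v)
    {c : (Fin 2 → ℤ) → ℝ} (hc : ∀ n, c n = ∫ v, f v * cos (2 * π * ∑ i, (n i : ℝ) * v i))
    (hs : Summable c) : HasSum c (∑ n ∈ zbox M, f (zc n)) := by
  have hq : IsOpenQuotientMap (fun (x : Fin 2 → ℝ) => (fun i => (x i : UnitAddCircle))) :=
    IsOpenQuotientMap.piMap fun _ => QuotientAddGroup.isOpenQuotientMap_mk
  let F0 : UnitAddTorus (Fin 2) → ℂ := fun x => (perz f (Function.surjInv hq.surjective x) : ℂ)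
  have hF0 : ∀ x : Fin 2 → ℝ, F0 (fun i => (x i : UnitAddCircle)) = perz f x := by
    intro x
    have h1 := Function.surjInv_eq hq.surjective (fun i => (x i : UnitAddCircle))
    set w := Function.surjInv hq.surjective (fun i => (x i : UnitAddCircle)) with hw
    have h2 : ∀ i, ∃ m : ℤ, w i = x i + m := by
      intro i
      have h3 : ((w i : ℝ) : UnitAddCircle) = (x i : UnitAddCircle) := congrFun h1 i
      have h4 : ((w i - x i : ℝ) : UnitAddCircle) = 0 := by
        rw [AddCircle.coe_sub, h3, sub_self]
      obtain ⟨m, hm⟩ := (AddCircle.coe_eq_zero_iff 1).1 h4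
      refine ⟨m, ?_⟩
      simp at hm
      linarith
    choose m hm using h2
    change ((perz f w : ℝ) : ℂ) = _
    have : w = x + zc m := by ext i; simp [zc, hm]
    rw [this, perz_add]
  let F : C(UnitAddTorus (Fin 2), ℂ) := ⟨F0, by
    rw [← hq.continuous_comp_iff]
    have : F0 ∘ (fun (x : Fin 2 → ℝ) => (fun i => (x i : UnitAddCircle))) = fun x => (perz f x : ℂ) := by
      ext x; exact hF0 x
    rw [this]
    exact Complex.continuous_ofReal.comp (perz_cont hf hM)⟩
  have hsupp : HasCompactSupport f := by
    apply HasCompactSupport.intro (K := Set.pi Set.univ fun _ : Fin 2 => Set.Icc (-(M:ℝ)) M)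
      (isCompact_univ_pi fun _ => isCompact_Icc)
    intro v hv
    apply hM
    by_contra h
    push Not at h
    apply hv
    intro i _
    exact abs_le.1 (h i)
  have hcoef : ∀ n, UnitAddTorus.mFourierCoeff F n = (c n : ℂ) := by
    intro n
    let e : (Fin 2 → ℝ) → ℂ := fun x => UnitAddTorus.mFourier (-n) (fun i => (x i : UnitAddCircle))
    have he : Continuous e := (map_continuous _).comp hq.continuous
    let g : (Fin 2 → ℝ) → ℂ := fun x => e x * (f x : ℂ)
    have hgc : Continuous g := by
      have : Continuous fun x => (f x : ℂ) := Complex.continuous_ofReal.comp hf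
      exact he.mul this
    have hgs : HasCompactSupport g := by
      apply hsupp.mono
      intro x hx h
      apply hx
      simp only [g, h]; simp
    have hgi : Integrable g := hgc.integrable_of_hasCompactSupport hgs
    have h1 := unfold_int hgi
    have h2 : UnitAddTorus.mFourierCoeff F n = ∫ x in ubox 0, e x * (perz f x : ℂ) := by
      rw [UnitAddTorus.mFourierCoeff_eq_integral _ _ (fun _ => (0:ℝ))]
      have : {x : Fin 2 → ℝ | ∀ i, x i ∈ Set.Ioc (0:ℝ) (0 + 1)} = ubox 0 := by
        ext x; simp [ubox]
      rw [this]
      apply setIntegral_congr_fun (ubox_meas 0)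
      intro x _
      simp only [smul_eq_mul]
      change e x * F0 _ = _
      rw [hF0]
    have hbd : ∀ x ∈ ubox 0, ∀ i, |x i| ≤ ((1:ℕ):ℝ) := by
      intro x hx i
      have := hx i
      simp at this
      rw [abs_le]; push_cast; constructor <;> linarith [this.1, this.2]
    have h3 : ∫ x in ubox 0, e x * (perz f x : ℂ) = ∑ m ∈ zbox (1 + M), ∫ x in ubox 0, g (x + zc m) := by
      rw [← integral_finsetSum]
      · apply setIntegral_congr_fun (ubox_meas 0)
        intro x hx
        simp only
        rw [perz_eq hM (hbd x hx)]
        push_cast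
        rw [Finset.mul_sum]
        apply Finset.sum_congr rfl
        intro m _
        simp only [g, e, mF_per]
      · intro m _
        exact (hgi.comp_add_right (zc m)).integrableOn
    have h4 : ∑ m ∈ zbox (1 + M), ∫ x in ubox 0, g (x + zc m) = ∫ x, g x := by
      rw [← h1.tsum_eq]
      symm
      apply tsum_eq_sum
      intro m hm
      rw [← integral_zero (Fin 2 → ℝ) ℂ (μ := volume.restrict (ubox 0))]
      apply setIntegral_congr_fun (ubox_meas 0)
      intro x hx
      simp only [g]
      rw [perz_fin hM (hbd x hx) hm]; simp
    rw [h2, h3, h4]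
    have hco : Continuous fun v : Fin 2 → ℝ => cos (2 * π * ∑ i, (n i : ℝ) * v i) := by fun_prop
    have hsi : Continuous fun v : Fin 2 → ℝ => sin (2 * π * ∑ i, (n i : ℝ) * v i) := by fun_prop
    have hgx : ∀ x, g x = ((f x * cos (2 * π * ∑ i, (n i : ℝ) * x i) : ℝ) : ℂ)
        - ((f x * sin (2 * π * ∑ i, (n i : ℝ) * x i) : ℝ) : ℂ) * Complex.I := by
      intro x
      simp only [g, e]
      rw [mF_eq]
      have : (2 * π * ∑ i, ((-n) i : ℝ) * x i : ℝ) = -(2 * π * ∑ i, (n i : ℝ) * x i) := by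
        simp [Fin.sum_univ_two]; ring
      have e2 : (2 * π * ∑ i, (((-n) i : ℤ) : ℝ) * x i : ℝ) = -(2 * π * ∑ i, (n i : ℝ) * x i) := by
        simp [Fin.sum_univ_two]; ring
      rw [e2, Complex.exp_mul_I, ← Complex.ofReal_cos, ← Complex.ofReal_sin, cos_neg, sin_neg]
      push_cast
      ring
    have i1 : Integrable fun x => f x * cos (2 * π * ∑ i, (n i : ℝ) * x i) :=
      (hf.mul hco).integrable_of_hasCompactSupport hsupp.mul_right
    have i2 : Integrable fun x => f x * sin (2 * π * ∑ i, (n i : ℝ) * x i) :=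
      (hf.mul hsi).integrable_of_hasCompactSupport hsupp.mul_right
    have odd : ∫ x, f x * sin (2 * π * ∑ i, (n i : ℝ) * x i) = 0 := by
      have := integral_neg_eq_self (fun x => f x * sin (2 * π * ∑ i, (n i : ℝ) * x i)) volume
      have e3 : ∀ x : Fin 2 → ℝ, f (-x) * sin (2 * π * ∑ i, (n i : ℝ) * (-x) i)
          = -(f x * sin (2 * π * ∑ i, (n i : ℝ) * x i)) := by
        intro x
        have : (2 * π * ∑ i, (n i : ℝ) * (-x) i : ℝ) = -(2 * π * ∑ i, (n i : ℝ) * x i) := by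
          simp [Fin.sum_univ_two]; ring
        rw [this, sin_neg, heven]; ring
      simp only [e3, integral_neg] at this
      linarith
    simp only [hgx]
    have r1 := integral_ofReal (𝕜 := ℂ) (μ := volume)
      (f := fun x : Fin 2 → ℝ => f x * cos (2 * π * ∑ i, (n i : ℝ) * x i))
    have r2 := integral_ofReal (𝕜 := ℂ) (μ := volume)
      (f := fun x : Fin 2 → ℝ => f x * sin (2 * π * ∑ i, (n i : ℝ) * x i))
    simp only [Complex.coe_algebraMap, RCLike.ofReal_eq_complex_ofReal] at r1 r2
    rw [integral_sub i1.ofReal (i2.ofReal.mul_const _), integral_mul_const]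
    refine (congrArg₂ (fun a b : ℂ => a - b * Complex.I) r1 r2).trans ?_
    rw [odd, ← hc]
    simp
  have hsum : Summable (UnitAddTorus.mFourierCoeff F) := by
    have : UnitAddTorus.mFourierCoeff F = fun n => (c n : ℂ) := funext hcoef
    rw [this]
    exact Complex.ofRealCLM.summable hs
  have key := UnitAddTorus.hasSum_mFourier_series_apply_of_summable hsum
    (fun i => ((0 : Fin 2 → ℝ) i : UnitAddCircle))
  have e0 : F (fun i => ((0 : Fin 2 → ℝ) i : UnitAddCircle)) = (perz f 0 : ℂ) := hF0 0
  rw [e0] at key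
  have e1 : perz f 0 = ∑ n ∈ zbox M, f (zc n) := by
    have := perz_eq hM (K := 0) (v := 0) (by simp)
    simpa using this
  rw [e1] at key
  simp only [mF_eq, hcoef] at key
  simp only [Pi.zero_apply, mul_zero, Finset.sum_const_zero, Complex.ofReal_zero, zero_mul,
    Complex.exp_zero, smul_eq_mul, mul_one] at key
  exact_mod_cast key

lemma sym_split {F : ℝ → ℝ} (hF : Continuous F) :
    ∫ u in (-(1/2):ℝ)..(1/2), F u = ∫ u in (0:ℝ)..(1/2), (F u + F (-u)) := by
  rw [← intervalIntegral.integral_add_adjacent_intervals (b := 0) (hF.intervalIntegrable _ _)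
      (hF.intervalIntegrable _ _)]
  have e : ∫ u in (-(1/2):ℝ)..0, F u = ∫ u in (0:ℝ)..(1/2), F (-u) := by
    rw [intervalIntegral.integral_comp_neg]; simp
  rw [e, intervalIntegral.integral_add (hF.intervalIntegrable _ _)
    ((by fun_prop : Continuous fun u => F (-u)).intervalIntegrable _ _)]
  ring

lemma dK_L1' (N : ℕ) (hN : 2 ≤ N) :
    ∫ t in (-(1/2):ℝ)..(1/2), |dK N t| ≤ 2 * (4 + Real.log (tN N)) := by
  rw [sym_split (dK_cont N).abs]
  have : ∀ u, |dK N u| + |dK N (-u)| = 2 * |dK N u| := by intro u; rw [dK_even]; ring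
  simp only [this]
  rw [intervalIntegral.integral_const_mul]
  have := dK_L1 N hN
  linarith

lemma dK_sq (N : ℕ) : |∫ u in (0:ℝ)..(1/2), dK N u * u ^ 2| ≤ 1 / tN N := by
  have hT := tN_pos N
  have hd : ∀ u, HasDerivAt (fun u => -(jK N u * u ^ 2)) (dK N u * u ^ 2 - 2 * u * jK N u) u := by
    intro u
    refine (((jK_deriv N u).fun_mul (hasDerivAt_pow 2 u)).fun_neg).congr_deriv ?_
    norm_num; ring
  have hc := dK_cont N
  have i1 : IntervalIntegrable (fun u => dK N u * u ^ 2) volume 0 (1/2) :=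
    (by fun_prop : Continuous fun u => dK N u * u ^ 2).intervalIntegrable _ _
  have i2 : IntervalIntegrable (fun u => 2 * u * jK N u) volume 0 (1/2) :=
    (by fun_prop : Continuous fun u => 2 * u * jK N u).intervalIntegrable _ _
  have key := intervalIntegral.integral_eq_sub_of_hasDerivAt (a := 0) (b := 1/2)
    (fun s _ => hd s) (i1.sub i2)
  rw [intervalIntegral.integral_sub i1 i2, jK_half] at key
  have e : ∫ u in (0:ℝ)..(1/2), dK N u * u ^ 2 = ∫ u in (0:ℝ)..(1/2), 2 * u * jK N u := by
    simp at key ⊢; linarith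
  rw [e]
  have := intervalIntegral.norm_integral_le_of_norm_le_const (a := 0) (b := 1/2) (C := 2 / tN N)
    (f := fun u => 2 * u * jK N u) (fun u hu => by
      rw [Set.uIoc_of_le (by norm_num)] at hu
      have hb := jK_bound N hu.1 hu.2
      have hu0 := hu.1
      rw [Real.norm_eq_abs, abs_mul, abs_of_pos (by linarith : 0 < 2 * u)]
      calc 2 * u * |jK N u| ≤ 2 * u * (1 / (tN N * u)) := by gcongr
        _ = 2 / tN N := by field_simp)
  rw [Real.norm_eq_abs] at this
  refine this.trans (le_of_eq ?_)
  rw [abs_of_pos (by norm_num)]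
  field_simp; norm_num

lemma AF_cont : Continuous AF := by
  have : AF = fun R => ∫ τ in (-1:ℝ)..1, sqrt (1 - τ ^ 2) *
    ∫ s in (-1:ℝ)..1, (1 - s ^ 2) * sqrt ((1 + τ ^ 2) + (1 - τ ^ 2) * s ^ 2) * cos (2 * π * R * s) :=
    funext AF_iter
  rw [this]
  apply intervalIntegral.continuous_parametric_intervalIntegral_of_continuous'
  have : Continuous fun p : ℝ × ℝ => ∫ s in (-1:ℝ)..1, (1 - s ^ 2) *
      sqrt ((1 + p.2 ^ 2) + (1 - p.2 ^ 2) * s ^ 2) * cos (2 * π * p.1 * s) := by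
    apply intervalIntegral.continuous_parametric_intervalIntegral_of_continuous'
    unfold Function.uncurry; fun_prop
  unfold Function.uncurry
  fun_prop

lemma coef_zero (N : ℕ) (y : ℝ) :
    |(∫ u in (-(1/2):ℝ)..(1/2), dK N u * ((y + u) ^ 2 * AF ((y + u) * 0))) - y ^ 2 * AF 0|
      ≤ 2 * |AF 0| / tN N := by
  have hc := dK_cont N
  simp only [mul_zero]
  rw [sym_split (by fun_prop)]
  have e : ∀ u, dK N u * ((y + u) ^ 2 * AF 0) + dK N (-u) * ((y + -u) ^ 2 * AF 0)
      = (2 * y ^ 2 * AF 0) * dK N u + (2 * AF 0) * (dK N u * u ^ 2) := by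
    intro u; rw [dK_even]; ring
  simp only [e]
  rw [intervalIntegral.integral_add ((by fun_prop : Continuous _).intervalIntegrable _ _)
    ((by fun_prop : Continuous _).intervalIntegrable _ _), intervalIntegral.integral_const_mul,
    intervalIntegral.integral_const_mul, dK_integral]
  have := dK_sq N
  have e2 : 2 * y ^ 2 * AF 0 * (1 / 2) + 2 * AF 0 * (∫ u in (0:ℝ)..(1/2), dK N u * u ^ 2) - y ^ 2 * AF 0
     = 2 * AF 0 * (∫ u in (0:ℝ)..(1/2), dK N u * u ^ 2) := by ring
  rw [e2, abs_mul, abs_mul]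
  calc _ ≤ |2| * |AF 0| * (1 / tN N) := by gcongr
    _ = _ := by norm_num; ring

lemma coef_asymp (N : ℕ) (hN : 2 ≤ N) {y r : ℝ} (hy : 1 / 2 < y) (hr : 0 < r) :
    |(∫ u in (-(1/2):ℝ)..(1/2), dK N u * ((y + u) ^ 2 * AF ((y + u) * r)))
      - (-(sqrt 2 / (2 * π))) / r ^ 2 * (cos (2 * π * r * y) * wK N r)|
      ≤ 2 * (4 + log (tN N)) / ((y - 1 / 2) * r ^ 3) := by
  have hc := dK_cont N
  have hA := AF_cont
  rw [← dK_cos_shift, ← intervalIntegral.integral_const_mul,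
    ← intervalIntegral.integral_sub ((by fun_prop : Continuous _).intervalIntegrable _ _)
    ((by fun_prop : Continuous _).intervalIntegrable _ _)]
  have hle : (-(1/2):ℝ) ≤ 1/2 := by norm_num
  calc _ ≤ ∫ u in (-(1/2):ℝ)..(1/2), |dK N u * ((y + u) ^ 2 * AF ((y + u) * r)) -
        (-(sqrt 2 / (2 * π))) / r ^ 2 * (dK N u * cos (2 * π * r * (y + u)))| :=
        intervalIntegral.abs_integral_le_integral_abs hle
    _ ≤ ∫ u in (-(1/2):ℝ)..(1/2), |dK N u| * (1 / ((y - 1 / 2) * r ^ 3)) := by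
        apply intervalIntegral.integral_mono_on hle
          ((by fun_prop : Continuous _).intervalIntegrable _ _)
          ((by fun_prop : Continuous _).intervalIntegrable _ _)
        intro u hu
        have hY : y - 1 / 2 ≤ y + u := by linarith [hu.1]
        have hY0 : 0 < y + u := by linarith
        have h1 := AF_asymp (R := (y + u) * r) (by positivity)
        have e : dK N u * ((y + u) ^ 2 * AF ((y + u) * r)) -
          (-(sqrt 2 / (2 * π))) / r ^ 2 * (dK N u * cos (2 * π * r * (y + u)))
          = dK N u * ((y + u) ^ 2 * (AF ((y + u) * r) -
            (-(sqrt 2 / (2 * π))) * cos (2 * π * ((y + u) * r)) / ((y + u) * r) ^ 2)) := by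
          have : 2 * π * r * (y + u) = 2 * π * ((y + u) * r) := by ring
          rw [this]
          field_simp
        rw [e, abs_mul, abs_mul, abs_of_pos (by positivity : 0 < (y + u) ^ 2)]
        gcongr
        calc _ ≤ (y + u) ^ 2 * (1 / ((y + u) * r) ^ 3) := by gcongr
          _ = 1 / ((y + u) * r ^ 3) := by field_simp
          _ ≤ _ := by
            have : 0 < y - 1 / 2 := by linarith
            gcongr
    _ = (∫ u in (-(1/2):ℝ)..(1/2), |dK N u|) * (1 / ((y - 1 / 2) * r ^ 3)) := by
        rw [intervalIntegral.integral_mul_const]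
    _ ≤ 2 * (4 + log (tN N)) * (1 / ((y - 1 / 2) * r ^ 3)) := by
        have : 0 < y - 1 / 2 := by linarith
        have := dK_L1' N hN
        gcongr
    _ = _ := by ring

/-- The mollified profile. -/
def PhiK (N : ℕ) (y ν : ℝ) : ℝ := ∫ u in (-(1/2):ℝ)..(1/2), dK N u * gP ν (y + u)

/-- clamp -/
def clp (y u : ℝ) : ℝ := max (y - 1/2) (min (y + u) (y + 1/2))

lemma clp_eq {y u : ℝ} (hu : u ∈ Set.Icc (-(1/2):ℝ) (1/2)) : clp y u = y + u := by
  unfold clp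
  rw [min_eq_left (by linarith [hu.2]), max_eq_right (by linarith [hu.1])]

lemma clp_cont (y : ℝ) : Continuous (clp y) := by unfold clp; fun_prop

lemma clp_pos {y : ℝ} (hy : 1 / 2 < y) (u : ℝ) : 0 < clp y u :=
  lt_of_lt_of_le (by linarith : 0 < y - 1 / 2) (le_max_left _ _)

lemma clp_le {y : ℝ} (u : ℝ) : clp y u ≤ y + 1 / 2 :=
  max_le (by linarith) (min_le_right _ _)

lemma gclp_cont {y : ℝ} (hy : 1 / 2 < y) : Continuous fun p : ℝ × ℝ => gP p.1 (clp y p.2) := by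
  unfold gP
  have := clp_cont y
  refine Real.continuous_sqrt.comp (continuous_const.sub ?_)
  apply Continuous.div (by fun_prop) (by fun_prop)
  intro p
  exact pow_ne_zero _ (clp_pos hy _).ne'

lemma PhiK_clp (N : ℕ) (y ν : ℝ) : PhiK N y ν = ∫ u in (-(1/2):ℝ)..(1/2), dK N u * gP ν (clp y u) := by
  unfold PhiK
  apply intervalIntegral.integral_congr
  intro u hu
  rw [Set.uIcc_of_le (by norm_num)] at hu
  simp only [clp_eq hu]

lemma PhiK_cont (N : ℕ) {y : ℝ} (hy : 1 / 2 < y) : Continuous (PhiK N y) := by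
  have : PhiK N y = fun ν => ∫ u in (-(1/2):ℝ)..(1/2), dK N u * gP ν (clp y u) := funext (PhiK_clp N y)
  rw [this]
  apply intervalIntegral.continuous_parametric_intervalIntegral_of_continuous'
  have := gclp_cont hy
  have h2 := dK_cont N
  unfold Function.uncurry
  fun_prop

lemma PhiK_zero (N : ℕ) {y ν : ℝ} (hy : 1 / 2 < y) (hν : y + 1/2 ≤ ν) : PhiK N y ν = 0 := by
  have := primal_gP_zero N hy hν
  rw [gP_zero (by linarith) (by linarith), sub_zero] at this
  exact this

lemma PhiK_coefC (N : ℕ) {y : ℝ} (hy : 1 / 2 < y) (k : ℂ) :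
    ∫ z : ℂ, PhiK N y ‖z‖ * cos (2 * π * (k.re * z.re + k.im * z.im)) =
      ∫ u in (-(1/2):ℝ)..(1/2), dK N u * ((y + u) ^ 2 * AF ((y + u) * ‖k‖)) := by
  have hle : (-(1/2):ℝ) ≤ 1/2 := by norm_num
  let G : ℂ → ℝ → ℝ := fun z u => dK N u * gP ‖z‖ (clp y u) * cos (2 * π * (k.re * z.re + k.im * z.im))
  have hGc : Continuous (Function.uncurry G) := by
    have h1 : Continuous fun p : ℂ × ℝ => gP ‖p.1‖ (clp y p.2) :=
      (gclp_cont hy).comp (by fun_prop : Continuous fun p : ℂ × ℝ => (‖p.1‖, p.2))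
    have h2 := dK_cont N
    simp only [G, Function.uncurry_def]
    fun_prop
  have hGi : Integrable (Function.uncurry G)
      ((volume : Measure ℂ).prod (volume.restrict (Set.Ioc (-(1/2):ℝ) (1/2)))) := by
    have : (volume : Measure ℂ).prod (volume.restrict (Set.Ioc (-(1/2):ℝ) (1/2)))
      = ((volume : Measure ℂ).prod volume).restrict (Set.univ ×ˢ (Set.Ioc (-(1/2):ℝ) (1/2))) := by
      rw [← Measure.prod_restrict, Measure.restrict_univ]
    rw [this]
    refine IntegrableOn.of_forall_sdiff_eq_zero (s := Metric.closedBall (0:ℂ) (y + 1/2) ×ˢ Set.Icc (-(1/2):ℝ) (1/2))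
      (hGc.continuousOn.integrableOn_compact ((isCompact_closedBall _ _).prod isCompact_Icc))
      (MeasurableSet.univ.prod measurableSet_Ioc) ?_
    rintro ⟨z, u⟩ ⟨⟨_, hu⟩, h2⟩
    have hz : y + 1/2 ≤ ‖z‖ := by
      by_contra h
      apply h2
      refine ⟨?_, Set.Ioc_subset_Icc_self hu⟩
      simp only [Metric.mem_closedBall, dist_zero_right]
      linarith
    simp only [Function.uncurry, G]
    rw [gP_zero (clp_pos hy u) ((clp_le u).trans hz)]
    simp
  have h1 : ∀ z : ℂ, PhiK N y ‖z‖ * cos (2 * π * (k.re * z.re + k.im * z.im)) =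
      ∫ u in Set.Ioc (-(1/2):ℝ) (1/2), G z u := by
    intro z
    rw [PhiK_clp, ← intervalIntegral.integral_mul_const, intervalIntegral.integral_of_le hle]
  simp only [h1]
  rw [integral_integral_swap hGi, intervalIntegral.integral_of_le hle]
  apply setIntegral_congr_fun measurableSet_Ioc
  intro u hu
  simp only [G]
  rw [clp_eq (Set.Ioc_subset_Icc_self hu)]
  simp only [mul_assoc (dK N u)]
  rw [integral_const_mul, AF_rot (by linarith [hu.1])]

lemma PhiK_coef (N : ℕ) {y : ℝ} (hy : 1 / 2 < y) (n : Fin 2 → ℤ) :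
    ∫ v : Fin 2 → ℝ, PhiK N y (sqrt (v 0 ^ 2 + v 1 ^ 2)) * cos (2 * π * ∑ i, (n i : ℝ) * v i) =
      ∫ u in (-(1/2):ℝ)..(1/2), dK N u * ((y + u) ^ 2 *
        AF ((y + u) * sqrt ((n 0 : ℝ) ^ 2 + (n 1 : ℝ) ^ 2))) := by
  have hn : ∀ a b : ℝ, ‖(⟨a, b⟩ : ℂ)‖ = sqrt (a ^ 2 + b ^ 2) := by
    intro a b
    rw [Complex.norm_def, Complex.normSq_apply]
    congr 1; ring
  have h := PhiK_coefC N hy ⟨n 0, n 1⟩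
  rw [hn] at h
  rw [← h, ← Complex.volume_preserving_equiv_pi.integral_comp'
    (fun v : Fin 2 → ℝ => PhiK N y (sqrt (v 0 ^ 2 + v 1 ^ 2)) * cos (2 * π * ∑ i, (n i : ℝ) * v i))]
  congr 1
  ext z
  have : ‖z‖ = sqrt (z.re ^ 2 + z.im ^ 2) := hn z.re z.im
  simp [Complex.measurableEquivPi_apply, this, Fin.sum_univ_two]

/-- the integer norm square of a lattice point -/
def nsq (n : Fin 2 → ℤ) : ℕ := (n 0 ^ 2 + n 1 ^ 2).toNat

lemma nsq_cast (n : Fin 2 → ℤ) : ((nsq n : ℕ) : ℝ) = (n 0 : ℝ) ^ 2 + (n 1 : ℝ) ^ 2 := by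
  have : ((nsq n : ℕ) : ℤ) = n 0 ^ 2 + n 1 ^ 2 := by
    unfold nsq
    rw [Int.toNat_of_nonneg (by positivity)]
  have h2 : (((nsq n : ℕ) : ℤ) : ℝ) = ((n 0 ^ 2 + n 1 ^ 2 : ℤ) : ℝ) := by rw [this]
  push_cast at h2
  exact h2

lemma nsq_iff (n : Fin 2 → ℤ) (m : ℕ) : nsq n = m ↔ n 0 ^ 2 + n 1 ^ 2 = (m : ℤ) := by
  have : ((nsq n : ℕ) : ℤ) = n 0 ^ 2 + n 1 ^ 2 := by
    unfold nsq
    rw [Int.toNat_of_nonneg (by positivity)]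
  omega

/-- fibers of `nsq` -/
def nsqEquiv (m : ℕ) : {n : Fin 2 → ℤ // nsq n = m} ≃ {p : ℤ × ℤ | p.1 ^ 2 + p.2 ^ 2 = (m : ℤ)} :=
  (finTwoArrowEquiv ℤ).subtypeEquiv (fun n => by
    rw [nsq_iff]
    simp [finTwoArrowEquiv])

lemma nsq_card (m : ℕ) : Nat.card {n : Fin 2 → ℤ // nsq n = m} = r2 m := by
  rw [Nat.card_congr (nsqEquiv m)]
  rfl

lemma nsq_finite (m : ℕ) : Finite {n : Fin 2 → ℤ // nsq n = m} := by
  have := (sq_sum_finite m).to_subtype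
  exact Finite.of_equiv _ (nsqEquiv m).symm

lemma fib_sum {g : ℕ → ℝ} {S : ℝ} (h : HasSum (fun n : Fin 2 → ℤ => g (nsq n)) S) :
    HasSum (fun m : ℕ => (r2 m : ℝ) * g m) S := by
  have h1 := h.tsum_fiberwise nsq
  suffices e : (fun m : ℕ => (r2 m : ℝ) * g m) = fun m => ∑' b : (nsq ⁻¹' {m} : Set (Fin 2 → ℤ)), g (nsq b) by
    rw [e]; exact h1
  funext m
  have : ∀ b : (nsq ⁻¹' {m} : Set (Fin 2 → ℤ)), g (nsq b) = g m := fun b => by rw [b.2]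
  simp only [this]
  rw [tsum_const, nsmul_eq_mul, ← nsq_card]
  rfl

lemma fib_summable {g : ℕ → ℝ} (h : Summable (fun m : ℕ => (r2 m : ℝ) * |g m|)) :
    Summable (fun n : Fin 2 → ℤ => g (nsq n)) := by
  rw [← summable_abs_iff, ← (Equiv.sigmaFiberEquiv nsq).summable_iff]
  refine (summable_sigma_of_nonneg (fun x => ?_)).2 ⟨?_, ?_⟩
  · exact abs_nonneg _
  · intro m
    have := nsq_finite m
    exact Summable.of_finite
  · refine h.congr ?_
    intro m
    have : ∀ b : {n : Fin 2 → ℤ // nsq n = m},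
        ((fun n : Fin 2 → ℤ => |g (nsq n)|) ∘ (Equiv.sigmaFiberEquiv nsq)) ⟨m, b⟩ = |g m| := by
      intro b
      simp [Equiv.sigmaFiberEquiv, b.2]
    simp only [this]
    rw [tsum_const, nsmul_eq_mul, ← nsq_card]

/-- the dual coefficient -/
def cM (N : ℕ) (y : ℝ) (m : ℕ) : ℝ :=
  ∫ u in (-(1/2):ℝ)..(1/2), dK N u * ((y + u) ^ 2 * AF ((y + u) * sqrt m))

lemma poisson_r2 (N : ℕ) {y : ℝ} (hy : 1 / 2 < y) (hs : Summable fun m : ℕ => (r2 m : ℝ) * |cM N y m|)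
    {K : ℕ} (hK : (y + 1/2) ^ 2 ≤ K) :
    HasSum (fun m : ℕ => (r2 m : ℝ) * cM N y m)
      (∑ m ∈ Finset.range K, (r2 m : ℝ) * PhiK N y (sqrt m)) := by
  obtain ⟨M, hM⟩ := exists_nat_ge (y + 1/2)
  have hz : ∀ v : Fin 2 → ℝ, (∃ i, (M:ℝ) < |v i|) → PhiK N y (sqrt (v 0 ^ 2 + v 1 ^ 2)) = 0 := by
    rintro v ⟨i, hi⟩
    apply PhiK_zero N hy
    refine hM.trans (hi.le.trans ?_)
    apply Real.abs_le_sqrt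
    fin_cases i
    · simp; positivity
    · simp; positivity
  have h := poisson2 (f := fun v : Fin 2 → ℝ => PhiK N y (sqrt (v 0 ^ 2 + v 1 ^ 2))) (M := M)
    ((PhiK_cont N hy).comp (by fun_prop)) hz (by intro v; simp)
    (c := fun n => cM N y (nsq n)) (by
      intro n
      rw [PhiK_coef N hy]
      unfold cM
      rw [nsq_cast]) (fib_summable hs)
  have h2 := fib_sum h
  have h3 : HasSum (fun n : Fin 2 → ℤ => PhiK N y (sqrt (nsq n)))
      (∑ n ∈ zbox M, PhiK N y (sqrt (zc n 0 ^ 2 + zc n 1 ^ 2))) := by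
    have e : ∀ n : Fin 2 → ℤ, PhiK N y (sqrt (nsq n)) = PhiK N y (sqrt (zc n 0 ^ 2 + zc n 1 ^ 2)) := by
      intro n
      rw [nsq_cast]; rfl
    simp only [e]
    apply hasSum_sum_of_ne_finset_zero
    intro n hn
    rw [mem_zbox] at hn
    push Not at hn
    obtain ⟨i, hi⟩ := hn
    refine hz _ ⟨i, ?_⟩
    unfold zc
    exact_mod_cast hi
  have h4 := fib_sum (g := fun m => PhiK N y (sqrt m)) h3
  have h5 : HasSum (fun m : ℕ => (r2 m : ℝ) * PhiK N y (sqrt m))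
      (∑ m ∈ Finset.range K, (r2 m : ℝ) * PhiK N y (sqrt m)) := by
    apply hasSum_sum_of_ne_finset_zero
    intro m hm
    rw [Finset.mem_range, not_lt] at hm
    rw [PhiK_zero N hy, mul_zero]
    apply Real.le_sqrt_of_sq_le
    exact hK.trans (by exact_mod_cast hm)
  rw [h5.unique h4]
  exact h2

/-- the summation weight -/
def wt (δ a : ℝ) (m : ℕ) : ℝ := (1 + |(m:ℝ) - a|) ^ (-(1 + δ))

lemma wt_nonneg (δ a : ℝ) (m : ℕ) : 0 ≤ wt δ a m := by unfold wt; positivity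

lemma wt_sum (δ : ℝ) (hδ : 0 < δ) : ∃ Z > 0, ∀ a : ℝ, ∀ s : Finset ℕ, ∑ m ∈ s, wt δ a m ≤ Z := by
  let h : ℤ → ℝ := fun j => |(j:ℝ)| ^ (-(1 + δ)) + if j = 0 then 1 else 0
  have hs : Summable h := by
    apply Summable.add
    · exact Real.summable_abs_int_rpow (by linarith)
    · exact (hasSum_ite_eq (0:ℤ) (1:ℝ)).summable
  have h0 : ∀ j, 0 ≤ h j := by
    intro j
    simp only [h]
    split_ifs <;> positivity
  refine ⟨∑' j, h j + 1, by have : 0 ≤ ∑' j, h j := tsum_nonneg h0; linarith, ?_⟩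
  intro a s
  have h1 : ∀ m : ℕ, wt δ a m ≤ h ((m:ℤ) - ⌊a⌋) := by
    intro m
    unfold wt
    simp only [h]
    split_ifs with hj
    · have : (1 + |(m:ℝ) - a|) ^ (-(1 + δ)) ≤ 1 :=
        Real.rpow_le_one_of_one_le_of_nonpos (by linarith [abs_nonneg ((m:ℝ) - a)]) (by linarith)
      have : 0 ≤ |(((m:ℤ) - ⌊a⌋ : ℤ) : ℝ)| ^ (-(1 + δ)) := by positivity
      linarith
    · rw [add_zero]
      apply Real.rpow_le_rpow_of_nonpos
      · apply abs_pos.2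
        exact_mod_cast hj
      · push_cast
        have e : (m:ℝ) - (⌊a⌋:ℝ) = (m - a) + (a - ⌊a⌋) := by ring
        rw [e]
        refine (abs_add_le _ _).trans ?_
        have : |a - ⌊a⌋| ≤ 1 := by
          rw [abs_of_nonneg (sub_nonneg.2 (Int.floor_le a))]
          linarith [Int.lt_floor_add_one a]
        linarith
      · linarith
  have hinj : Function.Injective (fun m : ℕ => (m:ℤ) - ⌊a⌋) := by
    intro a b hab
    simpa using hab
  calc ∑ m ∈ s, wt δ a m ≤ ∑ m ∈ s, h ((m:ℤ) - ⌊a⌋) := Finset.sum_le_sum fun m _ => h1 m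
    _ = ∑ j ∈ s.map ⟨_, hinj⟩, h j := by rw [Finset.sum_map]; rfl
    _ ≤ ∑' j, h j := hs.sum_le_tsum _ (fun j _ => h0 j)
    _ ≤ _ := by linarith

lemma recip_le {δ x W : ℝ} (hδ : 0 < δ) (hx : 0 < x) (hW : x ≤ W) : 1 / x ≤ W ^ δ * x ^ (-(1 + δ)) := by
  have h1 : x ^ δ ≤ W ^ δ := Real.rpow_le_rpow hx.le hW hδ.le
  have h2 : x ^ (-(1 + δ)) * x ^ δ = 1 / x := by
    rw [← Real.rpow_add hx, one_div, ← Real.rpow_neg_one]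
    congr 1; ring
  rw [← h2, mul_comm]
  gcongr

lemma half_pow {δ : ℝ} {m : ℕ} (h0 : 0 ≤ δ) (hδ : δ ≤ 2) (hm : 1 ≤ m) : (m:ℝ) ^ (-δ) ≤ 4 * (1 + (m:ℝ)) ^ (-δ) := by
  have hm' : (1:ℝ) ≤ m := by exact_mod_cast hm
  have h1 : (m:ℝ) ^ (-δ) ≤ ((1 + (m:ℝ)) / 2) ^ (-δ) :=
    Real.rpow_le_rpow_of_nonpos (by positivity) (by linarith) (by linarith)
  rw [Real.div_rpow (by positivity) (by norm_num)] at h1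
  refine h1.trans ?_
  rw [Real.rpow_neg (by norm_num : (0:ℝ) ≤ 2), div_inv_eq_mul, mul_comm]
  gcongr
  calc (2:ℝ) ^ δ ≤ 2 ^ (2:ℝ) := Real.rpow_le_rpow_of_exponent_le (by norm_num) hδ
    _ = 4 := by norm_num

lemma weight2 {δ : ℝ} (h0 : 0 < δ) (hδ : δ ≤ 1/4) {m : ℕ} (hm : 1 ≤ m) :
    (1 + (m:ℝ)) ^ δ * (1 / sqrt m ^ 3) ≤ 4 * wt δ 0 m := by
  have hm' : (1:ℝ) ≤ m := by exact_mod_cast hm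
  have e : 1 / sqrt m ^ 3 = (m:ℝ) ^ (-(3/2:ℝ)) := by
    rw [Real.sqrt_eq_rpow, ← Real.rpow_natCast, ← Real.rpow_mul (by positivity), one_div,
      ← Real.rpow_neg (by positivity)]
    norm_num
  rw [e]
  have h1 := half_pow (δ := 3/2) (by norm_num) (by norm_num) hm
  unfold wt
  rw [sub_zero, abs_of_nonneg (by positivity : (0:ℝ) ≤ m)]
  calc (1 + (m:ℝ)) ^ δ * (m:ℝ) ^ (-(3/2:ℝ)) ≤ (1 + (m:ℝ)) ^ δ * (4 * (1 + (m:ℝ)) ^ (-(3/2:ℝ))) := by gcongr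
    _ = 4 * (1 + (m:ℝ)) ^ (δ + -(3/2:ℝ)) := by rw [Real.rpow_add (by positivity)]; ring
    _ ≤ _ := by
      gcongr
      · linarith
      · linarith

lemma weight1 {δ T : ℝ} (h0 : 0 < δ) (hδ : δ ≤ 1/4) (hT : 12 ≤ T) {m : ℕ} (hm : 1 ≤ m) :
    (1 + (m:ℝ)) ^ δ * (1 / (m * (1 + |sqrt m - T|))) ≤
      12 * (((17 * T ^ 2) ^ δ) ^ 2 / T) * (wt δ 0 m + wt δ (T ^ 2) m) := by
  have hm' : (1:ℝ) ≤ m := by exact_mod_cast hm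
  set Q := (17 * T ^ 2) ^ δ with hQ
  have hQ0 : 0 < Q := by positivity
  have hT2 : 144 ≤ T ^ 2 := by nlinarith
  have hQ1 : 1 ≤ Q := Real.one_le_rpow (by linarith) h0.le
  have w0 := wt_nonneg δ 0 m
  have w1 := wt_nonneg δ (T^2) m
  have hsq : sqrt m ^ 2 = (m:ℝ) := Real.sq_sqrt (by positivity)
  have hsm : 1 ≤ sqrt (m:ℝ) := by rw [Real.one_le_sqrt]; exact hm'
  rcases lt_or_ge (m:ℝ) (T ^ 2 / 4) with hA | hA
  · have hs : sqrt m < T / 2 := by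
      rw [Real.sqrt_lt' (by positivity)]; linarith
    have h1 : T / 2 ≤ 1 + |sqrt m - T| := by
      rw [abs_of_nonpos (by linarith)]; linarith
    have h2 : 1 / ((m:ℝ) * (1 + |sqrt m - T|)) ≤ 2 / T * (1 / m) := by
      rw [div_mul_div_comm, div_le_div_iff₀ (by positivity) (by positivity)]
      nlinarith
    have h3 : (1 + (m:ℝ)) ^ δ ≤ Q := Real.rpow_le_rpow (by positivity) (by linarith) h0.le
    have h4 : 1 / (m:ℝ) ≤ Q * (m:ℝ) ^ (-(1 + δ)) := recip_le h0 (by positivity) (by linarith)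
    have h5 := half_pow (δ := 1 + δ) (by linarith) (by linarith) hm
    have e : wt δ 0 m = (1 + (m:ℝ)) ^ (-(1 + δ)) := by
      unfold wt; rw [sub_zero, abs_of_nonneg (by positivity : (0:ℝ) ≤ m)]
    rw [← e] at h5
    calc (1 + (m:ℝ)) ^ δ * (1 / (m * (1 + |sqrt m - T|))) ≤ Q * (2 / T * (Q * (4 * wt δ 0 m))) := by
          gcongr
          refine h2.trans ?_
          gcongr
          exact h4.trans (by gcongr)
      _ = 8 * (Q ^ 2 / T) * wt δ 0 m := by ring
      _ ≤ 12 * (Q ^ 2 / T) * (wt δ 0 m + wt δ (T ^ 2) m) := by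
          gcongr
          · norm_num
          · linarith
  rcases le_or_gt (m:ℝ) (4 * T ^ 2) with hB | hB
  · have hs : sqrt m ≤ 2 * T := by
      rw [Real.sqrt_le_left (by positivity)]; linarith
    have h1 : 1 + |(m:ℝ) - T ^ 2| ≤ 3 * T * (1 + |sqrt m - T|) := by
      have : (m:ℝ) - T ^ 2 = (sqrt m - T) * (sqrt m + T) := by nlinarith [hsq]
      rw [this, abs_mul, abs_of_nonneg (by positivity : 0 ≤ sqrt m + T)]
      nlinarith [abs_nonneg (sqrt m - T)]
    have hp : 0 < 1 + |(m:ℝ) - T ^ 2| := by positivity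
    have h2 : 1 / ((m:ℝ) * (1 + |sqrt m - T|)) ≤ 12 / T * (1 / (1 + |(m:ℝ) - T ^ 2|)) := by
      rw [div_mul_div_comm, div_le_div_iff₀ (by positivity) (by positivity)]
      have : T ^ 2 / 4 * ((1 + |(m:ℝ) - T ^ 2|) / (3 * T)) ≤ m * (1 + |sqrt m - T|) := by
        gcongr
        rw [div_le_iff₀ (by positivity)]
        linarith
      have e : T ^ 2 / 4 * ((1 + |(m:ℝ) - T ^ 2|) / (3 * T)) = T * (1 + |(m:ℝ) - T ^ 2|) / 12 := by
        field_simp; norm_num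
      linarith
    have h3 : (1 + (m:ℝ)) ^ δ ≤ Q := Real.rpow_le_rpow (by positivity) (by linarith) h0.le
    have h4 : 1 / (1 + |(m:ℝ) - T ^ 2|) ≤ Q * wt δ (T ^ 2) m := by
      apply recip_le h0 hp
      have : |(m:ℝ) - T ^ 2| ≤ 4 * T ^ 2 := by rw [abs_le]; constructor <;> linarith
      linarith
    calc (1 + (m:ℝ)) ^ δ * (1 / (m * (1 + |sqrt m - T|))) ≤ Q * (12 / T * (Q * wt δ (T ^ 2) m)) := by
          gcongr
          refine h2.trans ?_
          gcongr
      _ = 12 * (Q ^ 2 / T) * wt δ (T ^ 2) m := by ring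
      _ ≤ 12 * (Q ^ 2 / T) * (wt δ 0 m + wt δ (T ^ 2) m) := by
          gcongr
          linarith
  · have hs : 2 * T ≤ sqrt m := by
      apply Real.le_sqrt_of_sq_le; linarith
    have h1 : sqrt m / 2 ≤ 1 + |sqrt m - T| := by
      rw [abs_of_nonneg (by linarith)]; linarith
    have h2 : 1 / ((m:ℝ) * (1 + |sqrt m - T|)) ≤ 2 * (1 / sqrt m ^ 3) := by
      rw [mul_one_div, div_le_div_iff₀ (by positivity) (by positivity)]
      have e : sqrt m ^ 3 = m * sqrt m := by rw [pow_succ, hsq]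
      rw [e]
      nlinarith
    have e : 1 / sqrt m ^ 3 = (m:ℝ) ^ (-(3/2:ℝ)) := by
      rw [Real.sqrt_eq_rpow, ← Real.rpow_natCast, ← Real.rpow_mul (by positivity), one_div,
        ← Real.rpow_neg (by positivity)]
      norm_num
    have h5 := half_pow (δ := 3/2) (by norm_num) (by norm_num) hm
    have e2 : wt δ 0 m = (1 + (m:ℝ)) ^ (-(1 + δ)) := by
      unfold wt; rw [sub_zero, abs_of_nonneg (by positivity : (0:ℝ) ≤ m)]
    have h6 : (1 + (m:ℝ)) ^ (-(1/2 - 2 * δ)) ≤ Q ^ 2 / T := by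
      have g1 : (1 + (m:ℝ)) ^ (-(1/2 - 2 * δ)) ≤ (T ^ 2) ^ (-(1/2 - 2 * δ)) :=
        Real.rpow_le_rpow_of_nonpos (by positivity) (by linarith) (by linarith)
      have g2 : (T ^ 2) ^ (-(1/2 - 2 * δ)) = ((T ^ 2) ^ δ) ^ 2 / T := by
        have hTp : 0 < T := by linarith
        rw [← Real.rpow_natCast ((T ^ 2) ^ δ), ← Real.rpow_mul (by positivity)]
        rw [← Real.rpow_natCast T, ← Real.rpow_mul hTp.le, ← Real.rpow_mul hTp.le]
        nth_rewrite 3 [← Real.rpow_one T]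
        rw [← Real.rpow_sub hTp]
        congr 1
        push_cast; ring
      rw [g2] at g1
      refine g1.trans ?_
      gcongr
      rw [hQ]
      gcongr
      linarith
    calc (1 + (m:ℝ)) ^ δ * (1 / (m * (1 + |sqrt m - T|)))
        ≤ (1 + (m:ℝ)) ^ δ * (2 * (4 * (1 + (m:ℝ)) ^ (-(3/2:ℝ)))) := by
          gcongr
          refine h2.trans ?_
          gcongr
          rw [e]; exact h5
      _ = 8 * ((1 + (m:ℝ)) ^ (-(1 + δ)) * (1 + (m:ℝ)) ^ (-(1/2 - 2 * δ))) := by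
          rw [← Real.rpow_add (by positivity)]
          have : (1 + (m:ℝ)) ^ δ * (1 + (m:ℝ)) ^ (-(3/2:ℝ)) = (1 + (m:ℝ)) ^ (-(1 + δ) + -(1/2 - 2 * δ)) := by
            rw [← Real.rpow_add (by positivity)]
            congr 1; ring
          rw [← this]; ring
      _ ≤ 8 * (wt δ 0 m * (Q ^ 2 / T)) := by
          rw [e2]; gcongr
      _ = 8 * (Q ^ 2 / T) * wt δ 0 m := by ring
      _ ≤ 12 * (Q ^ 2 / T) * (wt δ 0 m + wt δ (T ^ 2) m) := by
          gcongr
          · norm_num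
          · linarith

/-- the dual main term -/
def mainT (X y : ℝ) (m : ℕ) : ℝ :=
  if m = 0 then y ^ 2 * AF 0 else
    if (m:ℝ) ≤ X ^ 2 then -(sqrt 2 / (2 * π)) / m * cos (2 * π * sqrt m * y) else 0

lemma cprime_le : sqrt 2 / (2 * π) ≤ 1 := by
  rw [div_le_one (by positivity)]
  have h1 : sqrt 2 ≤ 2 := by rw [Real.sqrt_le_left (by norm_num)]; norm_num
  nlinarith [Real.pi_gt_three]

lemma term_bound {N : ℕ} {δ C0 X y : ℝ} (hN : 12 ≤ N) (h0 : 0 < δ) (hδ : δ ≤ 1/4)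
    (hC0 : ∀ m : ℕ, (r2 m : ℝ) ≤ C0 * (1 + (m:ℝ)) ^ δ) (hNX : (N:ℝ) ≤ X) (hXN : X < N + 1)
    (hy : tN N / 2 ≤ y - 1/2) {m : ℕ} (hm : 1 ≤ m) :
    (r2 m : ℝ) * |cM N y m - mainT X y m| ≤
      232 * C0 * ((4 + log (tN N)) * ((17 * tN N ^ 2) ^ δ) ^ 2 / tN N) *
        (wt δ 0 m + wt δ (tN N ^ 2) m) := by
  have hm' : (1:ℝ) ≤ m := by exact_mod_cast hm
  have hT : 12 ≤ tN N := by unfold tN; have : (12:ℝ) ≤ N := by exact_mod_cast hN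
                            linarith
  have hXT : |X - tN N| ≤ 1/2 := by
    unfold tN; rw [abs_le]; constructor <;> linarith
  have hX0 : 0 < X := by unfold tN at hT; linarith
  set T := tN N with hTd
  have hTp : 0 < T := by linarith
  have hlog : 0 ≤ log T := Real.log_nonneg (by linarith)
  have hC0' : 0 ≤ C0 := by
    have := (Nat.cast_nonneg (r2 m)).trans (hC0 m)
    by_contra h
    push Not at h
    have h2 : 0 < (1 + (m:ℝ)) ^ δ := by positivity
    nlinarith
  have hsm : 0 < sqrt (m:ℝ) := by positivity
  have hsq : sqrt m ^ 2 = (m:ℝ) := Real.sq_sqrt (by positivity)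
  have hw := wK_bound N hsm.le
  have hc := coef_asymp N (by omega) (y := y) (by linarith) hsm
  rw [← hTd] at hw hc
  rw [hsq] at hc
  have hcM : cM N y m = ∫ u in (-(1/2):ℝ)..(1/2), dK N u * ((y + u) ^ 2 * AF ((y + u) * sqrt m)) := rfl
  rw [← hcM] at hc
  have hmain : mainT X y m = -(sqrt 2 / (2 * π)) / m * (cos (2 * π * sqrt m * y) * (if (m:ℝ) ≤ X ^ 2 then 1 else 0)) := by
    unfold mainT
    rw [if_neg (by omega)]
    split_ifs <;> ring
  have hw2 : |wK N (sqrt m) - (if (m:ℝ) ≤ X ^ 2 then 1 else 0)| ≤ 18 / (1 + |sqrt m - T|) := by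
    have h1 : |(if sqrt (m:ℝ) ≤ T then (1:ℝ) else 0) - (if (m:ℝ) ≤ X ^ 2 then 1 else 0)| ≤ 2 / (1 + |sqrt m - T|) := by
      have hiff : (m:ℝ) ≤ X ^ 2 ↔ sqrt m ≤ X := by
        rw [Real.sqrt_le_left hX0.le]
      simp only [hiff]
      rw [abs_le] at hXT
      have key : ∀ P : Prop, ∀ _ : |sqrt m - T| ≤ 1, (1:ℝ) ≤ 2 / (1 + |sqrt m - T|) := by
        intro _ h
        rw [le_div_iff₀ (by positivity)]; linarith
      split_ifs with ha hb hb
      · simp; positivity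
      · simp only [sub_zero, abs_one]
        push Not at hb
        exact key True (by rw [abs_le]; constructor <;> linarith)
      · simp only [zero_sub, abs_neg, abs_one]
        push Not at ha
        exact key True (by rw [abs_le]; constructor <;> linarith)
      · simp; positivity
    have := abs_add_le (wK N (sqrt m) - (if sqrt (m:ℝ) ≤ T then (1:ℝ) else 0))
      ((if sqrt (m:ℝ) ≤ T then (1:ℝ) else 0) - (if (m:ℝ) ≤ X ^ 2 then 1 else 0))
    rw [sub_add_sub_cancel] at this
    refine this.trans ((add_le_add hw h1).trans (le_of_eq ?_))
    ring
  have h3 : |cM N y m - mainT X y m| ≤ 18 * (1 / (m * (1 + |sqrt m - T|))) +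
      4 * (4 + log T) / T * (1 / sqrt m ^ 3) := by
    have e : cM N y m - mainT X y m = (cM N y m - -(sqrt 2 / (2 * π)) / m * (cos (2 * π * sqrt m * y) * wK N (sqrt m)))
        + -(sqrt 2 / (2 * π)) / m * cos (2 * π * sqrt m * y) * (wK N (sqrt m) - (if (m:ℝ) ≤ X ^ 2 then 1 else 0)) := by
      rw [hmain]; ring
    rw [e]
    refine (abs_add_le _ _).trans ?_
    rw [add_comm (18 * _)]
    apply add_le_add
    · refine hc.trans ?_
      rw [mul_one_div, div_div]
      rw [div_le_div_iff₀ (mul_pos (by linarith) (by positivity)) (by positivity)]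
      have : 0 ≤ (4 + log T) * sqrt m ^ 3 := by positivity
      nlinarith
    · rw [abs_mul, abs_mul, abs_div, abs_neg, abs_of_pos (by positivity : 0 < sqrt 2 / (2 * π)),
        abs_of_pos (by positivity : (0:ℝ) < m)]
      calc sqrt 2 / (2 * π) / m * |cos (2 * π * sqrt m * y)| * |wK N (sqrt m) - (if (m:ℝ) ≤ X ^ 2 then 1 else 0)|
          ≤ 1 / m * 1 * (18 / (1 + |sqrt m - T|)) := by
            gcongr
            · exact cprime_le
            · exact abs_cos_le_one _
        _ = _ := by field_simp
  have hw1 := weight1 h0 hδ hT hm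
  have hw3 := weight2 h0 hδ hm
  set Q := (17 * T ^ 2) ^ δ with hQ
  have hQ1 : 1 ≤ Q := Real.one_le_rpow (by nlinarith) h0.le
  have w0 := wt_nonneg δ 0 m
  have w1 := wt_nonneg δ (T^2) m
  calc (r2 m : ℝ) * |cM N y m - mainT X y m| ≤ (C0 * (1 + (m:ℝ)) ^ δ) * (18 * (1 / (m * (1 + |sqrt m - T|))) +
      4 * (4 + log T) / T * (1 / sqrt m ^ 3)) := by
        gcongr
        exact hC0 m
    _ = C0 * (18 * ((1 + (m:ℝ)) ^ δ * (1 / (m * (1 + |sqrt m - T|)))) +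
      4 * (4 + log T) / T * ((1 + (m:ℝ)) ^ δ * (1 / sqrt m ^ 3))) := by ring
    _ ≤ C0 * (18 * (12 * (Q ^ 2 / T) * (wt δ 0 m + wt δ (T ^ 2) m)) +
      4 * (4 + log T) / T * (4 * wt δ 0 m)) := by gcongr
    _ ≤ C0 * (18 * (12 * ((4 + log T) * Q ^ 2 / T) * (wt δ 0 m + wt δ (T ^ 2) m)) +
      4 * ((4 + log T) * Q ^ 2 / T) * (4 * (wt δ 0 m + wt δ (T ^ 2) m))) := by
        have hq : 1 ≤ Q ^ 2 := one_le_pow₀ hQ1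
        have g1 : Q ^ 2 / T ≤ (4 + log T) * Q ^ 2 / T := by
          gcongr
          nlinarith
        have g2 : 4 * (4 + log T) / T ≤ 4 * ((4 + log T) * Q ^ 2 / T) := by
          rw [← mul_div_assoc]
          gcongr
          nlinarith
        gcongr
        linarith
    _ = _ := by ring

lemma r2_zero : r2 0 = 1 := by
  unfold r2
  have : {p : ℤ × ℤ | p.1 ^ 2 + p.2 ^ 2 = ((0:ℕ) : ℤ)} = {(0, 0)} := by
    ext ⟨a, b⟩
    simp only [Set.mem_ofPred_eq, Set.mem_singleton_iff, Prod.mk.injEq]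
    constructor
    · intro h
      push_cast at h
      constructor <;> nlinarith [sq_nonneg a, sq_nonneg b]
    · rintro ⟨rfl, rfl⟩; simp
  rw [this, Set.ncard_singleton]

lemma wt_zero (δ : ℝ) : wt δ 0 0 = 1 := by simp [wt]

lemma wt_summable {δ Z : ℝ} (hZ : ∀ a : ℝ, ∀ s : Finset ℕ, ∑ m ∈ s, wt δ a m ≤ Z) (a : ℝ) :
    Summable (wt δ a) ∧ ∑' m, wt δ a m ≤ Z := by
  have h := summable_of_sum_le (wt_nonneg δ a) (hZ a)
  exact ⟨h, h.tsum_le_of_sum_le (hZ a)⟩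

lemma dual_bound {N : ℕ} {δ C0 Z X y : ℝ} (hN : 12 ≤ N) (h0 : 0 < δ) (hδ : δ ≤ 1/4)
    (hC0 : ∀ m : ℕ, (r2 m : ℝ) ≤ C0 * (1 + (m:ℝ)) ^ δ) (hZ : ∀ a : ℝ, ∀ s : Finset ℕ, ∑ m ∈ s, wt δ a m ≤ Z)
    (hNX : (N:ℝ) ≤ X) (hXN : X < N + 1)
    (hy : tN N / 2 ≤ y - 1/2) {K : ℕ} (hK : (y + 1/2) ^ 2 ≤ K) :
    |∑ m ∈ Finset.range K, (r2 m : ℝ) * PhiK N y (sqrt m) -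
      ∑ m ∈ Finset.range (⌊X ^ 2⌋₊ + 1), (r2 m : ℝ) * mainT X y m| ≤
      (232 * C0 + 2 * |AF 0|) * ((4 + log (tN N)) * ((17 * tN N ^ 2) ^ δ) ^ 2 / tN N) * (Z + Z) := by
  have hT : 12 ≤ tN N := by unfold tN; have : (12:ℝ) ≤ N := by exact_mod_cast hN
                            linarith
  have hX0 : 0 < X := by unfold tN at hT; linarith
  set T := tN N with hTd
  have hTp : 0 < T := by linarith
  have hlog : 0 ≤ log T := Real.log_nonneg (by linarith)
  set Q := (17 * T ^ 2) ^ δ with hQ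
  have hQ1 : 1 ≤ Q := Real.one_le_rpow (by nlinarith) h0.le
  have hC0' : 1 ≤ C0 := by
    have := hC0 0
    rw [r2_zero] at this
    simpa using this
  set V := (4 + log T) * Q ^ 2 / T with hV
  have hV0 : 0 ≤ V := by positivity
  have hq : 1 ≤ Q ^ 2 := one_le_pow₀ hQ1
  set d : ℕ → ℝ := fun m => (r2 m : ℝ) * (cM N y m - mainT X y m) with hd
  have hdb : ∀ m, |d m| ≤ (232 * C0 + 2 * |AF 0|) * V * (wt δ 0 m + wt δ (T ^ 2) m) := by
    intro m
    have w0 := wt_nonneg δ 0 m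
    have w1 := wt_nonneg δ (T^2) m
    simp only [hd]
    rw [abs_mul, Nat.abs_cast]
    rcases Nat.eq_zero_or_pos m with rfl | hm
    · have hc := coef_zero N y
      rw [r2_zero, wt_zero]
      rw [wt_zero] at w0
      have e : cM N y 0 - mainT X y 0 = (∫ u in (-(1/2):ℝ)..(1/2), dK N u * ((y+u)^2 * AF ((y+u)*0))) - y^2*AF 0 := by
        simp [cM, mainT]
      rw [e, Nat.cast_one, one_mul]
      refine hc.trans ?_
      rw [← hTd]
      calc 2 * |AF 0| / T = 2 * |AF 0| * (1 / T) * 1 := by ring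
        _ ≤ (232 * C0 + 2 * |AF 0|) * V * (1 + wt δ (T ^ 2) 0) := by
          have : 1 / T ≤ V := by
            rw [hV]; gcongr; nlinarith
          gcongr
          · linarith
          · linarith
    · refine (term_bound hN h0 hδ hC0 hNX hXN hy hm).trans ?_
      rw [← hTd, ← hQ, ← hV]
      gcongr
      linarith [abs_nonneg (AF 0)]
  obtain ⟨s0, t0⟩ := wt_summable hZ 0
  obtain ⟨s1, t1⟩ := wt_summable hZ (T ^ 2)
  have hB : Summable fun m => (232 * C0 + 2 * |AF 0|) * V * (wt δ 0 m + wt δ (T ^ 2) m) :=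
    (s0.add s1).mul_left _
  have hds : Summable d := Summable.of_norm_bounded hB (fun m => by rw [Real.norm_eq_abs]; exact hdb m)
  have hmainS : HasSum (fun m => (r2 m : ℝ) * mainT X y m)
      (∑ m ∈ Finset.range (⌊X ^ 2⌋₊ + 1), (r2 m : ℝ) * mainT X y m) := by
    apply hasSum_sum_of_ne_finset_zero
    intro m hm
    rw [Finset.mem_range, not_lt] at hm
    have : ¬ ((m:ℝ) ≤ X ^ 2) := by
      intro h
      have := Nat.le_floor h
      omega
    unfold mainT
    rw [if_neg (by omega), if_neg this, mul_zero]
  have hcs : Summable fun m => (r2 m : ℝ) * cM N y m := by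
    refine (hds.add hmainS.summable).congr ?_
    intro m
    simp only [hd]; ring
  have hcs' : Summable fun m : ℕ => (r2 m : ℝ) * |cM N y m| := by
    refine hcs.abs.congr ?_
    intro m
    rw [abs_mul, Nat.abs_cast]
  have hP := poisson_r2 N (by linarith) hcs' hK
  have hD : HasSum d (∑ m ∈ Finset.range K, (r2 m : ℝ) * PhiK N y (sqrt m) -
      ∑ m ∈ Finset.range (⌊X ^ 2⌋₊ + 1), (r2 m : ℝ) * mainT X y m) := by
    have e : d = fun m => (r2 m : ℝ) * cM N y m - (r2 m : ℝ) * mainT X y m := by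
      funext m
      simp only [hd]; ring
    rw [e]
    exact hP.sub hmainS
  rw [← hD.tsum_eq]
  rw [← Real.norm_eq_abs]
  refine (tsum_of_norm_bounded hB.hasSum (fun m => by rw [Real.norm_eq_abs]; exact hdb m)).trans ?_
  rw [tsum_mul_left, s0.tsum_add s1]
  gcongr

lemma primal_bound {N : ℕ} {δ C0 Z y : ℝ} (hN : 12 ≤ N) (h0 : 0 < δ)
    (hC0 : ∀ m : ℕ, (r2 m : ℝ) ≤ C0 * (1 + (m:ℝ)) ^ δ) (hZ : ∀ a : ℝ, ∀ s : Finset ℕ, ∑ m ∈ s, wt δ a m ≤ Z)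
    (hy : tN N / 2 ≤ y - 1/2) (hy2 : y ≤ 3 * tN N) (K : ℕ) :
    |∑ m ∈ Finset.range K, (r2 m : ℝ) * PhiK N y (sqrt m) -
      ∑ m ∈ Finset.range K, (r2 m : ℝ) * gP (sqrt m) y| ≤
      7000 * C0 * ((4 + log (tN N)) * ((17 * tN N ^ 2) ^ δ) ^ 2 / tN N) * Z := by
  have hT : 12 ≤ tN N := by unfold tN; have : (12:ℝ) ≤ N := by exact_mod_cast hN
                            linarith
  set T := tN N with hTd
  have hTp : 0 < T := by linarith
  have hlog : 0 ≤ log T := Real.log_nonneg (by linarith)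
  set Q := (17 * T ^ 2) ^ δ with hQ
  have hQ0 : 0 < Q := by positivity
  have hC0' : 1 ≤ C0 := by
    have := hC0 0
    rw [r2_zero] at this
    simpa using this
  set V := (4 + log T) * Q ^ 2 / T with hV
  have hV0 : 0 ≤ V := by positivity
  have hterm : ∀ m : ℕ, |(r2 m : ℝ) * PhiK N y (sqrt m) - (r2 m : ℝ) * gP (sqrt m) y| ≤
      7000 * C0 * V * wt δ (y ^ 2) m := by
    intro m
    have w1 := wt_nonneg δ (y^2) m
    rw [← mul_sub, abs_mul, Nat.abs_cast]
    have hsq : sqrt m ^ 2 = (m:ℝ) := Real.sq_sqrt (by positivity)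
    have hs0 : 0 ≤ sqrt (m:ℝ) := Real.sqrt_nonneg _
    rcases le_or_gt (y + 1/2) (sqrt m) with h | h
    · have := primal_gP_zero N (by linarith) h
      unfold PhiK
      rw [this, abs_zero, mul_zero]
      positivity
    · have hp := primal_gP N hN (y := y) (ν := sqrt m) (by rw [← hTd]; exact hy) hs0
      rw [← hTd] at hp
      have hm16 : (m:ℝ) ≤ 16 * T ^ 2 := by
        rw [← hsq]; nlinarith
      have hT2 : 144 ≤ T ^ 2 := by nlinarith
      have hr : (r2 m : ℝ) ≤ C0 * Q := (hC0 m).trans (by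
        rw [hQ]; gcongr; linarith)
      have hpos : 0 < 1 + |(m:ℝ) - y ^ 2| := by positivity
      have h1 : 1 + |(m:ℝ) - y ^ 2| ≤ 7 * (1 + T * |sqrt m - y|) := by
        have : (m:ℝ) - y ^ 2 = (sqrt m - y) * (sqrt m + y) := by nlinarith
        rw [this, abs_mul, abs_of_nonneg (by linarith : 0 ≤ sqrt m + y)]
        nlinarith [abs_nonneg (sqrt m - y)]
      have h2 : 1 / (1 + |(m:ℝ) - y ^ 2|) ≤ Q * wt δ (y ^ 2) m := by
        apply recip_le h0 hpos
        have : |(m:ℝ) - y ^ 2| ≤ 16 * T ^ 2 := by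
          rw [abs_le]; constructor <;> nlinarith
        linarith
      have h3 : |PhiK N y (sqrt m) - gP (sqrt m) y| ≤ 7000 * ((4 + log T) / T) * (Q * wt δ (y ^ 2) m) := by
        refine hp.trans ?_
        calc 1000 * (4 + log T) / (T * (1 + T * |sqrt m - y|))
            ≤ 1000 * (4 + log T) / (T * ((1 + |(m:ℝ) - y ^ 2|) / 7)) := by
              gcongr
              linarith
          _ = 7000 * ((4 + log T) / T) * (1 / (1 + |(m:ℝ) - y ^ 2|)) := by
              field_simp; norm_num
          _ ≤ _ := by gcongr
      calc (r2 m : ℝ) * |PhiK N y (sqrt m) - gP (sqrt m) y|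
          ≤ (C0 * Q) * (7000 * ((4 + log T) / T) * (Q * wt δ (y ^ 2) m)) := by gcongr
        _ = _ := by rw [hV]; ring
  rw [← Finset.sum_sub_distrib]
  refine (Finset.abs_sum_le_sum_abs _ _).trans ((Finset.sum_le_sum fun m _ => hterm m).trans ?_)
  rw [← Finset.mul_sum]
  gcongr
  exact hZ _ _

lemma gP_sqrt (m : ℕ) (y : ℝ) : gP (sqrt m) y = sqrt (1 - (m:ℝ) ^ 2 / y ^ 4) := by
  unfold gP
  have : sqrt (m:ℝ) ^ 4 = (m:ℝ) ^ 2 := by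
    rw [show (4:ℕ) = 2 * 2 from rfl, pow_mul, Real.sq_sqrt (by positivity)]
  rw [this]

lemma r2_bound' (δ : ℝ) (hδ : 0 < δ) : ∃ C0 : ℝ, 1 ≤ C0 ∧ ∀ m : ℕ, (r2 m : ℝ) ≤ C0 * (1 + (m:ℝ)) ^ δ := by
  obtain ⟨C, hC, h⟩ := r2_bound δ hδ
  refine ⟨C + 1, by linarith, ?_⟩
  intro m
  rcases Nat.eq_zero_or_pos m with rfl | hm
  · rw [r2_zero]; simp; linarith
  · refine (h m (by omega)).trans ?_
    gcongr <;> linarith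

/-- the cosine sum -/
def cosS (X y : ℝ) : ℝ := ∑ m ∈ Finset.Icc 1 ⌊X ^ 2⌋₊, (r2 m : ℝ) / m * cos (2 * π * sqrt m * y)

lemma mainT_sum (X y : ℝ) (hX : 0 ≤ X) : ∑ m ∈ Finset.range (⌊X ^ 2⌋₊ + 1), (r2 m : ℝ) * mainT X y m =
    y ^ 2 * AF 0 - sqrt 2 / (2 * π) * cosS X y := by
  rw [Finset.sum_range_succ', cosS, Finset.mul_sum, r2_zero, sub_eq_neg_add, ← Finset.sum_neg_distrib]
  congr 1
  · rw [Finset.range_eq_Ico, Finset.sum_Ico_add' (fun m => (r2 m : ℝ) * mainT X y m) 0 _ 1]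
    apply Finset.sum_congr
    · ext m; simp
    · intro m hm
      rw [Finset.mem_Icc] at hm
      have : (m:ℝ) ≤ X ^ 2 := (Nat.le_floor_iff (by positivity)).1 hm.2
      unfold mainT
      rw [if_neg (by omega), if_pos this]
      ring
  · simp [mainT]

lemma V_bound {δ X : ℝ} (h0 : 0 < δ) (hδ : δ ≤ 1/4) {N : ℕ} (hN : 12 ≤ N) (hNX : (N:ℝ) ≤ X) (hXN : X < N + 1) :
    (4 + log (tN N)) * ((17 * tN N ^ 2) ^ δ) ^ 2 / tN N ≤ (4 + 1 / δ) * 18496 * X ^ (-1 + 5 * δ) := by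
  have hN' : (12:ℝ) ≤ N := by exact_mod_cast hN
  have hT : 12 ≤ tN N := by unfold tN; linarith
  have hT1 : tN N ≤ 2 * X := by unfold tN; linarith
  have hT2 : X / 2 ≤ tN N := by unfold tN; linarith
  have hX : 12 ≤ X := by linarith
  set T := tN N
  have hX0 : 0 < X := by linarith
  have hT0 : 0 < T := by linarith
  have hpw : ∀ c : ℝ, 1 ≤ c → c ^ δ ≤ c := fun c hc => by
    calc c ^ δ ≤ c ^ (1:ℝ) := Real.rpow_le_rpow_of_exponent_le hc (by linarith)
      _ = c := Real.rpow_one c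
  have hTd : T ^ δ ≤ 2 * X ^ δ := by
    calc T ^ δ ≤ (2 * X) ^ δ := by gcongr
      _ = 2 ^ δ * X ^ δ := Real.mul_rpow (by norm_num) hX0.le
      _ ≤ _ := by gcongr; exact hpw 2 (by norm_num)
  have h1 : 4 + log T ≤ (4 + 1 / δ) * (2 * X ^ δ) := by
    have hl := Real.log_le_rpow_div hT0.le h0
    have h1T : 1 ≤ T ^ δ := Real.one_le_rpow (by linarith) h0.le
    calc 4 + log T ≤ 4 * T ^ δ + T ^ δ / δ := by linarith
      _ = (4 + 1 / δ) * T ^ δ := by ring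
      _ ≤ _ := by gcongr
  have h2 : (17 * T ^ 2) ^ δ ≤ 68 * (X ^ δ) ^ 2 := by
    calc (17 * T ^ 2) ^ δ ≤ (68 * X ^ 2) ^ δ := by
          apply Real.rpow_le_rpow (by positivity) _ h0.le
          nlinarith
      _ = 68 ^ δ * (X ^ δ) ^ 2 := by
          rw [Real.mul_rpow (by norm_num) (by positivity), ← Real.rpow_natCast X, ← Real.rpow_natCast (X ^ δ),
            ← Real.rpow_mul hX0.le, ← Real.rpow_mul hX0.le, mul_comm δ]
      _ ≤ _ := by gcongr; exact hpw 68 (by norm_num)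
  have h3 : 1 / T ≤ 2 / X := by
    rw [div_le_div_iff₀ hT0 hX0]; linarith
  have e : X ^ (-1 + 5 * δ) = (X ^ δ) ^ 5 / X := by
    rw [← Real.rpow_natCast (X ^ δ), ← Real.rpow_mul hX0.le, neg_add_eq_sub, Real.rpow_sub hX0, Real.rpow_one]
    congr 2
    push_cast; ring
  have hl0 : 0 ≤ log T := Real.log_nonneg (by linarith)
  calc (4 + log T) * ((17 * T ^ 2) ^ δ) ^ 2 / T = (4 + log T) * ((17 * T ^ 2) ^ δ) ^ 2 * (1 / T) := by ring
    _ ≤ ((4 + 1 / δ) * (2 * X ^ δ)) * (68 * (X ^ δ) ^ 2) ^ 2 * (2 / X) := by gcongr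
    _ = _ := by rw [e]; ring

lemma sigma_expansion (ε : ℝ) (hε : 0 < ε) : ∃ C > 0, ∀ X ≥ (12:ℝ), ∀ y ∈ Set.Icc X (2 * X + 1/2),
    |∑ m ∈ Finset.range (⌊y ^ 2⌋₊ + 1), (r2 m : ℝ) * sqrt (1 - (m:ℝ) ^ 2 / y ^ 4)
      - (y ^ 2 * AF 0 - sqrt 2 / (2 * π) * cosS X y)| ≤ C * X ^ (-1 + ε) := by
  set δ := min ε 1 / 5 with hδd
  have hm0 : 0 < min ε 1 := lt_min hε one_pos
  have h0 : 0 < δ := by positivity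
  have hδ : δ ≤ 1/4 := by have := min_le_right ε 1; rw [hδd]; linarith
  have hδε : 5 * δ ≤ ε := by have := min_le_left ε 1; rw [hδd]; linarith
  obtain ⟨C0, hC1, hC0⟩ := r2_bound' δ h0
  obtain ⟨Z, hZ0, hZ⟩ := wt_sum δ h0
  refine ⟨(7000 * C0 * Z + (232 * C0 + 2 * |AF 0|) * (Z + Z)) * ((4 + 1 / δ) * 18496), by positivity, ?_⟩
  intro X hX y hy
  set N := ⌊X⌋₊ with hNd
  have hN : 12 ≤ N := Nat.le_floor (by exact_mod_cast hX)
  have hNX : (N:ℝ) ≤ X := Nat.floor_le (by linarith)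
  have hXN : X < N + 1 := Nat.lt_floor_add_one X
  have hN' : (12:ℝ) ≤ N := by exact_mod_cast hN
  have hyT : tN N / 2 ≤ y - 1/2 := by unfold tN; linarith [hy.1]
  have hyT2 : y ≤ 3 * tN N := by unfold tN; linarith [hy.2]
  obtain ⟨K, hK⟩ := exists_nat_ge ((y + 1/2) ^ 2)
  have hy0 : 0 < y := by linarith [hy.1]
  have e1 : ∑ m ∈ Finset.range K, (r2 m : ℝ) * gP (sqrt m) y =
      ∑ m ∈ Finset.range (⌊y ^ 2⌋₊ + 1), (r2 m : ℝ) * sqrt (1 - (m:ℝ) ^ 2 / y ^ 4) := by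
    simp only [gP_sqrt]
    symm
    apply Finset.sum_subset
    · intro m hm
      rw [Finset.mem_range] at hm ⊢
      have : (m:ℝ) ≤ y ^ 2 := (Nat.le_floor_iff (by positivity)).1 (by omega)
      have h : (m:ℝ) < K := by nlinarith
      exact_mod_cast h
    · intro m _ hm
      rw [Finset.mem_range, not_lt] at hm
      have : y ^ 2 < m := (Nat.floor_lt (by positivity)).1 (by omega)
      rw [Real.sqrt_eq_zero_of_nonpos, mul_zero]
      rw [sub_nonpos, one_le_div (by positivity)]
      calc y ^ 4 = (y ^ 2) ^ 2 := by ring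
        _ ≤ _ := by gcongr
  have hp := primal_bound hN h0 hC0 hZ hyT hyT2 K
  have hd := dual_bound hN h0 hδ hC0 hZ hNX hXN hyT hK
  have hv := V_bound h0 hδ hN hNX hXN
  rw [e1] at hp
  rw [mainT_sum X y (by linarith)] at hd
  set V := (4 + log (tN N)) * ((17 * tN N ^ 2) ^ δ) ^ 2 / tN N with hV
  have hXe : X ^ (-1 + 5 * δ) ≤ X ^ (-1 + ε) := Real.rpow_le_rpow_of_exponent_le (by linarith) (by linarith)
  have hV2 : V ≤ ((4 + 1 / δ) * 18496) * X ^ (-1 + ε) := hv.trans (by gcongr)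
  rw [abs_le] at hp hd
  rw [abs_le]
  have hfin : (7000 * C0 * Z + (232 * C0 + 2 * |AF 0|) * (Z + Z)) * V ≤
    (7000 * C0 * Z + (232 * C0 + 2 * |AF 0|) * (Z + Z)) * (((4 + 1 / δ) * 18496) * X ^ (-1 + ε)) := by gcongr
  constructor <;> linarith [hp.1, hp.2, hd.1, hd.2]

lemma cyganBall_eq : cyganBall = {u : ℝ × ℝ × ℝ | (u.1 ^ 2 + u.2.1 ^ 2) ^ 2 + u.2.2 ^ 2 ≤ 1} := by
  ext u
  simp only [cyganBall, cyganNorm, Set.mem_ofPred_eq]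
  have h0 : 0 ≤ (u.1 ^ 2 + u.2.1 ^ 2) ^ 2 + u.2.2 ^ 2 := by positivity
  constructor
  · intro h
    by_contra hh
    push Not at hh
    have := Real.one_lt_rpow hh (by norm_num : (0:ℝ) < 1/4)
    linarith
  · intro h
    exact Real.rpow_le_one h0 h (by norm_num)

lemma slice_int (s : ℝ) : Integrable fun t : ℝ => 2 * sqrt (1 - (s ^ 2 + t ^ 2) ^ 2) := by
  apply Continuous.integrable_of_hasCompactSupport
  · fun_prop
  · apply HasCompactSupport.of_support_subset_isCompact (isCompact_Icc (a := (-1:ℝ)) (b := 1))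
    intro t ht
    rw [Function.mem_support] at ht
    by_contra h
    apply ht
    rw [Real.sqrt_eq_zero_of_nonpos, mul_zero]
    have h1 : 1 < |t| := by
      by_contra h2
      push Not at h2
      exact h (abs_le.1 h2)
    have h2 : 1 < t ^ 2 := by rw [← sq_abs]; nlinarith
    nlinarith [sq_nonneg s]

lemma volB_eq : volB = 2 * AF 0 := by
  have hA : AF 0 = ∫ s : ℝ, ∫ t : ℝ, sqrt (1 - (s ^ 2 + t ^ 2) ^ 2) := by
    rw [AF_prod]; simp
  have hmeas : MeasurableSet {u : ℝ × ℝ × ℝ | (u.1 ^ 2 + u.2.1 ^ 2) ^ 2 + u.2.2 ^ 2 ≤ 1} :=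
    measurableSet_le (by fun_prop) (by fun_prop)
  have hvol : volume cyganBall = ∫⁻ s : ℝ, ENNReal.ofReal (∫ t : ℝ, 2 * sqrt (1 - (s ^ 2 + t ^ 2) ^ 2)) := by
    rw [cyganBall_eq, Measure.volume_eq_prod, Measure.prod_apply hmeas]
    apply lintegral_congr
    intro s
    rw [Measure.volume_eq_prod, Measure.prod_apply (hmeas.preimage measurable_prodMk_left),
      ofReal_integral_eq_lintegral_ofReal (slice_int s) (ae_of_all _ fun t => by positivity)]
    apply lintegral_congr
    intro t
    rcases le_or_gt 0 (1 - (s ^ 2 + t ^ 2) ^ 2) with h | h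
    · have : (Prod.mk t ⁻¹' (Prod.mk s ⁻¹' {u : ℝ × ℝ × ℝ | (u.1 ^ 2 + u.2.1 ^ 2) ^ 2 + u.2.2 ^ 2 ≤ 1})) =
          Set.Icc (-sqrt (1 - (s ^ 2 + t ^ 2) ^ 2)) (sqrt (1 - (s ^ 2 + t ^ 2) ^ 2)) := by
        ext c
        simp only [Set.mem_preimage, Set.mem_ofPred_eq, Set.mem_Icc]
        rw [← abs_le]
        constructor
        · intro hc
          apply Real.abs_le_sqrt; linarith
        · intro hc
          have := pow_le_pow_left₀ (abs_nonneg c) hc 2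
          rw [sq_abs, Real.sq_sqrt h] at this
          linarith
      rw [this, Real.volume_Icc]
      congr 1; ring
    · have : (Prod.mk t ⁻¹' (Prod.mk s ⁻¹' {u : ℝ × ℝ × ℝ | (u.1 ^ 2 + u.2.1 ^ 2) ^ 2 + u.2.2 ^ 2 ≤ 1})) = ∅ := by
        ext c
        simp only [Set.mem_preimage, Set.mem_ofPred_eq, Set.mem_empty_iff_false, iff_false, not_le]
        nlinarith [sq_nonneg c]
      rw [this, Real.sqrt_eq_zero_of_nonpos h.le]
      simp
  unfold volB
  rw [hvol, hA, ← integral_eq_lintegral_of_nonneg_ae]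
  · rw [← integral_const_mul]
    congr 1; ext s
    rw [integral_const_mul]
  · exact ae_of_all _ fun s => integral_nonneg fun t => by positivity
  · have : StronglyMeasurable fun p : ℝ × ℝ => 2 * sqrt (1 - (p.1 ^ 2 + p.2 ^ 2) ^ 2) :=
      (by fun_prop : Continuous fun p : ℝ × ℝ => 2 * sqrt (1 - (p.1 ^ 2 + p.2 ^ 2) ^ 2)).stronglyMeasurable
    exact this.integral_prod_right.aestronglyMeasurable

lemma heis_mem {x : ℝ} (hx : 0 < x) (a b c : ℝ) :
    (a, b, c) ∈ heisDil x '' cyganBall ↔ (a ^ 2 + b ^ 2) ^ 2 + c ^ 2 ≤ x ^ 4 := by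
  rw [cyganBall_eq]
  simp only [Set.mem_image, heisDil, Set.mem_ofPred_eq, Prod.mk.injEq]
  constructor
  · rintro ⟨u, hu, rfl, rfl, rfl⟩
    have : ((x * u.1) ^ 2 + (x * u.2.1) ^ 2) ^ 2 + (x ^ 2 * u.2.2) ^ 2 =
      x ^ 4 * ((u.1 ^ 2 + u.2.1 ^ 2) ^ 2 + u.2.2 ^ 2) := by ring
    rw [this]
    nlinarith [pow_pos hx 4]
  · intro h
    refine ⟨(a / x, b / x, c / x ^ 2), ?_, by field_simp, by field_simp, by field_simp⟩
    have : ((a / x) ^ 2 + (b / x) ^ 2) ^ 2 + (c / x ^ 2) ^ 2 = ((a ^ 2 + b ^ 2) ^ 2 + c ^ 2) / x ^ 4 := by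
      field_simp
    simp only
    rw [this, div_le_one (by positivity)]
    exact h

lemma latticeCount_eq {x : ℝ} (hx : 0 < x) : latticeCount x =
    ∑ m ∈ Finset.range (⌊x ^ 2⌋₊ + 1), r2 m * (2 * ⌊sqrt (x ^ 4 - (m:ℝ) ^ 2)⌋₊ + 1) := by
  classical
  let k : ℕ → ℤ := fun m => (⌊sqrt (x ^ 4 - (m:ℝ) ^ 2)⌋₊ : ℤ)
  let F : Finset ((ℤ × ℤ) × ℤ) := (Finset.range (⌊x ^ 2⌋₊ + 1)).biUnion fun m =>
    (sq_sum_finite m).toFinset ×ˢ Finset.Icc (-(k m)) (k m)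
  have hcard : F.card = ∑ m ∈ Finset.range (⌊x ^ 2⌋₊ + 1), r2 m * (2 * ⌊sqrt (x ^ 4 - (m:ℝ) ^ 2)⌋₊ + 1) := by
    rw [Finset.card_biUnion]
    · apply Finset.sum_congr rfl
      intro m _
      rw [Finset.card_product, Int.card_Icc]
      congr 1
      · unfold r2
        rw [Set.ncard_eq_toFinset_card _ (sq_sum_finite m)]
      · simp only [k]; omega
    · intro m _ m' _ hne
      refine Finset.disjoint_left.2 ?_
      rintro ⟨p, c⟩ h1 h2
      simp only [Finset.mem_product, Set.Finite.mem_toFinset, Set.mem_ofPred_eq] at h1 h2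
      apply hne
      have := h1.1.symm.trans h2.1
      exact_mod_cast this
  rw [← hcard, ← Set.ncard_coe_finset]
  unfold latticeCount
  rw [← Set.ncard_image_of_injective _ (Equiv.prodAssoc ℤ ℤ ℤ).symm.injective]
  congr 1
  ext ⟨⟨a, b⟩, c⟩
  simp only [Set.mem_image, Finset.mem_coe, F, Finset.mem_biUnion, Finset.mem_range, Finset.mem_product,
    Set.Finite.mem_toFinset, Set.mem_ofPred_eq, Finset.mem_Icc]
  have hL : (∃ p : ℤ × ℤ × ℤ, ((p.1 : ℝ), (p.2.1 : ℝ), (p.2.2 : ℝ)) ∈ heisDil x '' cyganBall ∧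
      (Equiv.prodAssoc ℤ ℤ ℤ).symm p = ((a, b), c)) ↔ ((a:ℝ) ^ 2 + (b:ℝ) ^ 2) ^ 2 + (c:ℝ) ^ 2 ≤ x ^ 4 := by
    constructor
    · rintro ⟨p, h1, h2⟩
      rw [heis_mem hx] at h1
      simp only [Equiv.prodAssoc_symm_apply, Prod.mk.injEq] at h2
      obtain ⟨⟨rfl, rfl⟩, rfl⟩ := h2
      exact h1
    · intro h
      exact ⟨(a, b, c), (heis_mem hx _ _ _).2 h, rfl⟩
  refine hL.trans ?_
  have key : ∀ m : ℕ, (m:ℝ) ^ 2 ≤ x ^ 4 → ((-(k m) ≤ c ∧ c ≤ k m) ↔ (c:ℝ) ^ 2 ≤ x ^ 4 - (m:ℝ) ^ 2) := by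
    intro m hm
    rw [← abs_le]
    simp only [k]
    rw [Int.abs_eq_natAbs, Nat.cast_le, Nat.le_floor_iff (Real.sqrt_nonneg _)]
    rw [Real.le_sqrt (by positivity) (by linarith), Nat.cast_natAbs, Int.cast_abs, sq_abs]
  constructor
  · intro h
    refine ⟨(a ^ 2 + b ^ 2).toNat, ?_, ?_, ?_⟩
    · have hc : (((a ^ 2 + b ^ 2).toNat : ℕ) : ℝ) = (a:ℝ) ^ 2 + (b:ℝ) ^ 2 := by
        have : (((a ^ 2 + b ^ 2).toNat : ℕ) : ℤ) = a ^ 2 + b ^ 2 := Int.toNat_of_nonneg (by positivity)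
        exact_mod_cast congrArg (Int.cast (R := ℝ)) this
      apply Nat.lt_succ_of_le
      apply Nat.le_floor
      rw [hc]
      refine (sq_le_sq₀ (by positivity) (by positivity)).1 ?_
      nlinarith [sq_nonneg (c:ℝ)]
    · exact (Int.toNat_of_nonneg (by positivity)).symm
    · have hc : (((a ^ 2 + b ^ 2).toNat : ℕ) : ℝ) = (a:ℝ) ^ 2 + (b:ℝ) ^ 2 := by
        have : (((a ^ 2 + b ^ 2).toNat : ℕ) : ℤ) = a ^ 2 + b ^ 2 := Int.toNat_of_nonneg (by positivity)
        exact_mod_cast congrArg (Int.cast (R := ℝ)) this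
      rw [key _ (by rw [hc]; nlinarith [sq_nonneg (c:ℝ)]), hc]
      linarith
  · rintro ⟨m, hm, hab, hc⟩
    have hm' : (m:ℝ) ≤ x ^ 2 := (Nat.le_floor_iff (by positivity)).1 (by omega)
    have hm2 : (m:ℝ) ^ 2 ≤ x ^ 4 := by
      calc (m:ℝ) ^ 2 ≤ (x ^ 2) ^ 2 := by gcongr
        _ = x ^ 4 := by ring
    rw [key m hm2] at hc
    have : (a:ℝ) ^ 2 + (b:ℝ) ^ 2 = m := by exact_mod_cast hab
    rw [this]; linarith

/-- the sawtooth sum at one radius -/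
def psiS (x : ℝ) : ℝ := ∑ m ∈ Finset.Icc 1 ⌊x ^ 2⌋₊, (r2 m : ℝ) * sawtooth (sqrt (x ^ 4 - (m:ℝ) ^ 2))

lemma latticeCount_saw {x : ℝ} (hx : 0 < x) : (latticeCount x : ℝ) =
    2 * x ^ 2 * ∑ m ∈ Finset.range (⌊x ^ 2⌋₊ + 1), (r2 m : ℝ) * sqrt (1 - (m:ℝ) ^ 2 / x ^ 4)
      - 2 * psiS x - 2 * sawtooth (x ^ 2) := by
  have h1 : (latticeCount x : ℝ) = ∑ m ∈ Finset.range (⌊x ^ 2⌋₊ + 1),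
      (2 * x ^ 2 * ((r2 m : ℝ) * sqrt (1 - (m:ℝ) ^ 2 / x ^ 4)) -
        2 * ((r2 m : ℝ) * sawtooth (sqrt (x ^ 4 - (m:ℝ) ^ 2)))) := by
    rw [latticeCount_eq hx]
    push_cast
    apply Finset.sum_congr rfl
    intro m _
    have e : sqrt (x ^ 4 - (m:ℝ) ^ 2) = x ^ 2 * sqrt (1 - (m:ℝ) ^ 2 / x ^ 4) := by
      rw [← Real.sqrt_sq (by positivity : 0 ≤ x ^ 2), ← Real.sqrt_mul (by positivity)]
      congr 1
      field_simp
    have : 2 * x ^ 2 * ((r2 m : ℝ) * sqrt (1 - (m:ℝ) ^ 2 / x ^ 4)) = 2 * ((r2 m : ℝ) * sqrt (x ^ 4 - (m:ℝ) ^ 2)) := by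
      rw [e]; ring
    rw [this]
    unfold sawtooth
    rw [← natCast_floor_eq_intCast_floor (Real.sqrt_nonneg _)]
    ring
  rw [h1, Finset.sum_sub_distrib, ← Finset.mul_sum, ← Finset.mul_sum, sub_sub]
  congr 1
  rw [← mul_add]
  congr 1
  rw [Finset.sum_range_succ', psiS, r2_zero]
  congr 1
  · rw [Finset.range_eq_Ico, Finset.sum_Ico_add' (fun m : ℕ => (r2 m : ℝ) * sawtooth (sqrt (x ^ 4 - (m:ℝ) ^ 2))) 0 _ 1]
    rfl
  · simp only [Nat.cast_one, one_mul, Nat.cast_zero]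
    congr 1
    rw [show x ^ 4 - 0 ^ 2 = (x ^ 2) ^ 2 by ring, Real.sqrt_sq (by positivity)]

lemma sawtooth_abs (t : ℝ) : |sawtooth t| ≤ 1 / 2 := by
  unfold sawtooth
  rw [abs_le]
  constructor <;> linarith [Int.floor_le t, Int.lt_floor_add_one t]

lemma cosS_bound (ε : ℝ) (hε : 0 < ε) : ∃ C > 0, ∀ X ≥ (1:ℝ), ∀ y, |cosS X y| ≤ C * X ^ ε := by
  set δ := min ε 1 / 4 with hδd
  have hm0 : 0 < min ε 1 := lt_min hε one_pos
  have h0 : 0 < δ := by positivity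
  have hδ : δ ≤ 1/4 := by have := min_le_right ε 1; rw [hδd]; linarith
  have hδε : 4 * δ ≤ ε := by have := min_le_left ε 1; rw [hδd]; linarith
  obtain ⟨C0, hC1, hC0⟩ := r2_bound' δ h0
  obtain ⟨Z, hZ0, hZ⟩ := wt_sum δ h0
  refine ⟨8 * C0 * Z, by positivity, ?_⟩
  intro X hX y
  have hX0 : 0 < X := by linarith
  have hterm : ∀ m ∈ Finset.Icc 1 ⌊X ^ 2⌋₊, |(r2 m : ℝ) / m * cos (2 * π * sqrt m * y)| ≤
      8 * C0 * (X ^ δ) ^ 4 * wt δ 0 m := by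
    intro m hm
    rw [Finset.mem_Icc] at hm
    have hmX : (m:ℝ) ≤ X ^ 2 := (Nat.le_floor_iff (by positivity)).1 hm.2
    have hm1 : (1:ℝ) ≤ m := by exact_mod_cast hm.1
    have hX2 : (X ^ 2) ^ δ = (X ^ δ) ^ 2 := by
      rw [← Real.rpow_natCast X, ← Real.rpow_natCast (X ^ δ),
            ← Real.rpow_mul hX0.le, ← Real.rpow_mul hX0.le, mul_comm δ]
    have h1 : 1 / (m:ℝ) ≤ (X ^ 2) ^ δ * (m:ℝ) ^ (-(1 + δ)) := recip_le h0 (by positivity) hmX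
    have h5 := half_pow (δ := 1 + δ) (by linarith) (by linarith) hm.1
    have e : wt δ 0 m = (1 + (m:ℝ)) ^ (-(1 + δ)) := by
      unfold wt; rw [sub_zero, abs_of_nonneg (by positivity : (0:ℝ) ≤ m)]
    rw [← e] at h5
    have w0 := wt_nonneg δ 0 m
    have h2 : (1 + (m:ℝ)) ^ δ ≤ 2 * (X ^ δ) ^ 2 := by
      calc (1 + (m:ℝ)) ^ δ ≤ (2 * X ^ 2) ^ δ := Real.rpow_le_rpow (by positivity) (by nlinarith) h0.le
        _ = 2 ^ δ * (X ^ δ) ^ 2 := by rw [Real.mul_rpow (by norm_num) (by positivity), hX2]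
        _ ≤ 2 ^ (1:ℝ) * (X ^ δ) ^ 2 := by
          gcongr
          · norm_num
          · linarith
        _ = _ := by rw [Real.rpow_one]
    rw [abs_mul, abs_of_nonneg (by positivity : 0 ≤ (r2 m : ℝ) / m)]
    calc (r2 m : ℝ) / m * |cos (2 * π * sqrt m * y)| ≤ (r2 m : ℝ) / m * 1 := by
          gcongr; exact abs_cos_le_one _
      _ = (r2 m : ℝ) * (1 / m) := by ring
      _ ≤ (C0 * (2 * (X ^ δ) ^ 2)) * ((X ^ δ) ^ 2 * (4 * wt δ 0 m)) := by
          apply mul_le_mul _ _ (by positivity) (by positivity)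
          · exact (hC0 m).trans (by gcongr)
          · rw [hX2] at h1
            exact h1.trans (by gcongr)
      _ = _ := by ring
  unfold cosS
  refine (Finset.abs_sum_le_sum_abs _ _).trans ((Finset.sum_le_sum hterm).trans ?_)
  rw [← Finset.mul_sum]
  have hXe : (X ^ δ) ^ 4 ≤ X ^ ε := by
    rw [← Real.rpow_natCast (X ^ δ), ← Real.rpow_mul hX0.le]
    apply Real.rpow_le_rpow_of_exponent_le hX
    push_cast; linarith
  calc 8 * C0 * (X ^ δ) ^ 4 * ∑ m ∈ Finset.Icc 1 ⌊X ^ 2⌋₊, wt δ 0 m ≤ 8 * C0 * X ^ ε * Z := by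
        gcongr
        · exact Finset.sum_nonneg fun m _ => wt_nonneg _ _ _
        · exact hZ _ _
    _ = _ := by ring

lemma cosS_diff (X x w : ℝ) : cosS X (x + w) - cosS X x = -2 * ∑ m ∈ Finset.Icc 1 ⌊X ^ 2⌋₊,
    (r2 m : ℝ) / m * sin (π * sqrt m * w) * sin (π * sqrt m * (2 * x + w)) := by
  unfold cosS
  rw [← Finset.sum_sub_distrib, Finset.mul_sum]
  apply Finset.sum_congr rfl
  intro m _
  rw [← mul_sub, Real.cos_sub_cos]
  rw [show (2 * π * sqrt m * (x + w) + 2 * π * sqrt m * x) / 2 = π * sqrt m * (2 * x + w) by ring,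
    show (2 * π * sqrt m * (x + w) - 2 * π * sqrt m * x) / 2 = π * sqrt m * w by ring]
  ring

/-- Voronoï-type series expansion for `Ê(x;ω)`. -/
theorem voronoi_expansion (ω : ℝ → ℝ) (hω : OmegaClass ω) (ε : ℝ) (hε : 0 < ε) :
    ∃ C > (0 : ℝ), ∃ X₀ > (0 : ℝ), ∀ X ≥ X₀, ∀ x ∈ Set.Ioo X (2 * X),
      |Ehat ω x
          - (2 : ℝ) ^ ((3 : ℝ) / 2) / Real.pi *
            ∑ m ∈ Finset.Icc 1 ⌊X ^ 2⌋₊,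
              (r2 m : ℝ) / m * Real.sin (Real.pi * Real.sqrt m * ω x) *
                Real.sin (Real.pi * Real.sqrt m * (2 * x + ω x))
          + 2 / x ^ 2 * XiPsi ω x|
        ≤ C * X ^ (-1 + ε) := by
  obtain ⟨C1, hC1, hsig⟩ := sigma_expansion ε hε
  obtain ⟨C2, hC2, hcos⟩ := cosS_bound ε hε
  obtain ⟨X1, hX1⟩ := (hω.tendsto_zero.eventually (gt_mem_nhds (by norm_num : (0:ℝ) < 1/2))).exists_forall_of_atTop
  refine ⟨10 * C1 + 4 * C2 + 2, by positivity, max 12 X1, by positivity, ?_⟩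
  intro X hX x hx
  have hX12 : 12 ≤ X := (le_max_left _ _).trans hX
  have hX1' : X1 ≤ X := (le_max_right _ _).trans hX
  have hx0 : 0 < x := by linarith [hx.1]
  have hw0 := hω.pos x hx0
  have hw1 : ω x < 1/2 := hX1 x (by linarith [hx.1])
  set w := ω x with hw
  set S := ∑ m ∈ Finset.Icc 1 ⌊X ^ 2⌋₊,
              (r2 m : ℝ) / m * sin (π * sqrt m * w) * sin (π * sqrt m * (2 * x + w)) with hS
  have hcd := cosS_diff X x w
  rw [← hS] at hcd
  have ha := hsig X hX12 (x + w) ⟨by linarith [hx.1], by linarith [hx.2]⟩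
  have hb := hsig X hX12 x ⟨hx.1.le, by linarith [hx.2]⟩
  have hLa := latticeCount_saw (x := x + w) (by linarith)
  have hLb := latticeCount_saw hx0
  have hXi : XiPsi ω x = psiS (x + w) - psiS x := rfl
  set Sa := ∑ m ∈ Finset.range (⌊(x + w) ^ 2⌋₊ + 1), (r2 m : ℝ) * sqrt (1 - (m:ℝ) ^ 2 / (x + w) ^ 4)
  set Sb := ∑ m ∈ Finset.range (⌊x ^ 2⌋₊ + 1), (r2 m : ℝ) * sqrt (1 - (m:ℝ) ^ 2 / x ^ 4)
  set ea := Sa - ((x + w) ^ 2 * AF 0 - sqrt 2 / (2 * π) * cosS X (x + w)) with hea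
  set eb := Sb - (x ^ 2 * AF 0 - sqrt 2 / (2 * π) * cosS X x) with heb
  have h232 : (2:ℝ) ^ ((3:ℝ) / 2) = 2 * sqrt 2 := by
    rw [Real.sqrt_eq_rpow]
    rw [show (3:ℝ) / 2 = 1 + 1 / 2 by norm_num, Real.rpow_add (by norm_num), Real.rpow_one]
  have hsum : ∑ j ∈ Finset.Icc 1 4, (Nat.choose 4 j : ℝ) * x ^ (4 - j) * w ^ j = (x + w) ^ 4 - x ^ 4 := by
    rw [show Finset.Icc 1 4 = {1, 2, 3, 4} from rfl]
    simp [Nat.choose]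
    ring
  have hmain : Ehat ω x - (2 : ℝ) ^ ((3 : ℝ) / 2) / π * S + 2 / x ^ 2 * XiPsi ω x =
      2 * ((x + w) ^ 2 / x ^ 2) * ea - 2 * eb
        - sqrt 2 / π * (((x + w) ^ 2 / x ^ 2 - 1) * cosS X (x + w))
        - 2 / x ^ 2 * (sawtooth ((x + w) ^ 2) - sawtooth (x ^ 2)) := by
    unfold Ehat Eshell
    rw [← hw, hsum, hLa, hLb, hXi, h232, volB_eq]
    have e1 : Sa = ea + ((x + w) ^ 2 * AF 0 - sqrt 2 / (2 * π) * cosS X (x + w)) := by rw [hea]; ring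
    have e2 : Sb = eb + (x ^ 2 * AF 0 - sqrt 2 / (2 * π) * cosS X x) := by rw [heb]; ring
    have e3 : cosS X x = cosS X (x + w) + 2 * S := by linarith
    rw [e1, e2, e3]
    field_simp
    ring
  rw [hmain]
  set P := X ^ (-1 + ε) with hP
  have hX0 : 0 < X := by linarith
  have hr : (x + w) ^ 2 / x ^ 2 ≤ 4 := by
    rw [div_le_iff₀ (by positivity)]
    have g1 : (x + w) ^ 2 ≤ (2 * x) ^ 2 := pow_le_pow_left₀ (by linarith) (by linarith [hx.1]) 2
    linarith
  have hr2 : |(x + w) ^ 2 / x ^ 2 - 1| ≤ 2 / X := by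
    have e : (x + w) ^ 2 / x ^ 2 - 1 = (2 * x * w + w ^ 2) / x ^ 2 := by field_simp; ring
    rw [e, abs_of_pos (by positivity), div_le_div_iff₀ (by positivity) hX0]
    have g1 : x * w ≤ x * (1/2) := mul_le_mul_of_nonneg_left hw1.le hx0.le
    have g2 : w ^ 2 ≤ 1 := pow_le_one₀ hw0.le (by linarith)
    have g3 : (2 * x * w + w ^ 2) ≤ 2 * x := by linarith [hx.1]
    calc (2 * x * w + w ^ 2) * X ≤ 2 * x * x := mul_le_mul g3 hx.1.le hX0.le (by positivity)
      _ = 2 * x ^ 2 := by ring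
  have hPX : X ^ ε / X = P := by
    rw [hP, neg_add_eq_sub, Real.rpow_sub hX0, Real.rpow_one]
  have hP2 : 1 / x ^ 2 ≤ P := by
    rw [← hPX]
    have : 1 ≤ X ^ ε := Real.one_le_rpow (by linarith) hε.le
    rw [div_le_div_iff₀ (by positivity) hX0]
    have g1 : X * 1 ≤ x * x := mul_le_mul hx.1.le (by linarith [hx.1]) (by norm_num) hx0.le
    have g2 : 1 * x ^ 2 ≤ X ^ ε * x ^ 2 := by gcongr
    linarith
  have hP0 : 0 ≤ P := by positivity
  have hs2 : sqrt 2 / π ≤ 1 := by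
    rw [div_le_one (by positivity)]
    have h1 : sqrt 2 ≤ 2 := by rw [Real.sqrt_le_left (by norm_num)]; norm_num
    linarith [Real.pi_gt_three]
  have t1 : |2 * ((x + w) ^ 2 / x ^ 2) * ea| ≤ 8 * C1 * P := by
    rw [abs_mul, abs_of_pos (by positivity : 0 < 2 * ((x + w) ^ 2 / x ^ 2))]
    calc 2 * ((x + w) ^ 2 / x ^ 2) * |ea| ≤ 2 * 4 * (C1 * P) := by gcongr
      _ = _ := by ring
  have t2 : |2 * eb| ≤ 2 * C1 * P := by
    rw [abs_mul, abs_of_pos (by norm_num : (0:ℝ) < 2)]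
    linarith
  have t3 : |sqrt 2 / π * (((x + w) ^ 2 / x ^ 2 - 1) * cosS X (x + w))| ≤ 2 * C2 * P := by
    rw [abs_mul, abs_mul, abs_of_pos (by positivity : 0 < sqrt 2 / π)]
    calc sqrt 2 / π * (|(x + w) ^ 2 / x ^ 2 - 1| * |cosS X (x + w)|) ≤ 1 * (2 / X * (C2 * X ^ ε)) := by
          gcongr
          exact hcos X (by linarith) _
      _ = _ := by rw [← hPX]; ring
  have t4 : |2 / x ^ 2 * (sawtooth ((x + w) ^ 2) - sawtooth (x ^ 2))| ≤ 2 * P := by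
    rw [abs_mul, abs_of_pos (by positivity : 0 < 2 / x ^ 2)]
    have : |sawtooth ((x + w) ^ 2) - sawtooth (x ^ 2)| ≤ 1 := by
      have g1 := abs_le.1 (sawtooth_abs ((x + w) ^ 2))
      have g2 := abs_le.1 (sawtooth_abs (x ^ 2))
      rw [abs_le]; constructor <;> linarith [g1.1, g1.2, g2.1, g2.2]
    calc 2 / x ^ 2 * |sawtooth ((x + w) ^ 2) - sawtooth (x ^ 2)| ≤ 2 / x ^ 2 * 1 := by gcongr
      _ = 2 * (1 / x ^ 2) := by ring
      _ ≤ _ := by gcongr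
  have hCP : 0 ≤ C2 * P := by positivity
  rw [abs_le] at t1 t2 t3 t4 ⊢
  constructor <;> linarith [t1.1, t1.2, t2.1, t2.2, t3.1, t3.2, t4.1, t4.2]
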